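/- If u and v are fine superminimizers in a quasiopen set U, then min{u, v} is also a fine superminimizer in U, provided min{u,v} ∈ N^{1,p}_{fine-loc}(U). -/

import Mathlib

open MeasureTheory Metric Set Filter ENNReal

noncomputable section

variable {X : Type*} [MetricSpace X] [MeasurableSpace X] [BorelSpace X]

/-- A nonconstant compact rectifiable curve, parameterized by arc length
(modelled as a `1`-Lipschitz map on `[0, len]`). -/
structure Curve (X : Type*) [MetricSpace X] where
  len : ℝ
  len_pos : 0 < len
  toFun : ℝ → X
  lip : LipschitzOnWith 1 toFun (Set.Icc 0 len)

/-- The curve lies in the set `E`. -/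
def Curve.InSet (γ : Curve X) (E : Set X) : Prop :=
  ∀ t ∈ Set.Icc (0 : ℝ) γ.len, γ.toFun t ∈ E

/-- Line integral (w.r.t. arc length) of a nonnegative function along a curve. -/
def curveLint (γ : Curve X) (g : X → ℝ≥0∞) : ℝ≥0∞ :=
  ∫⁻ t in Set.Icc (0 : ℝ) γ.len, g (γ.toFun t)

/-- The `p`-modulus of a family of curves. -/
def pMod (μ : Measure X) (p : ℝ) (Γ : Set (Curve X)) : ℝ≥0∞ :=
  ⨅ (ρ : X → ℝ≥0∞) (_ : Measurable ρ) (_ : ∀ γ ∈ Γ, 1 ≤ curveLint γ ρ),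
    ∫⁻ x, ρ x ^ p ∂μ

/-- A property holds for `p`-almost every curve. -/
def AECurve (μ : Measure X) (p : ℝ) (P : Curve X → Prop) : Prop :=
  pMod μ p {γ | ¬ P γ} = 0

/-- `g` is a `p`-weak upper gradient of `f` on `E`. -/
def IsWeakUpperGradientOn (μ : Measure X) (p : ℝ) (f : X → ℝ) (g : X → ℝ≥0∞)
    (E : Set X) : Prop :=
  AECurve (μ.restrict E) p fun γ =>
    γ.InSet E → edist (f (γ.toFun 0)) (f (γ.toFun γ.len)) ≤ curveLint γ g

/-- The Newtonian `p`-energy `∫_E |f|^p dμ + inf_g ∫_E g^p dμ`,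
the `p`-th power of the Newtonian norm. -/
def npEnergy (μ : Measure X) (p : ℝ) (f : X → ℝ) (E : Set X) : ℝ≥0∞ :=
  (∫⁻ x in E, ENNReal.ofReal |f x| ^ p ∂μ) +
    ⨅ (g : X → ℝ≥0∞) (_ : Measurable g) (_ : IsWeakUpperGradientOn μ p f g E),
      ∫⁻ x in E, g x ^ p ∂μ

/-- The Newtonian norm `‖f‖_{N^{1,p}(E)}`. -/
def npNorm (μ : Measure X) (p : ℝ) (f : X → ℝ) (E : Set X) : ℝ≥0∞ :=
  npEnergy μ p f E ^ (1 / p)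

/-- Membership in the Newtonian space `N^{1,p}(E)`. -/
def MemNp (μ : Measure X) (p : ℝ) (f : X → ℝ) (E : Set X) : Prop :=
  Measurable f ∧ npEnergy μ p f E < ⊤

/-- The Sobolev capacity `C_p(E)`. -/
def sobolevCap (μ : Measure X) (p : ℝ) (E : Set X) : ℝ≥0∞ :=
  ⨅ (f : X → ℝ) (_ : MemNp μ p f Set.univ) (_ : ∀ x ∈ E, 1 ≤ f x),
    npEnergy μ p f Set.univ

/-- `f ∈ N^{1,p}_0(A)`: a global Newtonian function vanishing outside `A`. -/
def MemNp0 (μ : Measure X) (p : ℝ) (f : X → ℝ) (A : Set X) : Prop :=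
  MemNp μ p f Set.univ ∧ ∀ x ∉ A, f x = 0

/-- The variational capacity `cap_p(E, A)`. -/
def varCap (μ : Measure X) (p : ℝ) (E A : Set X) : ℝ≥0∞ :=
  ⨅ (f : X → ℝ) (_ : MemNp0 μ p f A) (_ : ∀ x ∈ E, 1 ≤ f x)
    (g : X → ℝ≥0∞) (_ : Measurable g)
    (_ : IsWeakUpperGradientOn μ p f g Set.univ),
    ∫⁻ x, g x ^ p ∂μ

/-- The Wiener-type integrand in the definition of thinness, with the
convention that it equals `1` when `cap_p(B(x,r), B(x,2r)) = 0`. -/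
def thinIntegrand (μ : Measure X) (p : ℝ) (E : Set X) (x : X) (r : ℝ) : ℝ≥0∞ :=
  if varCap μ p (ball x r) (ball x (2 * r)) = 0 then 1
  else (varCap μ p (E ∩ ball x r) (ball x (2 * r)) /
        varCap μ p (ball x r) (ball x (2 * r))) ^ (1 / (p - 1))

/-- `E` is thin at `x`:
`∫_0^1 (cap_p(E∩B(x,r),B(x,2r))/cap_p(B(x,r),B(x,2r)))^{1/(p-1)} dr/r < ∞`. -/
def Thin (μ : Measure X) (p : ℝ) (E : Set X) (x : X) : Prop :=
  ∫⁻ r in Set.Ioo (0 : ℝ) 1, thinIntegrand μ p E x r / ENNReal.ofReal r < ⊤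

/-- A set is finely open if its complement is thin at each of its points. -/
def FinelyOpen (μ : Measure X) (p : ℝ) (V : Set X) : Prop :=
  ∀ x ∈ V, Thin μ p Vᶜ x

/-- A set `U` is quasiopen if for every `ε > 0` there is an open set `G`
with `C_p(G) < ε` such that `G ∪ U` is open. -/
def Quasiopen (μ : Measure X) (p : ℝ) (U : Set X) : Prop :=
  ∀ ε : ℝ≥0∞, 0 < ε → ∃ G : Set X, IsOpen G ∧ sobolevCap μ p G < ε ∧ IsOpen (G ∪ U)

/-- The fine topology: the topology generated by the finely open sets. -/
def fineTopology (μ : Measure X) (p : ℝ) : TopologicalSpace X :=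
  TopologicalSpace.generateFrom {V | FinelyOpen μ p V}

/-- `A` is a `p`-strict subset of `E`. -/
def PStrictSubset (μ : Measure X) (p : ℝ) (A E : Set X) : Prop :=
  A ⊆ E ∧ ∃ η : X → ℝ, MemNp0 μ p η E ∧ ∀ x ∈ A, η x = 1

/-- `V` is a finely open `p`-strict subset of `U` with compact closure
contained in `U` (written `V ⋐ U`). -/
def GoodSubset (μ : Measure X) (p : ℝ) (V U : Set X) : Prop :=
  FinelyOpen μ p V ∧ PStrictSubset μ p V U ∧ IsCompact (closure V) ∧ closure V ⊆ U

/-- The fine local Newtonian space `N^{1,p}_{fine-loc}(U)`. -/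
def MemNpFineLoc (μ : Measure X) (p : ℝ) (f : X → ℝ) (U : Set X) : Prop :=
  ∀ V : Set X, GoodSubset μ p V U → MemNp μ p f V

/-- The local Newtonian space `N^{1,p}_loc(G)`. -/
def MemNpLoc (μ : Measure X) (p : ℝ) (f : X → ℝ) (G : Set X) : Prop :=
  ∀ x ∈ G, ∃ r : ℝ, 0 < r ∧ MemNp μ p f (ball x r ∩ G)

/-- `∫_S g_u^p dμ`, where `g_u` is the minimal `p`-weak upper gradient of `u`
taken with respect to `U`, expressed as the infimum of the energies of all
`p`-weak upper gradients of `u` on `U`. -/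
def fineEnergy (μ : Measure X) (p : ℝ) (u : X → ℝ) (U S : Set X) : ℝ≥0∞ :=
  ⨅ (g : X → ℝ≥0∞) (_ : Measurable g) (_ : IsWeakUpperGradientOn μ p u g U),
    ∫⁻ x in S, g x ^ p ∂μ

/-- `u` is a fine superminimizer in `U`. -/
def FineSuperminimizer (μ : Measure X) (p : ℝ) (u : X → ℝ) (U : Set X) : Prop :=
  MemNpFineLoc μ p u U ∧
    ∀ V : Set X, GoodSubset μ p V U →
      ∀ φ : X → ℝ, MemNp0 μ p φ V → (∀ x, 0 ≤ φ x) →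
        fineEnergy μ p u U V ≤ fineEnergy μ p (fun x => u x + φ x) U V

/-- `u` is a fine minimizer in `U`. -/
def FineMinimizer (μ : Measure X) (p : ℝ) (u : X → ℝ) (U : Set X) : Prop :=
  MemNpFineLoc μ p u U ∧
    ∀ V : Set X, GoodSubset μ p V U →
      ∀ φ : X → ℝ, MemNp0 μ p φ V →
        fineEnergy μ p u U V ≤ fineEnergy μ p (fun x => u x + φ x) U V

/-- `u` is a fine subminimizer in `U` if `-u` is a fine superminimizer. -/
def FineSubminimizer (μ : Measure X) (p : ℝ) (u : X → ℝ) (U : Set X) : Prop :=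
  FineSuperminimizer μ p (fun x => -u x) U

/-- A doubling measure which is positive and finite on balls. -/
def DoublingMeasure (μ : Measure X) : Prop :=
  (∀ (x : X) (r : ℝ), 0 < r → 0 < μ (ball x r) ∧ μ (ball x r) < ⊤) ∧
    ∃ C : ℝ≥0∞, C < ⊤ ∧
      ∀ (x : X) (r : ℝ), 0 < r → μ (ball x (2 * r)) ≤ C * μ (ball x r)

/-- `X` supports a `p`-Poincaré inequality. -/
def PoincareInequality (μ : Measure X) (p : ℝ) : Prop :=
  ∃ C : ℝ≥0∞, 0 < C ∧ ∃ lam : ℝ, 1 ≤ lam ∧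
    ∀ (x : X) (r : ℝ), 0 < r → ∀ (f : X → ℝ) (g : X → ℝ≥0∞),
      Measurable f → Measurable g → IsWeakUpperGradientOn μ p f g Set.univ →
      (μ (ball x r))⁻¹ *
          ∫⁻ y in ball x r, ENNReal.ofReal |f y - ⨍ z in ball x r, f z ∂μ| ∂μ ≤
        C * ENNReal.ofReal (2 * r) *
          ((μ (ball x (lam * r)))⁻¹ * ∫⁻ y in ball x (lam * r), g y ^ p ∂μ) ^ (1 / p)

set_option linter.unusedSectionVars false

/-- `H` bounds the increments of `F` on `[a, b]`. -/
def IncrBound (F : ℝ → ℝ) (H : ℝ → ℝ≥0∞) (a b : ℝ) : Prop :=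
  ∀ s t, a ≤ s → s ≤ t → t ≤ b → ENNReal.ofReal |F s - F t| ≤ ∫⁻ r in Icc s t, H r

lemma IncrBound.mono_interval {F : ℝ → ℝ} {H : ℝ → ℝ≥0∞} {a b c d : ℝ} (h : IncrBound F H a b)
    (hc : a ≤ c) (hd : d ≤ b) : IncrBound F H c d :=
  fun s t h1 h2 h3 => h s t (hc.trans h1) h2 (h3.trans hd)

lemma IncrBound.mono {F : ℝ → ℝ} {H H' : ℝ → ℝ≥0∞} {a b : ℝ} (h : IncrBound F H a b)
    (hH : ∀ r, a ≤ r → r ≤ b → H r ≤ H' r) : IncrBound F H' a b := by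
  intro s t h1 h2 h3
  exact (h s t h1 h2 h3).trans (setLIntegral_mono' measurableSet_Icc
    fun r hr => hH r (h1.trans hr.1) (hr.2.trans h3))

lemma IncrBound.abs_sub_le {F : ℝ → ℝ} {H : ℝ → ℝ≥0∞} {a b : ℝ} (h : IncrBound F H a b)
    (hm : AEMeasurable H) (hfin : ∫⁻ r in Icc a b, H r ≠ ⊤) {s t : ℝ} (h1 : a ≤ s) (h2 : s ≤ t)
    (h3 : t ≤ b) :
    |F s - F t| ≤ ∫ r in s..t, (H r).toReal := by
  have hle : ∫⁻ r in Icc s t, H r ≠ ⊤ :=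
    ne_top_of_le_ne_top hfin (lintegral_mono_set (Icc_subset_Icc h1 h3))
  have hae : ∀ᵐ r ∂(volume.restrict (Icc s t)), H r < ⊤ := ae_lt_top' hm.restrict hle
  have : ENNReal.ofReal |F s - F t| ≤ ENNReal.ofReal (∫ r in s..t, (H r).toReal) := by
    rw [intervalIntegral.integral_of_le h2, ← integral_Icc_eq_integral_Ioc,
      integral_toReal hm.restrict hae, ENNReal.ofReal_toReal hle]
    exact h s t h1 h2 h3
  exact (ENNReal.ofReal_le_ofReal_iff (intervalIntegral.integral_nonneg h2
    fun _ _ => ENNReal.toReal_nonneg)).1 this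

lemma intervalIntegrable_toReal {H : ℝ → ℝ≥0∞} {a b : ℝ} (hab : a ≤ b)
    (hm : AEMeasurable H) (hfin : ∫⁻ r in Icc a b, H r ≠ ⊤) :
    IntervalIntegrable (fun r => (H r).toReal) volume a b := by
  rw [intervalIntegrable_iff, uIoc_of_le hab]
  refine IntegrableOn.mono_set ?_ Ioc_subset_Icc_self
  exact integrable_toReal_of_lintegral_ne_top hm.restrict hfin

lemma IncrBound.absolutelyContinuous {F : ℝ → ℝ} {H : ℝ → ℝ≥0∞} {a b : ℝ} (hab : a ≤ b)
    (h : IncrBound F H a b) (hm : AEMeasurable H) (hfin : ∫⁻ r in Icc a b, H r ≠ ⊤) :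
    AbsolutelyContinuousOnInterval F a b := by
  have hii := intervalIntegrable_toReal hab hm hfin
  have hac := hii.absolutelyContinuousOnInterval_intervalIntegral (c := a) (by simp)
  rw [absolutelyContinuousOnInterval_iff] at hac ⊢
  intro ε hε
  obtain ⟨δ, hδ, hd⟩ := hac ε hε
  refine ⟨δ, hδ, fun E hE hs => lt_of_le_of_lt (Finset.sum_le_sum fun i hi => ?_) (hd E hE hs)⟩
  have hmem := hE.1 i hi
  rw [uIcc_of_le hab] at hmem
  have key : ∀ s t, s ∈ Icc a b → t ∈ Icc a b → s ≤ t →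
      dist (F s) (F t) ≤ dist (∫ v in a..s, (H v).toReal) (∫ v in a..t, (H v).toReal) := by
    intro s t hs ht hst
    have e : (∫ v in a..t, (H v).toReal) - (∫ v in a..s, (H v).toReal)
        = ∫ v in s..t, (H v).toReal := by
      refine intervalIntegral.integral_interval_sub_left (hii.mono_set ?_) (hii.mono_set ?_)
      · rw [uIcc_of_le ht.1, uIcc_of_le hab]; exact Icc_subset_Icc le_rfl ht.2
      · rw [uIcc_of_le hs.1, uIcc_of_le hab]; exact Icc_subset_Icc le_rfl hs.2
    rw [dist_comm (∫ v in a..s, (H v).toReal), Real.dist_eq, Real.dist_eq, e]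
    exact (h.abs_sub_le hm hfin hs.1 hst ht.2).trans (le_abs_self _)
  rcases le_total (E.2 i).1 (E.2 i).2 with hc | hc
  · exact key _ _ hmem.1 hmem.2 hc
  · rw [dist_comm (F _), dist_comm (∫ v in a..(E.2 i).1, (H v).toReal)]
    exact key _ _ hmem.2 hmem.1 hc

lemma abs_hasDerivAt_le {F Φ : ℝ → ℝ} {f φ x : ℝ} (hF : HasDerivAt F f x) (hΦ : HasDerivAt Φ φ x)
    (h : ∀ᶠ y in nhds x, x ≤ y → |F x - F y| ≤ Φ y - Φ x) : |f| ≤ φ := by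
  have h1 : Tendsto (fun y => |slope F x y|) (nhdsWithin x (Ioi x)) (nhds |f|) :=
    ((hasDerivAt_iff_tendsto_slope.1 hF).mono_left
      (nhdsWithin_mono _ fun y (hy : x < y) => hy.ne')).abs
  have h2 : Tendsto (slope Φ x) (nhdsWithin x (Ioi x)) (nhds φ) :=
    (hasDerivAt_iff_tendsto_slope.1 hΦ).mono_left (nhdsWithin_mono _ fun y (hy : x < y) => hy.ne')
  refine le_of_tendsto_of_tendsto h1 h2 ?_
  filter_upwards [self_mem_nhdsWithin, mem_nhdsWithin_of_mem_nhds h] with y hy hy'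
  have hyx : 0 < y - x := sub_pos.2 hy
  rw [slope_def_field, slope_def_field, abs_div, abs_of_pos hyx, abs_sub_comm]
  exact div_le_div_of_nonneg_right (hy' (le_of_lt hy)) hyx.le

lemma IncrBound.deriv_le {F : ℝ → ℝ} {H : ℝ → ℝ≥0∞} {a b : ℝ} (hab : a ≤ b)
    (h : IncrBound F H a b) (hm : AEMeasurable H) (hfin : ∫⁻ r in Icc a b, H r ≠ ⊤) :
    ∀ᵐ r, r ∈ Ioo a b → DifferentiableAt ℝ F r ∧ ENNReal.ofReal |deriv F r| ≤ H r := by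
  have hii := intervalIntegrable_toReal hab hm hfin
  have hd := hii.ae_hasDerivAt_integral
  filter_upwards [(h.absolutelyContinuous hab hm hfin).ae_differentiableAt, hd] with r h1 h2 hr
  have hmem : r ∈ uIcc a b := by rw [uIcc_of_le hab]; exact Ioo_subset_Icc_self hr
  have hdF := h1 hmem
  refine ⟨hdF, ?_⟩
  have := abs_hasDerivAt_le hdF.hasDerivAt (h2 hmem a (by simp)) (by
    filter_upwards [isOpen_Ioo.mem_nhds hr] with y hy hry
    have e : (∫ v in a..y, (H v).toReal) - (∫ v in a..r, (H v).toReal)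
        = ∫ v in r..y, (H v).toReal := by
      refine intervalIntegral.integral_interval_sub_left (hii.mono_set ?_) (hii.mono_set ?_)
      · rw [uIcc_of_le hy.1.le, uIcc_of_le hab]; exact Icc_subset_Icc le_rfl hy.2.le
      · rw [uIcc_of_le hr.1.le, uIcc_of_le hab]; exact Icc_subset_Icc le_rfl hr.2.le
    rw [e]
    exact h.abs_sub_le hm hfin hr.1.le hry hy.2.le)
  exact (ENNReal.ofReal_le_ofReal this).trans ENNReal.ofReal_toReal_le

lemma IncrBound.of_deriv_le {F : ℝ → ℝ} {G : ℝ → ℝ≥0∞} {a b : ℝ}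
    (hF : AbsolutelyContinuousOnInterval F a b)
    (h : ∀ᵐ r, r ∈ Ioo a b → DifferentiableAt ℝ F r → ENNReal.ofReal |deriv F r| ≤ G r) :
    IncrBound F G a b := by
  intro s t h1 h2 h3
  have hab : a ≤ b := h1.trans (h2.trans h3)
  have hac : AbsolutelyContinuousOnInterval F s t := hF.mono (by
    rw [uIcc_of_le h2, uIcc_of_le hab]; exact Icc_subset_Icc h1 h3)
  rw [abs_sub_comm, ← hac.integral_deriv_eq_sub, ← Real.norm_eq_abs, ofReal_norm,
    intervalIntegral.integral_of_le h2, integral_Ioc_eq_integral_Ioo]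
  refine (enorm_integral_le_lintegral_enorm _).trans ?_
  refine le_trans ?_ (lintegral_mono_set (Ioo_subset_Icc_self (a := s) (b := t)))
  refine lintegral_mono_ae ?_
  rw [ae_restrict_iff' measurableSet_Ioo]
  filter_upwards [h, hF.ae_differentiableAt] with r hr hd hrs
  rw [← ofReal_norm, Real.norm_eq_abs]
  exact hr ⟨h1.trans_lt hrs.1, hrs.2.trans_le h3⟩
    (hd (by rw [uIcc_of_le hab]; exact ⟨(h1.trans_lt hrs.1).le, (hrs.2.trans_le h3).le⟩))

/-- On a relatively open set on which `H` has finite integral, `H` bounds the derivative. -/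
lemma IncrBound.deriv_le_of_isOpen {F : ℝ → ℝ} {H : ℝ → ℝ≥0∞} {a b : ℝ} {O : Set ℝ}
    (h : IncrBound F H a b) (hm : AEMeasurable H) (hO : IsOpen O)
    (hfin : ∫⁻ r in Icc a b ∩ O, H r ≠ ⊤) :
    ∀ᵐ r, r ∈ Ioo a b → r ∈ O → DifferentiableAt ℝ F r ∧ ENNReal.ofReal |deriv F r| ≤ H r := by
  have key : ∀ q : ℚ × ℚ, ∀ᵐ r : ℝ, (Icc (q.1 : ℝ) q.2 ⊆ Icc a b ∩ O) →
      r ∈ Ioo (q.1 : ℝ) q.2 → DifferentiableAt ℝ F r ∧ ENNReal.ofReal |deriv F r| ≤ H r := by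
    intro q
    by_cases hq : (q.1 : ℝ) ≤ q.2
    · by_cases hs : Icc (q.1 : ℝ) q.2 ⊆ Icc a b ∩ O
      · have hb := (hs (left_mem_Icc.2 hq)).1
        have hb' := (hs (right_mem_Icc.2 hq)).1
        have := (h.mono_interval hb.1 hb'.2).deriv_le hq hm
          (ne_top_of_le_ne_top hfin (lintegral_mono_set hs))
        filter_upwards [this] with r hr _ using hr
      · exact Eventually.of_forall fun r hr => absurd hr hs
    · exact Eventually.of_forall fun r _ hr => absurd (hr.1.trans hr.2).le hq
  filter_upwards [ae_all_iff.2 key] with r hr hab hrO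
  have hopen : IsOpen (Ioo a b ∩ O) := isOpen_Ioo.inter hO
  obtain ⟨δ, hδ, hball⟩ := Metric.isOpen_iff.1 hopen r ⟨hab, hrO⟩
  obtain ⟨q1, h1, h1'⟩ := exists_rat_btwn (show r - δ < r by linarith)
  obtain ⟨q2, h2, h2'⟩ := exists_rat_btwn (show r < r + δ by linarith)
  refine hr (q1, q2) (fun x hx => ?_) ⟨h1', h2⟩
  have : x ∈ ball r δ := by
    rw [Real.ball_eq_Ioo]; exact ⟨h1.trans_le hx.1, hx.2.trans_lt h2'⟩
  exact ⟨Ioo_subset_Icc_self (hball this).1, (hball this).2⟩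

namespace Curve

/-- The curve, extended to a globally `1`-Lipschitz map by clamping the parameter. -/
def path (γ : Curve X) (t : ℝ) : X := γ.toFun (projIcc 0 γ.len γ.len_pos.le t)

lemma path_eq (γ : Curve X) {t : ℝ} (ht : t ∈ Icc 0 γ.len) : γ.path t = γ.toFun t := by
  simp [path, projIcc_of_mem _ ht]

lemma lipschitzWith_path (γ : Curve X) : LipschitzWith 1 γ.path := by
  have h := (lipschitzOnWith_iff_restrict.1 γ.lip).comp (LipschitzWith.projIcc γ.len_pos.le)
  rw [mul_one] at h
  exact h

lemma continuous_path (γ : Curve X) : Continuous γ.path := γ.lipschitzWith_path.continuous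

lemma measurable_path (γ : Curve X) : Measurable γ.path := γ.continuous_path.measurable

lemma path_mem (γ : Curve X) {E : Set X} (h : γ.InSet E) (t : ℝ) : γ.path t ∈ E :=
  h _ (projIcc 0 γ.len γ.len_pos.le t).2

/-- The restriction of a curve to `[s, t]`. -/
def sub (γ : Curve X) (s t : ℝ) (hs : 0 ≤ s) (hst : s < t) (ht : t ≤ γ.len) : Curve X where
  len := t - s
  len_pos := sub_pos.2 hst
  toFun r := γ.toFun (s + r)
  lip := by
    have h : LipschitzOnWith 1 (fun r : ℝ => s + r) (Icc 0 (t - s)) := by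
      refine LipschitzOnWith.of_dist_le_mul fun x _ y _ => ?_
      simp
    have := γ.lip.comp h (fun r hr => ⟨by linarith [hr.1], by linarith [hr.2]⟩)
    simpa [Function.comp_def] using this

end Curve

lemma curveLint_eq_path (γ : Curve X) (g : X → ℝ≥0∞) :
    curveLint γ g = ∫⁻ t in Icc (0 : ℝ) γ.len, g (γ.path t) :=
  setLIntegral_congr_fun measurableSet_Icc fun t ht => by rw [γ.path_eq ht]

lemma curveLint_sub (γ : Curve X) (g : X → ℝ≥0∞) {s t : ℝ} (hs : 0 ≤ s) (hst : s < t)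
    (ht : t ≤ γ.len) :
    curveLint (γ.sub s t hs hst ht) g = ∫⁻ r in Icc s t, g (γ.path r) := by
  have e : (fun r : ℝ => s + r) '' Icc 0 (t - s) = Icc s t := by
    rw [image_const_add_Icc]; simp
  have h1 := (measurePreserving_add_left volume s).setLIntegral_comp_emb
    (measurableEmbedding_addLeft s) (fun r => g (γ.path r)) (Icc 0 (t - s))
  rw [e] at h1
  rw [← h1]
  refine setLIntegral_congr_fun measurableSet_Icc fun r hr => ?_
  simp only [Curve.sub] at hr ⊢
  rw [γ.path_eq ⟨by linarith [hr.1], by linarith [hr.2]⟩]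

lemma curveLint_mono {γ : Curve X} {g h : X → ℝ≥0∞} (H : ∀ x, g x ≤ h x) :
    curveLint γ g ≤ curveLint γ h := lintegral_mono fun _ => H _

/-- A property of curves holds outside a family on which some `ρ ∈ L^p` has infinite integrals. -/
def PAECurve (μ : Measure X) (p : ℝ) (P : Curve X → Prop) : Prop :=
  ∃ ρ : X → ℝ≥0∞, Measurable ρ ∧ ∫⁻ x, ρ x ^ p ∂μ < ⊤ ∧ ∀ γ, curveLint γ ρ < ⊤ → P γ

lemma iSup_rpow {ι : Type*} (f : ι → ℝ≥0∞) {p : ℝ} (hp : 0 < p) :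
    (⨆ i, f i) ^ p = ⨆ i, f i ^ p := by
  exact (ENNReal.orderIsoRpow p hp).map_iSup f

lemma lintegral_iSup_rpow_le (μ : Measure X) {p : ℝ} (hp : 0 < p) (ρ : ℕ → X → ℝ≥0∞)
    (hm : ∀ n, Measurable (ρ n)) :
    ∫⁻ x, (⨆ n, ρ n x) ^ p ∂μ ≤ ∑' n, ∫⁻ x, ρ n x ^ p ∂μ := by
  rw [← lintegral_tsum fun n => ((hm n).pow_const p).aemeasurable]
  refine lintegral_mono fun x => ?_
  rw [iSup_rpow _ hp]
  exact iSup_le fun n => ENNReal.le_tsum n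

lemma lintegral_const_mul_rpow (μ : Measure X) {p : ℝ} (hp : 0 < p) {ρ : X → ℝ≥0∞}
    (hm : Measurable ρ) (c : ℝ≥0∞) :
    ∫⁻ x, (c * ρ x) ^ p ∂μ = c ^ p * ∫⁻ x, ρ x ^ p ∂μ := by
  simp_rw [ENNReal.mul_rpow_of_nonneg _ _ hp.le]
  rw [lintegral_const_mul _ (hm.pow_const p)]

lemma exists_mul_rpow_le {p : ℝ} (hp : 0 < p) {I ε : ℝ≥0∞} (hI : I < ⊤) (hε : 0 < ε) :
    ∃ c : ℝ≥0∞, c ≠ 0 ∧ c ≠ ⊤ ∧ c ≤ 1 ∧ c ^ p * I ≤ ε := by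
  refine ⟨min 1 ((ε / (I + 1)) ^ (1 / p)), ?_, ?_, min_le_left _ _, ?_⟩
  · have : 0 < (ε / (I + 1)) ^ (1 / p) :=
      ENNReal.rpow_pos_of_nonneg (ENNReal.div_pos hε.ne' (by finiteness)) (by positivity)
    simpa [min_eq_iff] using (lt_min one_pos this).ne'
  · exact ne_top_of_le_ne_top one_ne_top (min_le_left _ _)
  · calc (min 1 ((ε / (I + 1)) ^ (1 / p))) ^ p * I
        ≤ ((ε / (I + 1)) ^ (1 / p)) ^ p * (I + 1) := by
          gcongr
          · exact min_le_right _ _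
          · exact le_self_add
      _ = ε := by
          rw [← ENNReal.rpow_mul, one_div_mul_cancel hp.ne', ENNReal.rpow_one,
            ENNReal.div_mul_cancel (by simp) (by finiteness)]

lemma exists_dominating {μ : Measure X} {p : ℝ} (hp : 0 < p) (ρ : ℕ → X → ℝ≥0∞)
    (hm : ∀ n, Measurable (ρ n)) (hfin : ∀ n, ∫⁻ x, ρ n x ^ p ∂μ < ⊤) :
    ∃ (c : ℕ → ℝ≥0∞) (σ : X → ℝ≥0∞), Measurable σ ∧ ∫⁻ x, σ x ^ p ∂μ < ⊤ ∧
      (∀ n, c n ≠ 0 ∧ c n ≠ ⊤) ∧ ∀ n x, c n * ρ n x ≤ σ x := by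
  have hpos : ∀ n : ℕ, (0 : ℝ≥0∞) < (2⁻¹ : ℝ≥0∞) ^ n := fun n => by
    apply ENNReal.pow_pos; simp
  choose c h0 ht _ hc using fun n => exists_mul_rpow_le hp (hfin n) (hpos n)
  refine ⟨c, fun x => ⨆ n, c n * ρ n x, Measurable.iSup fun n => (hm n).const_mul _, ?_,
    fun n => ⟨h0 n, ht n⟩, fun n x => le_iSup (fun n => c n * ρ n x) n⟩
  refine (lintegral_iSup_rpow_le μ hp _ fun n => (hm n).const_mul _).trans_lt ?_
  refine (ENNReal.tsum_le_tsum fun n => ?_).trans_lt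
    (show ∑' n : ℕ, (2⁻¹ : ℝ≥0∞) ^ n < ⊤ by simp [ENNReal.tsum_geometric])
  rw [lintegral_const_mul_rpow μ hp (hm n)]
  exact hc n

lemma curveLint_const_mul {γ : Curve X} {ρ : X → ℝ≥0∞} {c : ℝ≥0∞} (hc : c ≠ ⊤) :
    curveLint γ (fun x => c * ρ x) = c * curveLint γ ρ :=
  lintegral_const_mul' _ _ hc

namespace PAECurve

variable {μ : Measure X} {p : ℝ}

lemma mono {P Q : Curve X → Prop} (h : PAECurve μ p P) (H : ∀ γ, P γ → Q γ) : PAECurve μ p Q := by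
  obtain ⟨ρ, h1, h2, h3⟩ := h
  exact ⟨ρ, h1, h2, fun γ hγ => H γ (h3 γ hγ)⟩

lemma of_forall (hp : 0 < p) {P : Curve X → Prop} (h : ∀ γ, P γ) : PAECurve μ p P :=
  ⟨fun _ => 0, measurable_const, by simp [hp], fun γ _ => h γ⟩

lemma all (hp : 0 < p) {P : ℕ → Curve X → Prop} (h : ∀ n, PAECurve μ p (P n)) :
    PAECurve μ p fun γ => ∀ n, P n γ := by
  choose ρ h1 h2 h3 using h
  obtain ⟨c, σ, hσ, hfin, hc, hle⟩ := exists_dominating hp ρ h1 h2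
  refine ⟨σ, hσ, hfin, fun γ hγ n => h3 n γ ?_⟩
  have h4 : c n * curveLint γ (ρ n) < ⊤ := by
    rw [← curveLint_const_mul (hc n).2]
    exact (curveLint_mono (hle n)).trans_lt hγ
  by_contra h5
  rw [not_lt, top_le_iff] at h5
  rw [h5, ENNReal.mul_top (hc n).1] at h4
  exact lt_irrefl _ h4

lemma and (hp : 0 < p) {P Q : Curve X → Prop} (h : PAECurve μ p P) (h' : PAECurve μ p Q) :
    PAECurve μ p fun γ => P γ ∧ Q γ := by
  have := all hp (P := fun n => if n = 0 then P else Q) (μ := μ) (fun n => by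
    split_ifs <;> assumption)
  exact this.mono fun γ h => ⟨by simpa using h 0, by simpa using h 1⟩

lemma lint_lt_top {g : X → ℝ≥0∞} (hg : Measurable g) (h : ∫⁻ x, g x ^ p ∂μ < ⊤) :
    PAECurve μ p fun γ => curveLint γ g < ⊤ := ⟨g, hg, h, fun _ h => h⟩

lemma lint_indicator_lt_top (hp : 0 < p) {g : X → ℝ≥0∞} (hg : Measurable g) {W : Set X}
    (hW : MeasurableSet W) (h : ∫⁻ x in W, g x ^ p ∂μ < ⊤) :
    PAECurve μ p fun γ => curveLint γ (W.indicator g) < ⊤ := by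
  refine lint_lt_top (hg.indicator hW) ?_
  rw [← lintegral_indicator hW] at h
  convert! h using 2 with x
  ext x
  by_cases hx : x ∈ W <;> simp [hx, hp]

end PAECurve

/-- A `p`-weak upper gradient, tested on all subcurves of almost every curve. -/
def WUG (μ : Measure X) (p : ℝ) (f : X → ℝ) (g : X → ℝ≥0∞) (U : Set X) : Prop :=
  PAECurve μ p fun γ => γ.InSet U →
    IncrBound (fun t => f (γ.path t)) (fun t => g (γ.path t)) 0 γ.len

lemma WUG.isWeakUpperGradientOn {μ : Measure X} {p : ℝ} (hp : 0 < p) {f : X → ℝ} {g : X → ℝ≥0∞}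
    {U : Set X} (h : WUG μ p f g U) : IsWeakUpperGradientOn μ p f g U := by
  obtain ⟨ρ, hm, hfin, hρ⟩ := h
  refine le_antisymm (ENNReal.le_of_forall_pos_le_add fun ε hε _ => ?_) bot_le
  rw [zero_add]
  obtain ⟨c, h0, htop, -, hc⟩ := exists_mul_rpow_le hp hfin (ENNReal.coe_pos.2 hε)
  refine (iInf₂_le_of_le (fun x => c * ρ x) (hm.const_mul c) (iInf_le_of_le ?_ ?_))
  · intro γ hγ
    have : curveLint γ ρ = ⊤ := by
      by_contra hne
      refine hγ fun hU => ?_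
      have := hρ γ (lt_top_iff_ne_top.2 hne) hU 0 γ.len le_rfl γ.len_pos.le le_rfl
      rw [← curveLint_eq_path] at this
      beta_reduce at this
      rw [γ.path_eq ⟨le_rfl, γ.len_pos.le⟩,
        γ.path_eq ⟨γ.len_pos.le, le_rfl⟩] at this
      rwa [edist_dist, Real.dist_eq]
    rw [curveLint_const_mul htop, this, ENNReal.mul_top h0]
    exact le_top
  · refine le_trans (lintegral_mono' Measure.restrict_le_self le_rfl) ?_
    rwa [lintegral_const_mul_rpow μ hp hm]

lemma IsWeakUpperGradientOn.wug {μ : Measure X} [SFinite μ] {p : ℝ} (hp : 0 < p) {f : X → ℝ}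
    {g : X → ℝ≥0∞} {U : Set X} (h : IsWeakUpperGradientOn μ p f g U) : WUG μ p f g U := by
  have key : ∀ n : ℕ, ∃ ρ : X → ℝ≥0∞, Measurable ρ ∧
      (∀ γ : Curve X, ¬ (γ.InSet U → edist (f (γ.toFun 0)) (f (γ.toFun γ.len)) ≤ curveLint γ g) →
        (n : ℝ≥0∞) ≤ curveLint γ ρ) ∧ ∫⁻ x, ρ x ^ p ∂μ ≤ (2⁻¹ : ℝ≥0∞) ^ n := by
    intro n
    have hpos : (0 : ℝ≥0∞) < (2⁻¹ : ℝ≥0∞) ^ n := by apply ENNReal.pow_pos; simp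
    have hnp : ((n : ℝ≥0∞) + 1) ^ p ≠ ⊤ := by finiteness
    have hlt : pMod (μ.restrict U) p {γ | ¬ (γ.InSet U →
        edist (f (γ.toFun 0)) (f (γ.toFun γ.len)) ≤ curveLint γ g)} <
        (2⁻¹ : ℝ≥0∞) ^ n / ((n : ℝ≥0∞) + 1) ^ p := by
      rw [show pMod _ _ _ = 0 from h]
      exact ENNReal.div_pos hpos.ne' hnp
    simp only [pMod, iInf_lt_iff] at hlt
    obtain ⟨ρ, hm, hadm, hgint⟩ := hlt
    refine ⟨fun x => ((n : ℝ≥0∞) + 1) * (toMeasurable μ U).indicator ρ x,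
      (hm.indicator (measurableSet_toMeasurable _ _)).const_mul _, fun γ hγ => ?_, ?_⟩
    · rw [curveLint_const_mul (by finiteness)]
      have hU : γ.InSet U := by by_contra hU; exact hγ fun h => absurd h hU
      have e : curveLint γ ((toMeasurable μ U).indicator ρ) = curveLint γ ρ :=
        setLIntegral_congr_fun measurableSet_Icc fun t ht => by
          rw [indicator_of_mem (subset_toMeasurable μ U (hU t ht))]
      rw [e]
      calc (n : ℝ≥0∞) ≤ ((n : ℝ≥0∞) + 1) * 1 := by rw [mul_one]; exact le_self_add
        _ ≤ _ := by gcongr; exact hadm γ hγ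
    · rw [lintegral_const_mul_rpow μ hp (hm.indicator (measurableSet_toMeasurable _ _))]
      have e : ∫⁻ x, (toMeasurable μ U).indicator ρ x ^ p ∂μ
          = ∫⁻ x, ρ x ^ p ∂(μ.restrict U) := by
        rw [← Measure.restrict_toMeasurable_of_sFinite,
          ← lintegral_indicator (measurableSet_toMeasurable _ _)]
        refine lintegral_congr fun x => ?_
        by_cases hx : x ∈ toMeasurable μ U <;> simp [hx, hp]
      rw [e, mul_comm]
      exact (ENNReal.le_div_iff_mul_le (Or.inl (by positivity)) (Or.inl hnp)).1 hgint.le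
  choose ρ hm hadm hgint using key
  refine ⟨fun x => ⨆ n, ρ n x, Measurable.iSup hm, ?_, fun γ hγ hU s t hs hst ht => ?_⟩
  · refine (lintegral_iSup_rpow_le μ hp _ hm).trans_lt ?_
    exact (ENNReal.tsum_le_tsum hgint).trans_lt (by simp [ENNReal.tsum_geometric])
  · rcases hst.eq_or_lt with rfl | hlt
    · simp
    by_contra hcon
    have hs' : s ∈ Icc 0 γ.len := ⟨hs, hst.trans ht⟩
    have ht' : t ∈ Icc 0 γ.len := ⟨hs.trans hst, ht⟩
    have hall : ∀ n : ℕ, (n : ℝ≥0∞) ≤ curveLint γ (fun x => ⨆ n, ρ n x) := by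
      intro n
      have h1 := hadm n (γ.sub s t hs hlt ht) (fun himp => hcon (by
        have := himp (fun r hr => hU _ ⟨by linarith [hr.1], by
          have : r ≤ t - s := hr.2
          linarith⟩)
        rw [curveLint_sub] at this
        simpa [edist_dist, Real.dist_eq, Curve.sub, γ.path_eq hs', γ.path_eq ht'] using this))
      rw [curveLint_sub] at h1
      refine h1.trans ?_
      rw [curveLint_eq_path]
      refine (lintegral_mono_set (Icc_subset_Icc hs ht)).trans (lintegral_mono fun r => ?_)
      exact le_iSup (fun n => ρ n (γ.path r)) n
    have : curveLint γ (fun x => ⨆ n, ρ n x) = ⊤ := by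
      rw [← top_le_iff, ← ENNReal.iSup_natCast]
      exact iSup_le hall
    exact hγ.ne this

lemma AbsolutelyContinuousOnInterval.of_dist_le {F F₁ F₂ F₃ : ℝ → ℝ} {a b K : ℝ}
    (h₁ : AbsolutelyContinuousOnInterval F₁ a b) (h₂ : AbsolutelyContinuousOnInterval F₂ a b)
    (h₃ : AbsolutelyContinuousOnInterval F₃ a b)
    (h : ∀ s t, |F s - F t| ≤ K * (|F₁ s - F₁ t| + |F₂ s - F₂ t| + |F₃ s - F₃ t|)) :
    AbsolutelyContinuousOnInterval F a b := by
  have h4 := ((Tendsto.add h₁ h₂).add h₃).const_mul K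
  simp only [add_zero, mul_zero] at h4
  refine squeeze_zero (fun E => Finset.sum_nonneg fun _ _ => dist_nonneg) (fun E => ?_) h4
  rw [← Finset.sum_add_distrib, ← Finset.sum_add_distrib, Finset.mul_sum]
  exact Finset.sum_le_sum fun i _ => h _ _

lemma deriv_eq_of_le {A B : ℝ → ℝ} {r : ℝ} (hle : ∀ s, A s ≤ B s) (h : A r = B r)
    (hA : DifferentiableAt ℝ A r) (hB : DifferentiableAt ℝ B r) : deriv A r = deriv B r := by
  have hmin : IsLocalMin (fun s => B s - A s) r :=
    Eventually.of_forall fun s => by simp [h, hle s]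
  have := hmin.deriv_eq_zero
  rw [deriv_fun_sub hB hA] at this
  linarith

/-- `g` has finite integral over the part in `W` of almost every curve. -/
def PLoc (μ : Measure X) (p : ℝ) (g : X → ℝ≥0∞) (W : Set X) : Prop :=
  PAECurve μ p fun γ => curveLint γ (W.indicator g) < ⊤

lemma PLoc.of_lintegral {μ : Measure X} {p : ℝ} (hp : 0 < p) {g : X → ℝ≥0∞} (hg : Measurable g)
    {W : Set X} (hW : MeasurableSet W) (h : ∫⁻ x in W, g x ^ p ∂μ < ⊤) : PLoc μ p g W :=
  PAECurve.lint_indicator_lt_top hp hg hW h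

lemma PLoc.of_lintegral_univ {μ : Measure X} {p : ℝ} (hp : 0 < p) {g : X → ℝ≥0∞}
    (hg : Measurable g) {W : Set X} (hW : MeasurableSet W) (h : ∫⁻ x, g x ^ p ∂μ < ⊤) :
    PLoc μ p g W :=
  PLoc.of_lintegral hp hg hW ((setLIntegral_le_lintegral _ _).trans_lt h)

lemma PLoc.const {μ : Measure X} {p : ℝ} (hp : 0 < p) {c : ℝ≥0∞} (hc : c ≠ ⊤) (W : Set X) :
    PLoc μ p (fun _ => c) W := by
  refine PAECurve.of_forall hp fun γ => ?_
  refine (curveLint_mono (h := fun _ => c) fun x => indicator_le_self _ _ x).trans_lt ?_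
  simp only [curveLint, lintegral_const, Measure.restrict_apply MeasurableSet.univ, univ_inter,
    Real.volume_Icc]
  exact ENNReal.mul_lt_top hc.lt_top ENNReal.ofReal_lt_top

namespace WUG

variable {μ : Measure X} {p : ℝ} {f f₁ f₂ f₃ : X → ℝ} {g g₁ g₂ g₃ : X → ℝ≥0∞} {U W : Set X}

lemma mono (h : WUG μ p f g U) (hg : ∀ x, g x ≤ g₁ x) : WUG μ p f g₁ U :=
  PAECurve.mono h fun _ hγ hU => (hγ hU).mono fun _ _ _ => hg _

lemma mono_set (h : WUG μ p f g U) {U' : Set X} (hU : U' ⊆ U) : WUG μ p f g U' :=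
  PAECurve.mono h fun _ hγ hU' => hγ fun t ht => hU (hU' t ht)

lemma congr (h : WUG μ p f g U) (hf : ∀ x, f₁ x = f x) : WUG μ p f₁ g U := by
  rwa [show f₁ = f from funext hf]

lemma of_abs_le (h : WUG μ p f g U) (hf : ∀ x y, |f₁ x - f₁ y| ≤ |f x - f y|) :
    WUG μ p f₁ g U :=
  PAECurve.mono h fun _ hγ hU s t h1 h2 h3 =>
    (ENNReal.ofReal_le_ofReal (hf _ _)).trans (hγ hU s t h1 h2 h3)

lemma add (hp : 0 < p) (h₁ : WUG μ p f₁ g₁ U) (h₂ : WUG μ p f₂ g₂ U) (hg : Measurable g₁)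
    (hf : ∀ x y, |f x - f y| ≤ |f₁ x - f₁ y| + |f₂ x - f₂ y|) :
    WUG μ p f (fun x => g₁ x + g₂ x) U := by
  refine (PAECurve.and hp h₁ h₂).mono fun γ hγ hU s t h1 h2 h3 => ?_
  beta_reduce
  rw [lintegral_add_left (f := fun r => g₁ (γ.path r)) (hg.comp γ.measurable_path)]
  refine (ENNReal.ofReal_le_ofReal (hf _ _)).trans ?_
  rw [ENNReal.ofReal_add (abs_nonneg _) (abs_nonneg _)]
  exact add_le_add (hγ.1 hU s t h1 h2 h3) (hγ.2 hU s t h1 h2 h3)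

lemma const_mul (h : WUG μ p f g U) (c : ℝ) :
    WUG μ p (fun x => c * f x) (fun x => ENNReal.ofReal |c| * g x) U := by
  refine PAECurve.mono h fun γ hγ hU s t h1 h2 h3 => ?_
  rw [lintegral_const_mul' _ _ ENNReal.ofReal_ne_top, ← mul_sub, abs_mul,
    ENNReal.ofReal_mul (abs_nonneg _)]
  exact mul_le_mul_right (hγ hU s t h1 h2 h3) _

lemma iSup (hp : 0 < p) {f : ℕ → X → ℝ} {g : ℕ → X → ℝ≥0∞} (h : ∀ n, WUG μ p (f n) (g n) U)
    (hb : ∀ x, BddAbove (range fun n => f n x)) :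
    WUG μ p (fun x => ⨆ n, f n x) (fun x => ⨆ n, g n x) U := by
  refine (PAECurve.all hp h).mono fun γ hγ hU s t h1 h2 h3 => ?_
  by_cases htop : ∫⁻ r in Icc s t, ⨆ n, g n (γ.path r) = ⊤
  · exact htop ▸ le_top
  rw [ENNReal.ofReal_le_iff_le_toReal htop]
  have key : ∀ n, |f n (γ.path s) - f n (γ.path t)| ≤
      (∫⁻ r in Icc s t, ⨆ n, g n (γ.path r)).toReal := fun n => by
    rw [← ENNReal.ofReal_le_iff_le_toReal htop]
    exact (hγ n hU s t h1 h2 h3).trans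
      (lintegral_mono fun r => le_iSup (fun n => g n (γ.path r)) n)
  rw [abs_sub_le_iff]
  constructor
  · rw [sub_le_iff_le_add]
    refine ciSup_le fun n => ?_
    have h4 := (abs_sub_le_iff.1 (key n)).1
    have h5 := le_ciSup (hb (γ.path t)) n
    linarith
  · rw [sub_le_iff_le_add]
    refine ciSup_le fun n => ?_
    have h4 := (abs_sub_le_iff.1 (key n)).2
    have h5 := le_ciSup (hb (γ.path s)) n
    linarith

lemma of_lipschitz (hp : 0 < p) {L : NNReal} (hf : LipschitzWith L f) :
    WUG μ p f (fun _ => (L : ℝ≥0∞)) U := by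
  refine PAECurve.of_forall hp fun γ _ s t h1 h2 h3 => ?_
  have := (hf.comp γ.lipschitzWith_path).dist_le_mul s t
  rw [mul_one, Real.dist_eq, Real.dist_eq, abs_sub_comm s, abs_of_nonneg (sub_nonneg.2 h2)] at this
  simp only [lintegral_const, Measure.restrict_apply MeasurableSet.univ, univ_inter,
    Real.volume_Icc]
  refine (ENNReal.ofReal_le_ofReal this).trans_eq ?_
  rw [ENNReal.ofReal_mul (p := (L : ℝ)) L.2, ENNReal.ofReal_coe_nnreal]

/-- A weak upper gradient may be verified through a pointwise bound on derivatives. -/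
lemma glue (hp : 0 < p)
    (h₁ : WUG μ p f₁ g₁ U) (h₂ : WUG μ p f₂ g₂ U) (h₃ : WUG μ p f₃ g₃ U)
    (hm₁ : Measurable g₁) (hm₂ : Measurable g₂) (hm₃ : Measurable g₃) (hm : Measurable g)
    (hL₁ : PLoc μ p g₁ W) (hL₂ : PLoc μ p g₂ W) (hL₃ : PLoc μ p g₃ W)
    (htop : ∀ x ∉ W, g x = ⊤) (K : ℝ)
    (hlip : ∀ x y, |f x - f y| ≤ K * (|f₁ x - f₁ y| + |f₂ x - f₂ y| + |f₃ x - f₃ y|))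
    (hder : ∀ (c : ℝ → X) (r : ℝ), c r ∈ W →
      DifferentiableAt ℝ (fun s => f (c s)) r →
      DifferentiableAt ℝ (fun s => f₁ (c s)) r → DifferentiableAt ℝ (fun s => f₂ (c s)) r →
      DifferentiableAt ℝ (fun s => f₃ (c s)) r →
      ENNReal.ofReal |deriv (fun s => f₁ (c s)) r| ≤ g₁ (c r) →
      ENNReal.ofReal |deriv (fun s => f₂ (c s)) r| ≤ g₂ (c r) →
      ENNReal.ofReal |deriv (fun s => f₃ (c s)) r| ≤ g₃ (c r) →
      ENNReal.ofReal |deriv (fun s => f (c s)) r| ≤ g (c r)) :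
    WUG μ p f g U := by
  refine (PAECurve.and hp (PAECurve.and hp h₁ hL₁)
    (PAECurve.and hp (PAECurve.and hp h₂ hL₂) (PAECurve.and hp h₃ hL₃))).mono fun γ hγ hU => ?_
  obtain ⟨⟨b₁, l₁⟩, ⟨b₂, l₂⟩, b₃, l₃⟩ := hγ
  intro s t h1 h2 h3
  by_cases htop' : ∫⁻ r in Icc s t, g (γ.path r) = ⊤
  · exact htop' ▸ le_top
  have hmem : ∀ᵐ r, r ∈ Icc s t → γ.path r ∈ W := by
    have := ae_lt_top (hm.comp γ.measurable_path) htop'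
    rw [ae_restrict_iff' measurableSet_Icc] at this
    filter_upwards [this] with r hr hrs
    by_contra hne
    exact (hr hrs).ne (htop _ hne)
  have key : ∀ {g' : X → ℝ≥0∞}, curveLint γ (W.indicator g') < ⊤ →
      ∫⁻ r in Icc s t, g' (γ.path r) ≠ ⊤ := by
    intro g' hl
    rw [curveLint_eq_path] at hl
    have e : ∫⁻ r in Icc s t, g' (γ.path r) = ∫⁻ r in Icc s t, W.indicator g' (γ.path r) := by
      refine lintegral_congr_ae ?_
      rw [Filter.EventuallyEq, ae_restrict_iff' measurableSet_Icc]
      filter_upwards [hmem] with r hr hrs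
      rw [indicator_of_mem (hr hrs)]
    rw [e]
    exact ((lintegral_mono_set (Icc_subset_Icc h1 h3)).trans_lt hl).ne
  replace b₁ := (b₁ hU).mono_interval h1 h3
  replace b₂ := (b₂ hU).mono_interval h1 h3
  replace b₃ := (b₃ hU).mono_interval h1 h3
  have m₁ := (hm₁.comp γ.measurable_path).aemeasurable (μ := volume)
  have m₂ := (hm₂.comp γ.measurable_path).aemeasurable (μ := volume)
  have m₃ := (hm₃.comp γ.measurable_path).aemeasurable (μ := volume)
  refine IncrBound.of_deriv_le (AbsolutelyContinuousOnInterval.of_dist_le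
    (b₁.absolutelyContinuous h2 m₁ (key l₁)) (b₂.absolutelyContinuous h2 m₂ (key l₂))
    (b₃.absolutelyContinuous h2 m₃ (key l₃)) fun s t => hlip _ _) ?_ s t le_rfl h2 le_rfl
  filter_upwards [hmem, b₁.deriv_le h2 m₁ (key l₁), b₂.deriv_le h2 m₂ (key l₂),
    b₃.deriv_le h2 m₃ (key l₃)] with r hr d₁ d₂ d₃ hI hd
  exact hder γ.path r (hr (Ioo_subset_Icc_self hI)) hd (d₁ hI).1 (d₂ hI).1 (d₃ hI).1
    (d₁ hI).2 (d₂ hI).2 (d₃ hI).2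

/-- Two-function version of `WUG.glue`. -/
lemma glue₂ (hp : 0 < p)
    (h₁ : WUG μ p f₁ g₁ U) (h₂ : WUG μ p f₂ g₂ U)
    (hm₁ : Measurable g₁) (hm₂ : Measurable g₂) (hm : Measurable g)
    (hL₁ : PLoc μ p g₁ W) (hL₂ : PLoc μ p g₂ W)
    (htop : ∀ x ∉ W, g x = ⊤)
    (hlip : ∀ x y, |f x - f y| ≤ |f₁ x - f₁ y| + |f₂ x - f₂ y|)
    (hder : ∀ (c : ℝ → X) (r : ℝ), c r ∈ W →
      DifferentiableAt ℝ (fun s => f (c s)) r →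
      DifferentiableAt ℝ (fun s => f₁ (c s)) r → DifferentiableAt ℝ (fun s => f₂ (c s)) r →
      ENNReal.ofReal |deriv (fun s => f₁ (c s)) r| ≤ g₁ (c r) →
      ENNReal.ofReal |deriv (fun s => f₂ (c s)) r| ≤ g₂ (c r) →
      ENNReal.ofReal |deriv (fun s => f (c s)) r| ≤ g (c r)) :
    WUG μ p f g U :=
  glue hp h₁ h₂ h₂ hm₁ hm₂ hm₂ hm hL₁ hL₂ hL₂ htop 1
    (fun x y => by linarith [hlip x y, abs_nonneg (f₂ x - f₂ y)])
    fun c r h0 h1 h2 h3 _ h5 h6 _ => hder c r h0 h1 h2 h3 h5 h6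

lemma max (hp : 0 < p) (h₁ : WUG μ p f₁ g₁ U) (h₂ : WUG μ p f₂ g₂ U)
    (hm₁ : Measurable g₁) (hm₂ : Measurable g₂) (hm : Measurable g)
    (hL₁ : PLoc μ p g₁ W) (hL₂ : PLoc μ p g₂ W)
    (htop : ∀ x ∉ W, g x = ⊤) (h1 : ∀ x ∈ W, f₂ x ≤ f₁ x → g₁ x ≤ g x)
    (h2 : ∀ x ∈ W, f₁ x < f₂ x → g₂ x ≤ g x) : WUG μ p (fun x => max (f₁ x) (f₂ x)) g U := by
  refine glue₂ hp h₁ h₂ hm₁ hm₂ hm hL₁ hL₂ htop (fun x y => ?_) ?_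
  · exact (abs_max_sub_max_le_max _ _ _ _).trans (max_le_add_of_nonneg (abs_nonneg _)
      (abs_nonneg _))
  · intro c r hr hd hd₁ hd₂ hb₁ hb₂
    rcases le_or_gt (f₂ (c r)) (f₁ (c r)) with hle | hlt
    · rw [← deriv_eq_of_le (A := fun s => f₁ (c s))
        (B := fun s => Max.max (f₁ (c s)) (f₂ (c s))) (fun s => le_max_left _ _)
        (max_eq_left hle).symm hd₁ hd]
      exact hb₁.trans (h1 _ hr hle)
    · rw [← deriv_eq_of_le (A := fun s => f₂ (c s))
        (B := fun s => Max.max (f₁ (c s)) (f₂ (c s))) (fun s => le_max_right _ _)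
        (max_eq_right hlt.le).symm hd₂ hd]
      exact hb₂.trans (h2 _ hr hlt)

lemma min (hp : 0 < p) (h₁ : WUG μ p f₁ g₁ U) (h₂ : WUG μ p f₂ g₂ U)
    (hm₁ : Measurable g₁) (hm₂ : Measurable g₂) (hm : Measurable g)
    (hL₁ : PLoc μ p g₁ W) (hL₂ : PLoc μ p g₂ W)
    (htop : ∀ x ∉ W, g x = ⊤) (h1 : ∀ x ∈ W, f₁ x < f₂ x → g₁ x ≤ g x)
    (h2 : ∀ x ∈ W, f₂ x ≤ f₁ x → g₂ x ≤ g x) : WUG μ p (fun x => min (f₁ x) (f₂ x)) g U := by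
  refine glue₂ hp h₁ h₂ hm₁ hm₂ hm hL₁ hL₂ htop (fun x y => ?_) ?_
  · exact (abs_min_sub_min_le_max _ _ _ _).trans (max_le_add_of_nonneg (abs_nonneg _)
      (abs_nonneg _))
  · intro c r hr hd hd₁ hd₂ hb₁ hb₂
    rcases le_or_gt (f₂ (c r)) (f₁ (c r)) with hle | hlt
    · rw [deriv_eq_of_le (A := fun s => Min.min (f₁ (c s)) (f₂ (c s)))
        (B := fun s => f₂ (c s)) (fun s => min_le_right _ _) (min_eq_right hle) hd hd₂]
      exact hb₂.trans (h2 _ hr hle)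
    · rw [deriv_eq_of_le (A := fun s => Min.min (f₁ (c s)) (f₂ (c s)))
        (B := fun s => f₁ (c s)) (fun s => min_le_left _ _) (min_eq_left hlt.le) hd hd₁]
      exact hb₁.trans (h1 _ hr hlt)

/-- A weak upper gradient of a nonnegative function may be taken to vanish on its zero set. -/
lemma indicator_pos (hp : 0 < p) (h : WUG μ p f g U) (hf : Measurable f) (hg : Measurable g)
    (hL : PLoc μ p g univ) (h0 : ∀ x, 0 ≤ f x) : WUG μ p f ({x | 0 < f x}.indicator g) U := by
  refine glue₂ hp h h hg hg
    (hg.indicator (measurableSet_lt measurable_const hf)) hL hL (by simp)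
    (fun x y => by linarith [abs_nonneg (f x - f y)]) ?_
  intro c r _ hd _ _ hb _
  rcases (h0 (c r)).eq_or_lt with he | hlt
  · rw [← deriv_eq_of_le (A := fun _ => 0) (fun s => h0 _) he (by simp) hd]
    simp
  · rwa [indicator_of_mem (show c r ∈ {x | 0 < f x} from hlt)]

lemma mul (hp : 0 < p) (h₁ : WUG μ p f₁ g₁ U) (h₂ : WUG μ p f₂ g₂ U)
    (hm₁ : Measurable g₁) (hm₂ : Measurable g₂) (hm : Measurable g)
    (hL₁ : PLoc μ p g₁ W) (hL₂ : PLoc μ p g₂ W) (htop : ∀ x ∉ W, g x = ⊤)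
    (hb₁ : ∀ x, |f₁ x| ≤ 1) (hb₂ : ∀ x, |f₂ x| ≤ 1)
    (h : ∀ x ∈ W, ENNReal.ofReal |f₂ x| * g₁ x + ENNReal.ofReal |f₁ x| * g₂ x ≤ g x) :
    WUG μ p (fun x => f₁ x * f₂ x) g U := by
  refine glue₂ hp h₁ h₂ hm₁ hm₂ hm hL₁ hL₂ htop (fun x y => ?_) ?_
  · have e : f₁ x * f₂ x - f₁ y * f₂ y = (f₁ x - f₁ y) * f₂ x + f₁ y * (f₂ x - f₂ y) := by ring
    rw [e]
    refine (abs_add_le _ _).trans ?_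
    rw [abs_mul, abs_mul]
    nlinarith [hb₁ y, hb₂ x, abs_nonneg (f₁ x - f₁ y), abs_nonneg (f₂ x - f₂ y)]
  · intro c r hr hd hd₁ hd₂ hb₁ hb₂
    rw [deriv_fun_mul hd₁ hd₂]
    refine le_trans ?_ (h _ hr)
    refine (ENNReal.ofReal_le_ofReal (abs_add_le _ _)).trans ?_
    rw [ENNReal.ofReal_add (abs_nonneg _) (abs_nonneg _), abs_mul, abs_mul,
      ENNReal.ofReal_mul (abs_nonneg _), ENNReal.ofReal_mul (abs_nonneg _), mul_comm]
    gcongr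

/-- Gluing along the open part `{ψ > 0}` of almost every curve. -/
lemma glue_pos (hp : 0 < p) {S : Set X} {ψ : X → ℝ}
    {g₀ : X → ℝ≥0∞} (hψ : WUG μ p ψ g₀ U) (hψ0 : ∀ x, 0 ≤ ψ x)
    (hm₀ : Measurable g₀) (hL₀ : PLoc μ p g₀ univ)
    (hψS : ∀ x, 0 < ψ x → x ∈ S)
    (h₁ : WUG μ p f g₁ U) (h₂ : WUG μ p (fun x => f x + ψ x) g₂ U)
    (hm₁ : Measurable g₁) (hm₂ : Measurable g₂) (hm : Measurable g)
    (hL₁ : PLoc μ p g₁ S) (hL₂ : PLoc μ p g₂ W) (htop : ∀ x ∉ W, g x = ⊤)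
    (hg₁ : ∀ x ∈ W, 0 < ψ x → g₁ x ≤ g x) (hg₂ : ∀ x ∈ W, ψ x = 0 → g₂ x ≤ g x) :
    WUG μ p f g U := by
  refine (PAECurve.and hp (PAECurve.and hp h₁ hL₁)
    (PAECurve.and hp (PAECurve.and hp h₂ hL₂) (PAECurve.and hp hψ hL₀))).mono fun γ hγ hU => ?_
  obtain ⟨⟨b₁, l₁⟩, ⟨b₂, l₂⟩, b₀, l₀⟩ := hγ
  intro s t h1 h2 h3
  by_cases htop' : ∫⁻ r in Icc s t, g (γ.path r) = ⊤
  · exact htop' ▸ le_top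
  have hmem : ∀ᵐ r, r ∈ Icc s t → γ.path r ∈ W := by
    have := ae_lt_top (hm.comp γ.measurable_path) htop'
    rw [ae_restrict_iff' measurableSet_Icc] at this
    filter_upwards [this] with r hr hrs
    by_contra hne
    exact (hr hrs).ne (htop _ hne)
  replace b₁ := (b₁ hU).mono_interval h1 h3
  replace b₂ := (b₂ hU).mono_interval h1 h3
  have m₁ := (hm₁.comp γ.measurable_path).aemeasurable (μ := volume)
  have m₂ := (hm₂.comp γ.measurable_path).aemeasurable (μ := volume)
  have m₀ := (hm₀.comp γ.measurable_path).aemeasurable (μ := volume)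
  have k₂ : ∫⁻ r in Icc s t, g₂ (γ.path r) ≠ ⊤ := by
    rw [curveLint_eq_path] at l₂
    have e : ∫⁻ r in Icc s t, g₂ (γ.path r) = ∫⁻ r in Icc s t, W.indicator g₂ (γ.path r) := by
      refine lintegral_congr_ae ?_
      rw [Filter.EventuallyEq, ae_restrict_iff' measurableSet_Icc]
      filter_upwards [hmem] with r hr hrs
      rw [indicator_of_mem (hr hrs)]
    rw [e]
    exact ((lintegral_mono_set (Icc_subset_Icc h1 h3)).trans_lt l₂).ne
  have k₀' : ∫⁻ r in Icc 0 γ.len, g₀ (γ.path r) ≠ ⊤ := by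
    rw [indicator_univ, curveLint_eq_path] at l₀
    exact l₀.ne
  have a₀' := (b₀ hU).absolutelyContinuous γ.len_pos.le m₀ k₀'
  have k₀ : ∫⁻ r in Icc s t, g₀ (γ.path r) ≠ ⊤ :=
    ne_top_of_le_ne_top k₀' (lintegral_mono_set (Icc_subset_Icc h1 h3))
  replace b₀ := (b₀ hU).mono_interval h1 h3
  have hcont : ContinuousOn (fun t => ψ (γ.path t)) (Ioo s t) := by
    have := a₀'.continuousOn
    rw [uIcc_of_le γ.len_pos.le] at this
    exact this.mono (Ioo_subset_Icc_self.trans (Icc_subset_Icc h1 h3))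
  obtain ⟨O, hO, hOe⟩ := (_root_.continuousOn_iff'.1 hcont) (Ioi 0) isOpen_Ioi
  have hO' : IsOpen (O ∩ Ioo s t) := hO.inter isOpen_Ioo
  have hOpos : ∀ r ∈ Ioo s t, 0 < ψ (γ.path r) ↔ r ∈ O ∩ Ioo s t := fun r hr => by
    rw [← hOe]; simp [hr.1, hr.2]
  have k₁ : ∫⁻ r in Icc s t ∩ (O ∩ Ioo s t), g₁ (γ.path r) ≠ ⊤ := by
    rw [curveLint_eq_path] at l₁
    refine ne_top_of_le_ne_top l₁.ne ?_
    calc ∫⁻ r in Icc s t ∩ (O ∩ Ioo s t), g₁ (γ.path r)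
        ≤ ∫⁻ r in Icc s t ∩ (O ∩ Ioo s t), S.indicator g₁ (γ.path r) := by
          refine setLIntegral_mono' (measurableSet_Icc.inter hO'.measurableSet) fun r hr => ?_
          rw [indicator_of_mem (hψS _ ((hOpos r hr.2.2).2 hr.2))]
      _ ≤ _ := lintegral_mono_set (inter_subset_left.trans (Icc_subset_Icc h1 h3))
  refine IncrBound.of_deriv_le (F := fun t => f (γ.path t)) (G := fun t => g (γ.path t))
    (AbsolutelyContinuousOnInterval.of_dist_le (K := 1)
    (b₂.absolutelyContinuous h2 m₂ k₂) (b₀.absolutelyContinuous h2 m₀ k₀)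
    (b₀.absolutelyContinuous h2 m₀ k₀) fun s t => ?_) ?_ s t le_rfl h2 le_rfl
  · have h5 := abs_sub_abs_le_abs_sub (f (γ.path s) - f (γ.path t))
      (-(ψ (γ.path s) - ψ (γ.path t)))
    rw [abs_neg] at h5
    have h6 : f (γ.path s) - f (γ.path t) - -(ψ (γ.path s) - ψ (γ.path t)) =
      f (γ.path s) + ψ (γ.path s) - (f (γ.path t) + ψ (γ.path t)) := by ring
    rw [h6] at h5
    have := abs_nonneg (ψ (γ.path s) - ψ (γ.path t))
    linarith
  filter_upwards [hmem, b₁.deriv_le_of_isOpen m₁ hO' k₁, b₂.deriv_le h2 m₂ k₂,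
    b₀.deriv_le h2 m₀ k₀] with r hr d₁ d₂ d₀ hI hd
  have hr' := hr (Ioo_subset_Icc_self hI)
  rcases (hψ0 (γ.path r)).eq_or_lt with he | hlt
  · refine le_trans (le_of_eq ?_) ((d₂ hI).2.trans (hg₂ _ hr' he.symm))
    rw [deriv_fun_add hd (d₀ hI).1, ← deriv_eq_of_le (A := fun _ => 0)
      (B := fun s => ψ (γ.path s)) (fun s => hψ0 _) he (by simp) (d₀ hI).1]
    simp
  · exact (d₁ hI ((hOpos r hI).1 hlt)).2.trans (hg₁ _ hr' hlt)

end WUG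

lemma PAECurve.sub {μ : Measure X} {p : ℝ} {P : Curve X → Prop} (h : PAECurve μ p P) :
    PAECurve μ p fun γ => ∀ s t (hs : 0 ≤ s) (hst : s < t) (ht : t ≤ γ.len),
      P (γ.sub s t hs hst ht) := by
  obtain ⟨ρ, hm, hfin, hρ⟩ := h
  refine ⟨ρ, hm, hfin, fun γ hγ s t hs hst ht => hρ _ ?_⟩
  rw [curveLint_sub]
  rw [curveLint_eq_path] at hγ
  exact (lintegral_mono_set (Icc_subset_Icc hs ht)).trans_lt hγ

lemma Curve.inSet_sub (γ : Curve X) {s t : ℝ} (hs : 0 ≤ s) (hst : s < t) (ht : t ≤ γ.len)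
    {U : Set X} : (γ.sub s t hs hst ht).InSet U ↔ ∀ r ∈ Icc s t, γ.path r ∈ U := by
  constructor
  · intro h r hr
    have := h (r - s) ⟨by linarith [hr.1], by
      have : r ≤ t := hr.2
      simp only [Curve.sub]; linarith⟩
    rw [γ.path_eq ⟨hs.trans hr.1, hr.2.trans ht⟩]
    simpa [Curve.sub] using this
  · intro h r hr
    have hr2 : r ≤ t - s := hr.2
    have := h (s + r) ⟨by linarith [hr.1], by linarith⟩
    rwa [γ.path_eq ⟨by linarith [hr.1], by linarith⟩] at this

lemma WUG.incr {μ : Measure X} {p : ℝ} {f : X → ℝ} {g : X → ℝ≥0∞} {U : Set X}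
    (h : WUG μ p f g U) :
    PAECurve μ p fun γ => ∀ s t, 0 ≤ s → s ≤ t → t ≤ γ.len → (∀ r ∈ Icc s t, γ.path r ∈ U) →
      ENNReal.ofReal |f (γ.path s) - f (γ.path t)| ≤ ∫⁻ r in Icc s t, g (γ.path r) := by
  refine (PAECurve.sub h).mono fun γ hγ s t hs hst ht hU => ?_
  rcases hst.eq_or_lt with rfl | hlt
  · simp
  have h1 := hγ s t hs hlt ht ((γ.inSet_sub hs hlt ht).2 hU) 0 (t - s) le_rfl
    (sub_nonneg.2 hst) le_rfl
  have e := curveLint_sub γ g hs hlt ht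
  rw [curveLint_eq_path] at e
  have e' : ∀ r ∈ Icc 0 (t - s), (γ.sub s t hs hlt ht).path r = γ.path (s + r) := by
    intro r hr
    rw [Curve.path_eq _ hr, γ.path_eq ⟨by linarith [hr.1], by linarith [hr.2]⟩]
    rfl
  simp only at h1
  rw [e' 0 ⟨le_rfl, by linarith⟩, e' (t - s) ⟨by linarith, le_rfl⟩] at h1
  simpa using h1.trans_eq e

lemma lintegral_rpow_add_lt_top' {α : Type*} [MeasurableSpace α] {μ : Measure α} {p : ℝ}
    (hp : 0 < p) {a b : α → ℝ≥0∞} (ha : Measurable a) (hfa : ∫⁻ x, a x ^ p ∂μ < ⊤)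
    (hfb : ∫⁻ x, b x ^ p ∂μ < ⊤) : ∫⁻ x, (a x + b x) ^ p ∂μ < ⊤ := by
  have h : ∀ x, (a x + b x) ^ p ≤ 2 ^ p * (a x ^ p + b x ^ p) := fun x => by
    rcases le_total (a x) (b x) with h | h
    · calc (a x + b x) ^ p ≤ (2 * b x) ^ p := by rw [two_mul]; gcongr
        _ = 2 ^ p * b x ^ p := ENNReal.mul_rpow_of_nonneg _ _ hp.le
        _ ≤ _ := by gcongr; exact le_add_self
    · calc (a x + b x) ^ p ≤ (2 * a x) ^ p := by rw [two_mul]; gcongr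
        _ = 2 ^ p * a x ^ p := ENNReal.mul_rpow_of_nonneg _ _ hp.le
        _ ≤ _ := by gcongr; exact le_self_add
  refine (lintegral_mono h).trans_lt ?_
  rw [lintegral_const_mul' _ _ (by finiteness), lintegral_add_left (ha.pow_const p)]
  exact ENNReal.mul_lt_top (by finiteness) (ENNReal.add_lt_top.2 ⟨hfa, hfb⟩)

section Energy

variable {μ : Measure X} {p : ℝ} {U W V : Set X}

lemma fineEnergy_le (hp : 0 < p) {f : X → ℝ} {g : X → ℝ≥0∞} (hg : Measurable g)
    (h : WUG μ p f g U) (S : Set X) : fineEnergy μ p f U S ≤ ∫⁻ x in S, g x ^ p ∂μ :=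
  iInf₂_le_of_le g hg (iInf_le _ (h.isWeakUpperGradientOn hp))

lemma exists_wug_of_fineEnergy_lt [SFinite μ] (hp : 0 < p) {f : X → ℝ} {S : Set X} {c : ℝ≥0∞}
    (h : fineEnergy μ p f U S < c) :
    ∃ g : X → ℝ≥0∞, Measurable g ∧ WUG μ p f g U ∧ ∫⁻ x in S, g x ^ p ∂μ < c := by
  simp only [fineEnergy, iInf_lt_iff] at h
  obtain ⟨g, hg, hw, hlt⟩ := h
  exact ⟨g, hg, hw.wug hp, hlt⟩

lemma MemNp.exists_wug [SFinite μ] (hp : 0 < p) {f : X → ℝ} (h : MemNp μ p f U) :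
    ∃ g : X → ℝ≥0∞, Measurable g ∧ WUG μ p f g U ∧ ∫⁻ x in U, g x ^ p ∂μ < ⊤ :=
  exists_wug_of_fineEnergy_lt hp (S := U) ((le_add_self).trans_lt h.2)

lemma MemNp.of_wug (hp : 0 < p) {f : X → ℝ} (hf : Measurable f)
    (hfin : ∫⁻ x in U, ENNReal.ofReal |f x| ^ p ∂μ < ⊤) {g : X → ℝ≥0∞} (hg : Measurable g)
    (h : WUG μ p f g U) (hgfin : ∫⁻ x in U, g x ^ p ∂μ < ⊤) : MemNp μ p f U :=
  ⟨hf, ENNReal.add_lt_top.2 ⟨hfin, (fineEnergy_le hp hg h U).trans_lt hgfin⟩⟩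

lemma lintegral_piecewise_rpow {S : Set X} (hS : MeasurableSet S) [DecidablePred (· ∈ S)]
    (W : Set X) (a b : X → ℝ≥0∞) :
    ∫⁻ x in W, (S.piecewise a b x) ^ p ∂μ =
      (∫⁻ x in W ∩ S, a x ^ p ∂μ) + ∫⁻ x in W \ S, b x ^ p ∂μ := by
  rw [← lintegral_inter_add_sdiff (μ := μ) _ W hS]
  congr 1
  · rw [inter_comm, ← Measure.restrict_restrict hS]
    exact setLIntegral_congr_fun hS fun x hx => by simp [hx]
  · rw [sdiff_eq, inter_comm, ← Measure.restrict_restrict hS.compl]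
    refine setLIntegral_congr_fun hS.compl fun x hx => ?_
    rw [mem_compl_iff] at hx
    simp [hx]

lemma lintegral_piecewise_toMeasurable_rpow [SFinite μ] (W : Set X)
    [DecidablePred (· ∈ toMeasurable μ W)] (a b : X → ℝ≥0∞) :
    ∫⁻ x in W, ((toMeasurable μ W).piecewise a b x) ^ p ∂μ = ∫⁻ x in W, a x ^ p ∂μ := by
  have h0 : W \ toMeasurable μ W = ∅ := sdiff_eq_empty.2 (subset_toMeasurable μ W)
  rw [lintegral_piecewise_rpow (measurableSet_toMeasurable _ _), h0,
    inter_eq_left.2 (subset_toMeasurable μ W)]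
  simp

lemma fineEnergy_max_add_min_le [SFinite μ] (hp : 0 < p) {a b : X → ℝ} (ha : Measurable a)
    (hb : Measurable b) :
    fineEnergy μ p (fun x => max (a x) (b x)) U W + fineEnergy μ p (fun x => min (a x) (b x)) U W ≤
      fineEnergy μ p a U W + fineEnergy μ p b U W := by
  classical
  refine ENNReal.le_of_forall_pos_le_add fun ε hε hlt => ?_
  obtain ⟨hA, hB⟩ := ENNReal.add_lt_top.1 hlt
  have hε' : (ε / 2 : ℝ≥0∞) ≠ 0 := by simpa using hε.ne'
  obtain ⟨g₁, hm₁, h₁, hi₁⟩ := exists_wug_of_fineEnergy_lt hp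
    (ENNReal.lt_add_right hA.ne hε')
  obtain ⟨g₂, hm₂, h₂, hi₂⟩ := exists_wug_of_fineEnergy_lt hp
    (ENNReal.lt_add_right hB.ne hε')
  have hW := measurableSet_toMeasurable μ W
  set W' := toMeasurable μ W with hW'
  have hS : MeasurableSet {x | b x ≤ a x} := measurableSet_le hb ha
  have hL₁ : PLoc μ p g₁ W' := PLoc.of_lintegral hp hm₁ hW (by
    rw [Measure.restrict_toMeasurable_of_sFinite]
    exact hi₁.trans (ENNReal.add_lt_top.2 ⟨hA, by finiteness⟩))
  have hL₂ : PLoc μ p g₂ W' := PLoc.of_lintegral hp hm₂ hW (by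
    rw [Measure.restrict_toMeasurable_of_sFinite]
    exact hi₂.trans (ENNReal.add_lt_top.2 ⟨hB, by finiteness⟩))
  have hmM : Measurable (W'.piecewise ({x | b x ≤ a x}.piecewise g₁ g₂) fun _ => ⊤) :=
    (hm₁.piecewise hS hm₂).piecewise hW measurable_const
  have hmm : Measurable (W'.piecewise ({x | b x ≤ a x}.piecewise g₂ g₁) fun _ => ⊤) :=
    (hm₂.piecewise hS hm₁).piecewise hW measurable_const
  have hM := h₁.max hp h₂ hm₁ hm₂ hmM hL₁ hL₂ (fun x hx => by simp [hx])
    (fun x hx h => by simp [hx, h]) (fun x hx h => by simp [hx, h])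
  have hm := h₁.min hp h₂ hm₁ hm₂ hmm hL₁ hL₂ (fun x hx => by simp [hx])
    (fun x hx h => by simp [hx, h]) (fun x hx h => by simp [hx, h])
  refine (add_le_add (fineEnergy_le hp hmM hM W) (fineEnergy_le hp hmm hm W)).trans ?_
  rw [lintegral_piecewise_toMeasurable_rpow, lintegral_piecewise_toMeasurable_rpow,
    lintegral_piecewise_rpow hS, lintegral_piecewise_rpow hS]
  have e₁ := lintegral_inter_add_sdiff (μ := μ) (fun x => g₁ x ^ p) W hS
  have e₂ := lintegral_inter_add_sdiff (μ := μ) (fun x => g₂ x ^ p) W hS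
  calc _ = (∫⁻ x in W, g₁ x ^ p ∂μ) + ∫⁻ x in W, g₂ x ^ p ∂μ := by
        rw [← e₁, ← e₂]; ring
    _ ≤ _ := add_le_add hi₁.le hi₂.le
    _ = _ := by
        rw [add_add_add_comm, ENNReal.add_halves]

/-- A function dominated by a nonnegative Newtonian function vanishing outside `W ⊆ U`, with a
weak upper gradient with respect to `U`, has a global weak upper gradient. -/
lemma WUG.extend_zero (hp : 0 < p) (hWU : W ⊆ U) {ζ φ : X → ℝ} {G g₀ : X → ℝ≥0∞}
    (hφ : WUG μ p φ g₀ univ) (hg₀ : Measurable g₀) (hL₀ : PLoc μ p g₀ univ)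
    (hφW : ∀ x ∉ W, φ x = 0) (h0 : ∀ x, 0 ≤ ζ x) (hle : ∀ x, ζ x ≤ φ x)
    (hζ : WUG μ p ζ G U) {H : X → ℝ≥0∞} (hH : ∀ x ∈ W, G x ≤ H x) :
    WUG μ p ζ H univ := by
  refine (PAECurve.and hp hζ.incr (PAECurve.and hp hφ hL₀)).mono fun γ hγ _ s t h1 h2 h3 => ?_
  obtain ⟨hincr, hb, hl⟩ := hγ
  have hcont : ContinuousOn (fun t => φ (γ.path t)) (Icc s t) := by
    have hfin : ∫⁻ r in Icc 0 γ.len, g₀ (γ.path r) ≠ ⊤ := by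
      rw [indicator_univ, curveLint_eq_path] at hl
      exact hl.ne
    have := ((hb fun _ _ => mem_univ _).absolutelyContinuous γ.len_pos.le
      (hg₀.comp γ.measurable_path).aemeasurable hfin).continuousOn
    rw [uIcc_of_le γ.len_pos.le] at this
    exact this.mono (Icc_subset_Icc h1 h3)
  have hnn : ∀ x, 0 ≤ φ x := fun x => (h0 x).trans (hle x)
  have hmem : ∀ r, φ (γ.path r) ≠ 0 → γ.path r ∈ W := fun r hr => by
    by_contra hne; exact hr (hφW _ hne)
  set I := ∫⁻ r in Icc s t, H (γ.path r) with hI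
  have hdirect : ∀ s' t', s ≤ s' → s' ≤ t' → t' ≤ t →
      (∀ r ∈ Icc s' t', φ (γ.path r) ≠ 0) →
      ENNReal.ofReal |ζ (γ.path s') - ζ (γ.path t')| ≤ I := by
    intro s' t' a1 a2 a3 hne
    refine (hincr s' t' (h1.trans a1) a2 (a3.trans h3)
      fun r hr => hWU (hmem r (hne r hr))).trans ?_
    refine (setLIntegral_mono' measurableSet_Icc
      fun r hr => hH _ (hmem r (hne r hr))).trans ?_
    exact lintegral_mono_set (Icc_subset_Icc a1 a3)
  by_cases hz : ∀ r ∈ Icc s t, φ (γ.path r) ≠ 0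
  · exact hdirect s t le_rfl h2 le_rfl hz
  push Not at hz
  have hcomp : IsCompact (Icc s t ∩ (fun r => φ (γ.path r)) ⁻¹' {0}) :=
    isCompact_Icc.of_isClosed_subset (hcont.preimage_isClosed_of_isClosed isClosed_Icc
      isClosed_singleton) inter_subset_left
  obtain ⟨z, hz1, hz2⟩ := hz
  have hne : (Icc s t ∩ (fun r => φ (γ.path r)) ⁻¹' {0}).Nonempty := ⟨z, hz1, hz2⟩
  obtain ⟨c, ⟨hc1, hc2⟩, hcmin⟩ := hcomp.exists_isLeast hne
  obtain ⟨d, ⟨hd1, hd2⟩, hdmax⟩ := hcomp.exists_isGreatest hne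
  have hleft : ENNReal.ofReal (ζ (γ.path s)) ≤ I := by
    refine ENNReal.le_of_forall_pos_le_add fun ε hε _ => ?_
    have hε' : (0 : ℝ) < ε := hε
    rcases hc1.1.eq_or_lt with he | hlt
    · have : ζ (γ.path s) ≤ 0 := by
        rw [he]; exact (hle _).trans hc2.le
      rw [ENNReal.ofReal_of_nonpos this]; exact bot_le
    have h4 : ∀ᶠ r in nhdsWithin c (Icc s t), φ (γ.path r) < ε :=
      (hcont c hc1).eventually (gt_mem_nhds (by
        have : φ (γ.path c) = 0 := hc2
        beta_reduce; rw [this]; exact hε'))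
    have h5 : ∀ᶠ r in nhdsWithin c (Iio c), φ (γ.path r) < ε ∧ r ∈ Ioo s c := by
      refine Filter.Eventually.and ?_ (Ioo_mem_nhdsLT hlt)
      have hsub : nhdsWithin c (Iio c) ≤ nhdsWithin c (Icc s t) := by
        rw [← nhdsWithin_Ioo_eq_nhdsLT hlt]
        exact nhdsWithin_mono _ fun r hr => ⟨hr.1.le, hr.2.le.trans hc1.2⟩
      exact hsub h4
    obtain ⟨r, hr1, hr2⟩ := h5.exists
    have h6 := hdirect s r le_rfl hr2.1.le (hr2.2.le.trans hc1.2) fun q hq hq0 =>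
      absurd (hcmin ⟨⟨hq.1, hq.2.trans (hr2.2.le.trans hc1.2)⟩, hq0⟩)
        (not_le.2 (hq.2.trans_lt hr2.2))
    calc ENNReal.ofReal (ζ (γ.path s))
        ≤ ENNReal.ofReal (|ζ (γ.path s) - ζ (γ.path r)| + ε) := ENNReal.ofReal_le_ofReal (by
          linarith [le_abs_self (ζ (γ.path s) - ζ (γ.path r)), hle (γ.path r)])
      _ ≤ I + ε := by
          rw [ENNReal.ofReal_add (abs_nonneg _) hε'.le, ENNReal.ofReal_coe_nnreal]
          gcongr
  have hright : ENNReal.ofReal (ζ (γ.path t)) ≤ I := by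
    refine ENNReal.le_of_forall_pos_le_add fun ε hε _ => ?_
    have hε' : (0 : ℝ) < ε := hε
    rcases hd1.2.eq_or_lt with he | hlt
    · have : ζ (γ.path t) ≤ 0 := by
        rw [← he]; exact (hle _).trans hd2.le
      rw [ENNReal.ofReal_of_nonpos this]; exact bot_le
    have h4 : ∀ᶠ r in nhdsWithin d (Icc s t), φ (γ.path r) < ε :=
      (hcont d hd1).eventually (gt_mem_nhds (by
        have : φ (γ.path d) = 0 := hd2
        beta_reduce; rw [this]; exact hε'))
    have h5 : ∀ᶠ r in nhdsWithin d (Ioi d), φ (γ.path r) < ε ∧ r ∈ Ioo d t := by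
      refine Filter.Eventually.and ?_ (Ioo_mem_nhdsGT hlt)
      have hsub : nhdsWithin d (Ioi d) ≤ nhdsWithin d (Icc s t) := by
        rw [← nhdsWithin_Ioo_eq_nhdsGT hlt]
        exact nhdsWithin_mono _ fun r hr => ⟨hd1.1.trans hr.1.le, hr.2.le⟩
      exact hsub h4
    obtain ⟨r, hr1, hr2⟩ := h5.exists
    have h6 := hdirect r t (hd1.1.trans hr2.1.le) hr2.2.le le_rfl fun q hq hq0 =>
      absurd (hdmax ⟨⟨(hd1.1.trans hr2.1.le).trans hq.1, hq.2⟩, hq0⟩)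
        (not_le.2 (hr2.1.trans_le hq.1))
    calc ENNReal.ofReal (ζ (γ.path t))
        ≤ ENNReal.ofReal (|ζ (γ.path r) - ζ (γ.path t)| + ε) := ENNReal.ofReal_le_ofReal (by
          linarith [neg_abs_le (ζ (γ.path r) - ζ (γ.path t)), hle (γ.path r)])
      _ ≤ I + ε := by
          rw [ENNReal.ofReal_add (abs_nonneg _) hε'.le, ENNReal.ofReal_coe_nnreal]
          gcongr
  refine le_trans (ENNReal.ofReal_le_ofReal (?_ : _ ≤ Max.max (ζ (γ.path s)) (ζ (γ.path t)))) ?_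
  · rw [abs_sub_le_iff]
    constructor
    · linarith [le_max_left (ζ (γ.path s)) (ζ (γ.path t)), h0 (γ.path t)]
    · linarith [le_max_right (ζ (γ.path s)) (ζ (γ.path t)), h0 (γ.path s)]
  · rw [ENNReal.ofReal_max]
    exact max_le hleft hright

lemma fineEnergy_min_le [SFinite μ] (hp : 0 < p) {u ψ φ : X → ℝ}
    (hmin : ∀ φ : X → ℝ, MemNp0 μ p φ W → (∀ x, 0 ≤ φ x) →
      fineEnergy μ p u U W ≤ fineEnergy μ p (fun x => u x + φ x) U W)
    (hWU : W ⊆ U) (hu : Measurable u) (hψ : Measurable ψ)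
    (hEu : fineEnergy μ p u U W < ⊤) (hEψ : fineEnergy μ p ψ U W < ⊤)
    (hφ : MemNp0 μ p φ W) (h0 : ∀ x, 0 ≤ φ x) (hle : ∀ x, ψ x ≤ u x + φ x) :
    fineEnergy μ p (fun x => min (u x) (ψ x)) U W ≤ fineEnergy μ p ψ U W := by
  obtain ⟨g₁, hm₁, h₁, hi₁⟩ := exists_wug_of_fineEnergy_lt hp hEu
  obtain ⟨g₂, hm₂, h₂, hi₂⟩ := exists_wug_of_fineEnergy_lt hp hEψ
  obtain ⟨g₀, hm₀, hw₀, hi₀⟩ := hφ.1.exists_wug hp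
  rw [Measure.restrict_univ] at hi₀
  have hmζ : Measurable fun x => max (ψ x - u x) 0 := (hψ.sub hu).max measurable_const
  have hζle : ∀ x, max (ψ x - u x) 0 ≤ φ x := fun x =>
    max_le (by linarith [hle x]) (h0 x)
  have hsum : Measurable fun x => g₂ x + g₁ x := hm₂.add hm₁
  have hW := measurableSet_toMeasurable μ W
  have hζ : MemNp0 μ p (fun x => max (ψ x - u x) 0) W := by
    refine ⟨MemNp.of_wug hp hmζ ?_ (hsum.indicator hW) (WUG.extend_zero hp hWU hw₀ hm₀
      (PLoc.of_lintegral_univ hp hm₀ MeasurableSet.univ hi₀) hφ.2 (fun x => le_max_right _ _)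
      hζle (h₂.add hp h₁ hm₂ fun x y => ?_) fun x hx => ?_) ?_, fun x hx => ?_⟩
    · refine lt_of_le_of_lt (lintegral_mono fun x => ?_)
        (lt_of_le_of_lt le_self_add hφ.1.2)
      gcongr 1
      refine ENNReal.ofReal_le_ofReal (abs_le_abs_of_nonneg (le_max_right _ _) (hζle x))
    · refine (abs_max_sub_max_le_abs _ _ _).trans ?_
      have e : ψ x - u x - (ψ y - u y) = (ψ x - ψ y) - (u x - u y) := by ring
      rw [e]
      exact abs_sub _ _
    · rw [indicator_of_mem (subset_toMeasurable μ W hx)]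
    · rw [Measure.restrict_univ]
      have e : ∀ x, (toMeasurable μ W).indicator (fun x => g₂ x + g₁ x) x ^ p =
          (toMeasurable μ W).indicator (fun x => (g₂ x + g₁ x) ^ p) x := fun x => by
        by_cases hx : x ∈ toMeasurable μ W <;> simp [hx, hp]
      simp_rw [e]
      rw [lintegral_indicator hW, Measure.restrict_toMeasurable_of_sFinite]
      exact lintegral_rpow_add_lt_top' hp hm₂ hi₂ hi₁
    · exact le_antisymm ((hζle x).trans_eq (hφ.2 x hx)) (le_max_right _ _)
  have h1 := hmin _ hζ fun x => le_max_right _ _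
  have e : (fun x => u x + max (ψ x - u x) 0) = fun x => max (u x) (ψ x) := by
    ext x
    rcases le_total (ψ x) (u x) with h | h
    · rw [max_eq_right (by linarith), max_eq_left h, add_zero]
    · rw [max_eq_left (by linarith), max_eq_right h]; ring
  rw [e] at h1
  have h2 := fineEnergy_max_add_min_le (μ := μ) (U := U) (W := W) hp hu hψ
  have hfin : fineEnergy μ p (fun x => max (u x) (ψ x)) U W ≠ ⊤ :=
    ((le_self_add.trans h2).trans_lt (ENNReal.add_lt_top.2 ⟨hEu, hEψ⟩)).ne
  exact (ENNReal.add_le_add_iff_left hfin).1 (h2.trans (by gcongr))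

end Energy

section Assembly

variable {μ : Measure X} {p : ℝ} {U W V : Set X}

/-- If almost every curve spending no time in `B` stays in `V`, then a function in `N^{1,p}(V)`
has finite energy with respect to `U` on sets avoiding `B`. -/
lemma MemNp.fineEnergy_lt_top [SFinite μ] (hp : 0 < p) {f : X → ℝ} {B : Set X}
    (hf : MemNp μ p f V) (hB : MeasurableSet B) (hWV : W ⊆ V) (hWB : Disjoint W B)
    (hcurve : PAECurve μ p fun γ => (∀ᵐ t, t ∈ Icc 0 γ.len → γ.path t ∉ B) → γ.InSet V) :
    fineEnergy μ p f U W < ⊤ := by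
  classical
  obtain ⟨g, hg, hw, hfin⟩ := hf.exists_wug hp
  have hm : Measurable (B.piecewise (fun _ => ⊤) g) := measurable_const.piecewise hB hg
  refine (fineEnergy_le hp hm ?_ W).trans_lt (?_ : _ < ⊤)
  · refine (PAECurve.and hp hw.incr (PAECurve.sub hcurve)).mono fun γ hγ _ s t h1 h2 h3 => ?_
    obtain ⟨hi, hc⟩ := hγ
    by_cases htop : ∫⁻ r in Icc s t, B.piecewise (fun _ => ⊤) g (γ.path r) = ⊤
    · exact le_top.trans_eq htop.symm
    have hae : ∀ᵐ r, r ∈ Icc s t → γ.path r ∉ B := by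
      have := ae_lt_top (hm.comp γ.measurable_path) htop
      rw [ae_restrict_iff' measurableSet_Icc] at this
      filter_upwards [this] with r hr hrs hB
      have := hr hrs
      simp [hB] at this
    rcases h2.eq_or_lt with rfl | hlt
    · simp
    have hin : ∀ r ∈ Icc s t, γ.path r ∈ V := by
      rw [← γ.inSet_sub h1 hlt h3]
      refine hc s t h1 hlt h3 ?_
      have hae' : ∀ᵐ r, s + r ∈ Icc s t → γ.path (s + r) ∉ B :=
        (measurePreserving_add_left volume s).quasiMeasurePreserving.ae hae
      filter_upwards [hae'] with r hr hrm
      have hrm' : r ≤ t - s := hrm.2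
      have h4 : s + r ∈ Icc s t := ⟨by linarith [hrm.1], by linarith⟩
      rw [Curve.path_eq _ hrm]
      have := hr h4
      rwa [γ.path_eq ⟨h1.trans h4.1, h4.2.trans h3⟩] at this
    refine (hi s t h1 h2 h3 hin).trans_eq ?_
    refine setLIntegral_congr_fun_ae measurableSet_Icc ?_
    filter_upwards [hae] with r hr hrs
    rw [piecewise_eq_of_notMem _ _ _ (hr hrs)]
  · refine lt_of_le_of_lt ?_ hfin
    rw [lintegral_piecewise_rpow hB, disjoint_iff_inter_eq_empty.1 hWB]
    simpa using lintegral_mono_set (sdiff_subset.trans hWV)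

lemma exists_energy_add_le (hp : 1 ≤ p) {G : X → ℝ≥0∞} (hG : Measurable G)
    (hfin : ∫⁻ x in V, G x ^ p ∂μ < ⊤) {η : ℝ≥0∞} (hη : η ≠ 0) :
    ∃ ε : ℝ≥0∞, 0 < ε ∧ ∀ e : X → ℝ≥0∞, Measurable e → ∫⁻ x, e x ^ p ∂μ ≤ ε →
      ∫⁻ x in V, (G x + e x) ^ p ∂μ ≤ (∫⁻ x in V, G x ^ p ∂μ) + η := by
  have hp0 : 0 < p := by linarith
  set A := ∫⁻ x in V, G x ^ p ∂μ with hA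
  have hcont : Continuous fun t : ℝ≥0∞ => (A ^ (1 / p) + t ^ (1 / p)) ^ p :=
    (ENNReal.continuous_rpow_const).comp
      (continuous_const.add ENNReal.continuous_rpow_const)
  have h0 : (A ^ (1 / p) + (0 : ℝ≥0∞) ^ (1 / p)) ^ p = A := by
    rw [ENNReal.zero_rpow_of_pos (by positivity), add_zero, ← ENNReal.rpow_mul,
      one_div_mul_cancel hp0.ne', ENNReal.rpow_one]
  have hev : ∀ᶠ t in nhdsWithin (0 : ℝ≥0∞) (Ioi 0),
      (A ^ (1 / p) + t ^ (1 / p)) ^ p < A + η ∧ t ∈ Ioi (0 : ℝ≥0∞) := by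
    refine Eventually.and (nhdsWithin_le_nhds (hcont.continuousAt.eventually (gt_mem_nhds ?_)))
      self_mem_nhdsWithin
    beta_reduce; rw [h0]; exact ENNReal.lt_add_right hfin.ne hη
  obtain ⟨ε, hε, hε0⟩ := hev.exists
  refine ⟨ε, hε0, fun e he hle => ?_⟩
  have h1 := ENNReal.lintegral_Lp_add_le (μ := μ.restrict V) hG.aemeasurable he.aemeasurable hp
  have h2 : ∫⁻ x in V, e x ^ p ∂μ ≤ ε := (setLIntegral_le_lintegral _ _).trans hle
  calc ∫⁻ x in V, (G x + e x) ^ p ∂μ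
      = ((∫⁻ x in V, (G x + e x) ^ p ∂μ) ^ (1 / p)) ^ p := by
        rw [← ENNReal.rpow_mul, one_div_mul_cancel hp0.ne', ENNReal.rpow_one]
    _ ≤ (A ^ (1 / p) + ε ^ (1 / p)) ^ p := by
        gcongr
        exact h1.trans (by gcongr)
    _ ≤ A + η := hε.le

/-- `V` and `φ` can be approximated from inside by a finely open set `W` which is separated from
the complement of `V`, up to a set of curves of measure zero. -/
def HasInnerApprox (μ : Measure X) (p : ℝ) (V : Set X) (φ : X → ℝ) : Prop :=
  ∀ ε : ℝ≥0∞, 0 < ε → ∃ W ⊆ V, FinelyOpen μ p W ∧ ∃ φ' : X → ℝ, MemNp0 μ p φ' W ∧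
    (∀ x, 0 ≤ φ' x) ∧ (∃ e : X → ℝ≥0∞, Measurable e ∧ WUG μ p (fun x => φ x - φ' x) e univ ∧
      ∫⁻ x, e x ^ p ∂μ ≤ ε) ∧
    ∃ B : Set X, MeasurableSet B ∧ Disjoint W B ∧
      PAECurve μ p fun γ => (∀ᵐ t, t ∈ Icc 0 γ.len → γ.path t ∉ B) → γ.InSet V

lemma GoodSubset.subset (h : GoodSubset μ p V U) (hWV : W ⊆ V) (hW : FinelyOpen μ p W) :
    GoodSubset μ p W U := by
  obtain ⟨_, ⟨hVU, η, hη, hη1⟩, hc, hcU⟩ := h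
  exact ⟨hW, ⟨hWV.trans hVU, η, hη, fun x hx => hη1 x (hWV hx)⟩,
    hc.of_isClosed_subset isClosed_closure (closure_mono hWV), (closure_mono hWV).trans hcU⟩

lemma fineSuperminimizer_min_of_hasInnerApprox [SFinite μ] (hp : 1 < p) {u v : X → ℝ}
    (hmu : Measurable u) (hmv : Measurable v)
    (hu : FineSuperminimizer μ p u U) (hv : FineSuperminimizer μ p v U)
    (hV : GoodSubset μ p V U) {φ : X → ℝ} (happ : HasInnerApprox μ p V φ) :
    fineEnergy μ p (fun x => min (u x) (v x)) U V ≤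
      fineEnergy μ p (fun x => min (u x) (v x) + φ x) U V := by
  classical
  have hp0 : 0 < p := by linarith
  refine ENNReal.le_of_forall_pos_le_add fun η hη hlt => ?_
  have hη3 : (η / 3 : ℝ≥0∞) ≠ 0 := by simpa using hη.ne'
  set w : X → ℝ := fun x => min (u x) (v x) with hw
  have hmw : Measurable w := hmu.min hmv
  obtain ⟨G, hmG, hG, hGi⟩ := exists_wug_of_fineEnergy_lt hp0 (ENNReal.lt_add_right hlt.ne hη3)
  have hGfin : ∫⁻ x in V, G x ^ p ∂μ < ⊤ :=
    hGi.trans (ENNReal.add_lt_top.2 ⟨hlt, by finiteness⟩)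
  obtain ⟨ε, hε, hadd⟩ := exists_energy_add_le hp.le hmG hGfin hη3
  obtain ⟨W, hWV, hWfine, φ', hφ', hφ'0, ⟨e, hme, he, hei⟩, B, hB, hWB, hcurve⟩ := happ ε hε
  have hWU : GoodSubset μ p W U := hV.subset hWV hWfine
  have hEu : fineEnergy μ p u U W < ⊤ :=
    (hu.1 V hV).fineEnergy_lt_top hp0 hB hWV hWB hcurve
  have hEv : fineEnergy μ p v U W < ⊤ :=
    (hv.1 V hV).fineEnergy_lt_top hp0 hB hWV hWB hcurve
  set Gn : X → ℝ≥0∞ := fun x => G x + e x with hGn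
  have hmGn : Measurable Gn := hmG.add hme
  have hGnw : WUG μ p (fun x => w x + φ' x) Gn U :=
    hG.add hp0 (he.mono_set (subset_univ U)) hmG fun x y => by
      have e1 : w x + φ' x - (w y + φ' y) = (w x + φ x - (w y + φ y)) -
        (φ x - φ' x - (φ y - φ' y)) := by ring
      rw [e1]; exact abs_sub _ _
  have hGni := hadd e hme hei
  have hGnfin : ∫⁻ x in V, Gn x ^ p ∂μ < ⊤ :=
    hGni.trans_lt (ENNReal.add_lt_top.2 ⟨hGfin, by finiteness⟩)
  have hEψ : fineEnergy μ p (fun x => w x + φ' x) U W < ⊤ :=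
    (fineEnergy_le hp0 hmGn hGnw W).trans_lt ((lintegral_mono_set hWV).trans_lt hGnfin)
  have hψ : Measurable fun x => w x + φ' x := hmw.add hφ'.1.1
  -- two applications of the minimizing property
  have key : fineEnergy μ p w U W ≤ fineEnergy μ p (fun x => w x + φ' x) U W := by
    have k1 := fineEnergy_min_le hp0 (hu.2 W hWU) hWU.2.1.1 hmu hψ hEu hEψ hφ' hφ'0
      fun x => add_le_add_left (min_le_left _ _) _
    have k2 := fineEnergy_min_le hp0 (hv.2 W hWU) hWU.2.1.1 hmv (hmu.min hψ) hEv
      (k1.trans_lt hEψ) hφ' hφ'0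
      fun x => (min_le_right _ _).trans (add_le_add_left (min_le_right _ _) _)
    have e1 : (fun x => min (v x) (min (u x) (w x + φ' x))) = w := by
      ext x
      rw [← min_assoc, min_comm (v x), min_eq_left]
      exact le_add_of_nonneg_right (hφ'0 x)
    rw [e1] at k2
    exact k2.trans k1
  have hEw : fineEnergy μ p w U W < ⊤ := key.trans_lt hEψ
  obtain ⟨gw, hmgw, hgw, hgwi⟩ := exists_wug_of_fineEnergy_lt hp0
    (ENNReal.lt_add_right hEw.ne hη3)
  have hgwfin : ∫⁻ x in W, gw x ^ p ∂μ < ⊤ :=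
    hgwi.trans (ENNReal.add_lt_top.2 ⟨hEw, by finiteness⟩)
  obtain ⟨g₀, hm₀, hg₀, hg₀i⟩ := hφ'.1.exists_wug hp0
  rw [Measure.restrict_univ] at hg₀i
  have hL₀ : PLoc μ p g₀ univ := PLoc.of_lintegral_univ hp0 hm₀ MeasurableSet.univ hg₀i
  have hW := measurableSet_toMeasurable μ W
  have hVm := measurableSet_toMeasurable μ V
  set S : Set X := {x | 0 < φ' x} with hS
  have hSm : MeasurableSet S := measurableSet_lt measurable_const hφ'.1.1
  have hSW : S ⊆ W := fun x hx => by
    by_contra hne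
    exact (ne_of_gt hx) (hφ'.2 x hne)
  have hLgw : PLoc μ p gw (toMeasurable μ W) := PLoc.of_lintegral hp0 hmgw hW (by
    rwa [Measure.restrict_toMeasurable_of_sFinite])
  have hLGn : PLoc μ p Gn (toMeasurable μ V) := PLoc.of_lintegral hp0 hmGn hVm (by
    rwa [Measure.restrict_toMeasurable_of_sFinite])
  have hLGnW : PLoc μ p Gn (toMeasurable μ W) := PLoc.of_lintegral hp0 hmGn hW (by
    rw [Measure.restrict_toMeasurable_of_sFinite]
    exact (lintegral_mono_set hWV).trans_lt hGnfin)
  have hLS : PLoc μ p gw S := PLoc.of_lintegral hp0 hmgw hSm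
    ((lintegral_mono_set hSW).trans_lt hgwfin)
  -- compare the energies over `{φ' > 0}`
  have hm1 : Measurable ((toMeasurable μ W).piecewise (S.piecewise Gn gw) fun _ => ⊤) :=
    (hmGn.piecewise hSm hmgw).piecewise hW measurable_const
  have hw1 : WUG μ p (fun x => w x + φ' x)
      ((toMeasurable μ W).piecewise (S.piecewise Gn gw) fun _ => ⊤) U := by
    refine WUG.glue hp0 hGnw hgw (hg₀.mono_set (subset_univ U)) hmGn hmgw hm₀ hm1
      hLGnW hLgw (PLoc.of_lintegral_univ hp0 hm₀ hW hg₀i) (fun x hx => by simp [hx]) 1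
      (fun x y => ?_) ?_
    · have := abs_nonneg (w x - w y)
      have := abs_nonneg (φ' x - φ' y)
      linarith
    · intro c r hr hd hd1 hd2 hd3 hb1 hb2 hb3
      rw [piecewise_eq_of_mem _ _ _ hr]
      by_cases hcS : c r ∈ S
      · rwa [piecewise_eq_of_mem _ _ _ hcS]
      · rw [piecewise_eq_of_notMem _ _ _ hcS]
        have hz : φ' (c r) = 0 := le_antisymm (not_lt.1 hcS) (hφ'0 _)
        rwa [← deriv_eq_of_le (A := fun s => w (c s)) (B := fun s => w (c s) + φ' (c s))
          (fun s => le_add_of_nonneg_right (hφ'0 _)) (by simp [hz]) hd2 hd]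
  have h1 := fineEnergy_le hp0 hm1 hw1 W
  rw [lintegral_piecewise_toMeasurable_rpow, lintegral_piecewise_rpow hSm,
    inter_eq_right.2 hSW] at h1
  have h2 := lintegral_inter_add_sdiff (μ := μ) (fun x => gw x ^ p) W hSm
  rw [inter_eq_right.2 hSW] at h2
  have hcomp : ∫⁻ x in S, gw x ^ p ∂μ ≤ (∫⁻ x in S, Gn x ^ p ∂μ) + η / 3 := by
    have hfin : ∫⁻ x in W \ S, gw x ^ p ∂μ ≠ ⊤ :=
      ((lintegral_mono_set sdiff_subset).trans_lt hgwfin).ne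
    refine (ENNReal.add_le_add_iff_right hfin).1 ?_
    rw [h2, add_right_comm]
    exact hgwi.le.trans (by gcongr; exact key.trans h1)
  -- the competitor for `w`
  have hm2 : Measurable ((toMeasurable μ V).piecewise (S.piecewise gw Gn) fun _ => ⊤) :=
    (hmgw.piecewise hSm hmGn).piecewise hVm measurable_const
  have hw2 : WUG μ p w ((toMeasurable μ V).piecewise (S.piecewise gw Gn) fun _ => ⊤) U := by
    refine WUG.glue_pos hp0 (hg₀.mono_set (subset_univ U)) hφ'0 hm₀ hL₀ (fun x hx => hx)
      hgw hGnw hmgw hmGn hm2 hLS hLGn (fun x hx => by simp [hx])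
      (fun x hx hpos => ?_) (fun x hx hz => ?_)
    · rw [piecewise_eq_of_mem _ _ _ hx, piecewise_eq_of_mem S _ _ hpos]
    · rw [piecewise_eq_of_mem _ _ _ hx, piecewise_eq_of_notMem]
      simp [hS, hz]
  refine (fineEnergy_le hp0 hm2 hw2 V).trans ?_
  have hSV := hSW.trans hWV
  rw [lintegral_piecewise_toMeasurable_rpow, lintegral_piecewise_rpow hSm,
    inter_eq_right.2 hSV]
  have h3 := lintegral_inter_add_sdiff (μ := μ) (fun x => Gn x ^ p) V hSm
  rw [inter_eq_right.2 hSV] at h3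
  have h4 : (η / 3 + η / 3 + η / 3 : ℝ≥0∞) = η := ENNReal.add_thirds _
  calc (∫⁻ x in S, gw x ^ p ∂μ) + ∫⁻ x in V \ S, Gn x ^ p ∂μ
      ≤ ((∫⁻ x in S, Gn x ^ p ∂μ) + η / 3) + ∫⁻ x in V \ S, Gn x ^ p ∂μ := by gcongr
    _ = (∫⁻ x in V, Gn x ^ p ∂μ) + η / 3 := by rw [← h3]; ring
    _ ≤ (∫⁻ x in V, G x ^ p ∂μ) + η / 3 + η / 3 := by gcongr
    _ ≤ _ + η / 3 + η / 3 + η / 3 := by gcongr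
    _ = _ := by rw [add_assoc, add_assoc, ← add_assoc (η / 3 : ℝ≥0∞), h4]

end Assembly

section Proper

lemma DoublingMeasure.le_pow_mul {μ : Measure X} {C : ℝ≥0∞}
    (h : ∀ (x : X) (r : ℝ), 0 < r → μ (ball x (2 * r)) ≤ C * μ (ball x r)) (x : X) {r : ℝ}
    (hr : 0 < r) (n : ℕ) : μ (ball x (2 ^ n * r)) ≤ C ^ n * μ (ball x r) := by
  induction n with
  | zero => simp
  | succ n ih =>
    have := h x (2 ^ n * r) (by positivity)
    rw [pow_succ', mul_assoc]
    refine this.trans ?_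
    rw [pow_succ', mul_assoc]
    gcongr

lemma DoublingMeasure.totallyBounded_closedBall {μ : Measure X} (hd : DoublingMeasure μ) (x : X)
    (R : ℝ) : TotallyBounded (closedBall x R) := by
  obtain ⟨hball, C, hC, hdoub⟩ := hd
  rw [Metric.totallyBounded_iff]
  by_contra! hcon
  obtain ⟨ε, hε, hcov⟩ := hcon
  obtain ⟨y, hyR, hysep⟩ : ∃ f : ℕ → X, (∀ n, f n ∈ closedBall x R) ∧
      Pairwise (Function.onFun (fun a b => ε ≤ dist a b) f) := by
    have : Std.Symm (fun a b : X => ε ≤ dist a b) := ⟨fun a b h => by rwa [dist_comm]⟩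
    refine exists_seq_of_forall_finset_exists' (· ∈ closedBall x R)
      (fun a b => ε ≤ dist a b) fun s _ => ?_
    obtain ⟨z, hz, hz'⟩ := Set.not_subset.1 (hcov s s.finite_toSet)
    refine ⟨z, hz, fun w hw => ?_⟩
    simp only [mem_iUnion, not_exists, mem_ball, not_lt] at hz'
    rw [dist_comm]
    exact hz' w hw
  have hR : 0 ≤ R := dist_nonneg.trans (hyR 0)
  obtain ⟨n, hn⟩ := pow_unbounded_of_one_lt ((2 * R + 1) / (ε / 2)) one_lt_two
  have hn' : 2 * R + 1 < 2 ^ n * (ε / 2) := by rwa [div_lt_iff₀ (by positivity)] at hn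
  set c := μ (ball x 1) / C ^ n with hc
  have hcpos : 0 < c := ENNReal.div_pos (hball x 1 one_pos).1.ne' (by finiteness)
  have hlow : ∀ k, c ≤ μ (ball (y k) (ε / 2)) := fun k => by
    refine ENNReal.div_le_of_le_mul' ?_
    refine le_trans (measure_mono ?_)
      (DoublingMeasure.le_pow_mul hdoub (y k) (half_pos hε) n)
    refine ball_subset_ball' ?_
    have : dist x (y k) ≤ R := by rw [dist_comm]; exact hyR k
    linarith
  have hfin := Measure.finite_const_le_meas_of_disjoint_iUnion μ hcpos
    (As := fun k => ball (y k) (ε / 2)) (fun k => measurableSet_ball)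
    (fun i j hij => ball_disjoint_ball (by linarith [hysep hij])) (by
      refine ((measure_mono (iUnion_subset fun k => ?_)).trans_lt
        (hball x (R + ε) (by linarith)).2).ne
      refine ball_subset_ball' ?_
      have : dist (y k) x ≤ R := hyR k
      linarith)
  simp only [hlow, Set.ofPred_true] at hfin
  exact Set.infinite_univ hfin

lemma DoublingMeasure.properSpace [CompleteSpace X] {μ : Measure X} (hd : DoublingMeasure μ) :
    ProperSpace X :=
  ⟨fun x R => isCompact_iff_totallyBounded_isComplete.2
    ⟨hd.totallyBounded_closedBall x R, isClosed_closedBall.isComplete⟩⟩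

lemma DoublingMeasure.isLocallyFiniteMeasure {μ : Measure X} (hd : DoublingMeasure μ) :
    IsLocallyFiniteMeasure μ :=
  ⟨fun x => ⟨ball x 1, ball_mem_nhds x one_pos, (hd.1 x 1 one_pos).2⟩⟩

end Proper

/-- Lusin's theorem for real functions and finite measures. -/
lemma exists_isClosed_continuousOn {ν : Measure X} [IsFiniteMeasure ν] {f : X → ℝ}
    (hf : Measurable f) {ε : ℝ≥0∞} (hε : ε ≠ 0) :
    ∃ K : Set X, IsClosed K ∧ ContinuousOn f K ∧ ν Kᶜ ≤ ε := by
  obtain ⟨δ, hδ, hδsum⟩ := ENNReal.exists_pos_sum_of_countable' hε ℕ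
  obtain ⟨b, hbc, -, hb⟩ := TopologicalSpace.exists_countable_basis ℝ
  have hbne : b.Nonempty := by
    by_contra hne
    rw [not_nonempty_iff_eq_empty] at hne
    have := hb.sUnion_eq
    rw [hne, sUnion_empty] at this
    exact empty_ne_univ this
  obtain ⟨V, hV⟩ := hbc.exists_eq_range hbne
  have hVo : ∀ n, IsOpen (V n) := fun n => hb.isOpen (hV ▸ mem_range_self n)
  have hm : ∀ n, MeasurableSet (f ⁻¹' V n) := fun n => hf (hVo n).measurableSet
  have h1 : ∀ n, ∃ F ⊆ f ⁻¹' V n, IsClosed F ∧ ν (f ⁻¹' V n \ F) < δ n / 2 := fun n =>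
    (hm n).exists_isClosed_sdiff_lt (measure_ne_top _ _) (by simpa using (hδ n).ne')
  have h2 : ∀ n, ∃ F ⊆ (f ⁻¹' V n)ᶜ, IsClosed F ∧ ν ((f ⁻¹' V n)ᶜ \ F) < δ n / 2 := fun n =>
    (hm n).compl.exists_isClosed_sdiff_lt (measure_ne_top _ _) (by simpa using (hδ n).ne')
  choose F hF hFc hFm using h1
  choose F' hF' hFc' hFm' using h2
  refine ⟨⋂ n, F n ∪ F' n, isClosed_iInter fun n => (hFc n).union (hFc' n), ?_, ?_⟩
  · rw [continuousOn_iff_continuous_domRestrict, hb.continuous_iff]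
    intro s hs
    rw [hV] at hs
    obtain ⟨n, rfl⟩ := hs
    have e : (Set.domRestrict (⋂ n, F n ∪ F' n) f) ⁻¹' V n = Subtype.val ⁻¹' (F' n)ᶜ := by
      ext ⟨x, hx⟩
      have hx' := mem_iInter.1 hx n
      simp only [mem_preimage, domRestrict_apply, mem_compl_iff]
      exact ⟨fun h h' => hF' n h' h, fun h => hF n (hx'.resolve_right h)⟩
    rw [e]
    exact (hFc' n).isOpen_compl.preimage continuous_subtype_val
  · rw [compl_iInter]
    refine (measure_iUnion_le _).trans (le_trans (ENNReal.tsum_le_tsum fun n => ?_) hδsum.le)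
    calc ν (F n ∪ F' n)ᶜ ≤ ν ((f ⁻¹' V n \ F n) ∪ ((f ⁻¹' V n)ᶜ \ F' n)) := by
          refine measure_mono fun x hx => ?_
          rw [mem_compl_iff, mem_union, not_or] at hx
          by_cases h : x ∈ f ⁻¹' V n
          · exact Or.inl ⟨h, hx.1⟩
          · exact Or.inr ⟨h, hx.2⟩
      _ ≤ δ n / 2 + δ n / 2 := (measure_union_le _ _).trans (add_le_add (hFm n).le (hFm' n).le)
      _ = δ n := ENNReal.add_halves _

/-- Sequences of `1`-Lipschitz paths with convergent starting points subconverge pointwise. -/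
lemma exists_subseq_lipschitzWith_tendsto [ProperSpace X] {σ : ℕ → ℝ → X}
    (hσ : ∀ n, LipschitzWith 1 (σ n)) {x : X} {R : ℝ} (hb : ∀ n, σ n 0 ∈ closedBall x R) :
    ∃ (τ : ℝ → X) (k : ℕ → ℕ), LipschitzWith 1 τ ∧ StrictMono k ∧
      ∀ t, Tendsto (fun n => σ (k n) t) atTop (nhds (τ t)) := by
  have hcpt : IsCompact (Set.pi univ fun q : ℚ => closedBall x (R + |(q : ℝ)|)) :=
    isCompact_univ_pi fun q => isCompact_closedBall _ _
  have hmem : ∀ n, (fun q : ℚ => σ n q) ∈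
      Set.pi univ fun q : ℚ => closedBall x (R + |(q : ℝ)|) := by
    intro n q _
    have h1 := (hσ n).dist_le_mul q 0
    have h2 : dist (σ n 0) x ≤ R := hb n
    rw [NNReal.coe_one, one_mul, Real.dist_0_eq_abs] at h1
    rw [mem_closedBall]
    linarith [dist_triangle (σ n q) (σ n 0) x]
  obtain ⟨τ₀, -, k, hk, hlim⟩ := hcpt.isSeqCompact hmem
  rw [tendsto_pi_nhds] at hlim
  have hcau : ∀ t : ℝ, CauchySeq fun n => σ (k n) t := by
    intro t
    rw [Metric.cauchySeq_iff]
    intro ε hε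
    obtain ⟨q, hq⟩ := exists_rat_near t (show 0 < ε / 4 by positivity)
    obtain ⟨N, hN⟩ := Metric.cauchySeq_iff.1 (hlim q).cauchySeq (ε / 4) (by positivity)
    refine ⟨N, fun m hm n hn => ?_⟩
    have h1 := hN m hm n hn
    have h2 := (hσ (k m)).dist_le_mul t q
    have h3 := (hσ (k n)).dist_le_mul q t
    rw [NNReal.coe_one, one_mul, Real.dist_eq] at h2
    rw [NNReal.coe_one, one_mul, Real.dist_eq, abs_sub_comm] at h3
    simp only [Function.comp] at h1
    linarith [dist_triangle4 (σ (k m) t) (σ (k m) q) (σ (k n) q) (σ (k n) t)]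
  choose τ hτ using fun t => cauchySeq_tendsto_of_complete (hcau t)
  refine ⟨τ, k, LipschitzWith.of_dist_le_mul fun s t => ?_, hk, hτ⟩
  exact le_of_tendsto ((hτ s).dist (hτ t))
    (Eventually.of_forall fun n => (hσ (k n)).dist_le_mul s t)

/-- Concatenation of two `1`-Lipschitz paths. -/
lemma lipschitzWith_concat {σ τ : ℝ → X} (hσ : LipschitzWith 1 σ) (hτ : LipschitzWith 1 τ) {L : ℝ}
    (h : σ L = τ L) : LipschitzWith 1 fun r => if r ≤ L then σ r else τ r := by
  have key : ∀ a b : ℝ, a ≤ b → dist (if a ≤ L then σ a else τ a) (if b ≤ L then σ b else τ b) ≤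
      b - a := by
    intro a b hab
    have h1 : ∀ s t : ℝ, s ≤ t → dist (σ s) (σ t) ≤ t - s := fun s t hst => by
      have := hσ.dist_le_mul s t
      rwa [NNReal.coe_one, one_mul, Real.dist_eq, abs_sub_comm, abs_of_nonneg (by linarith)] at this
    have h2 : ∀ s t : ℝ, s ≤ t → dist (τ s) (τ t) ≤ t - s := fun s t hst => by
      have := hτ.dist_le_mul s t
      rwa [NNReal.coe_one, one_mul, Real.dist_eq, abs_sub_comm, abs_of_nonneg (by linarith)] at this
    by_cases hb : b ≤ L
    · simp only [hb, hab.trans hb, if_true]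
      exact h1 a b hab
    · by_cases ha : a ≤ L
      · simp only [hb, ha, if_true, if_false]
        have h3 := h1 a L ha
        have h4 := h2 L b (not_le.1 hb).le
        rw [h] at h3
        linarith [dist_triangle (σ a) (τ L) (τ b)]
      · simp only [hb, ha, if_false]
        exact h2 a b hab
  refine LipschitzWith.of_dist_le_mul fun a b => ?_
  rw [NNReal.coe_one, one_mul, Real.dist_eq]
  rcases le_total a b with hab | hab
  · rw [abs_sub_comm, abs_of_nonneg (by linarith)]
    exact key a b hab
  · rw [abs_of_nonneg (by linarith), dist_comm]
    exact key b a hab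

/-- The least cost of reaching `x` from `S`, starting at cost `f` and paying `g` along a path. -/
def pathCost (S : Set X) (f : X → ℝ) (g : X → ℝ≥0∞) (x : X) : ℝ≥0∞ :=
  ⨅ (σ : ℝ → X) (_ : LipschitzWith 1 σ) (L : ℝ) (_ : 0 ≤ L) (_ : σ 0 ∈ S) (_ : σ L = x),
    ENNReal.ofReal (f (σ 0)) + ∫⁻ r in Icc 0 L, g (σ r)

section PathCost

variable {S : Set X} {f : X → ℝ} {g : X → ℝ≥0∞}

lemma pathCost_le_of_path {σ : ℝ → X} (hσ : LipschitzWith 1 σ) {L : ℝ} (hL : 0 ≤ L)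
    (h0 : σ 0 ∈ S) :
    pathCost S f g (σ L) ≤ ENNReal.ofReal (f (σ 0)) + ∫⁻ r in Icc 0 L, g (σ r) :=
  iInf₂_le_of_le σ hσ (iInf₂_le_of_le L hL (iInf₂_le_of_le h0 rfl le_rfl))

lemma pathCost_le_self {x : X} (hx : x ∈ S) : pathCost S f g x ≤ ENNReal.ofReal (f x) := by
  have := pathCost_le_of_path (S := S) (f := f) (g := g) (σ := fun _ => x)
    (LipschitzWith.const' x) (le_refl 0) hx
  simpa using this

lemma exists_path_of_pathCost_lt {x : X} {c : ℝ≥0∞} (h : pathCost S f g x < c) :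
    ∃ (σ : ℝ → X) (L : ℝ), LipschitzWith 1 σ ∧ 0 ≤ L ∧ σ 0 ∈ S ∧ σ L = x ∧
      ENNReal.ofReal (f (σ 0)) + ∫⁻ r in Icc 0 L, g (σ r) < c := by
  simp only [pathCost, iInf_lt_iff] at h
  obtain ⟨σ, h1, L, h2, h3, h4, h5⟩ := h
  exact ⟨σ, L, h1, h2, h3, h4, h5⟩

lemma pathCost_le_add {τ : ℝ → X} (hτ : LipschitzWith 1 τ) {s t : ℝ} (hst : s ≤ t) :
    pathCost S f g (τ t) ≤ pathCost S f g (τ s) + ∫⁻ r in Icc s t, g (τ r) := by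
  refine ENNReal.le_of_forall_pos_le_add fun ε hε hfin => ?_
  have hne : pathCost S f g (τ s) ≠ ⊤ := (ENNReal.add_lt_top.1 hfin).1.ne
  obtain ⟨σ, L, h1, h2, h3, h4, h5⟩ := exists_path_of_pathCost_lt
    (ENNReal.lt_add_right hne (ENNReal.coe_pos.2 hε).ne')
  have hτ' : LipschitzWith 1 fun r => τ (s + (r - L)) := by
    refine LipschitzWith.of_dist_le_mul fun a b => ?_
    have := hτ.dist_le_mul (s + (a - L)) (s + (b - L))
    simpa using this
  have hc := lipschitzWith_concat (L := L) h1 hτ' (by simpa using h4)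
  set κ : ℝ → X := fun r => if r ≤ L then σ r else τ (s + (r - L)) with hκ
  have hκ0 : κ 0 = σ 0 := by simp [hκ, h2]
  have hκt : κ (L + (t - s)) = τ t := by
    by_cases hs : s = t
    · subst hs
      simp [hκ, h4]
    · have : ¬ L + (t - s) ≤ L := by
        have := lt_of_le_of_ne hst hs
        linarith
      simp only [hκ, this, if_false]
      congr 1; ring
  have hle := pathCost_le_of_path (S := S) (f := f) (g := g) hc (L := L + (t - s)) (by linarith)
    (by rw [hκ0]; exact h3)
  rw [hκt, hκ0] at hle
  have hsplit : ∫⁻ r in Icc 0 (L + (t - s)), g (κ r) ≤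
      (∫⁻ r in Icc 0 L, g (σ r)) + ∫⁻ r in Icc s t, g (τ r) := by
    have hsub : Icc 0 (L + (t - s)) ⊆ Icc 0 L ∪ Ioc L (L + (t - s)) := fun r hr => by
      by_cases hrL : r ≤ L
      · exact Or.inl ⟨hr.1, hrL⟩
      · exact Or.inr ⟨not_le.1 hrL, hr.2⟩
    refine (lintegral_mono_set hsub).trans ((lintegral_union_le _ _ _).trans (add_le_add ?_ ?_))
    · refine (setLIntegral_congr_fun measurableSet_Icc fun r hr => ?_).le
      simp [hκ, hr.2]
    · have e1 : ∫⁻ r in Ioc L (L + (t - s)), g (κ r) =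
          ∫⁻ r in Ioc L (L + (t - s)), g (τ (r + (s - L))) := by
        refine setLIntegral_congr_fun measurableSet_Ioc fun r hr => ?_
        have : ¬ r ≤ L := not_le.2 hr.1
        simp only [hκ, this, if_false]
        congr 2; ring
      rw [e1]
      have e2 := (measurePreserving_add_right volume (s - L)).setLIntegral_comp_emb
        (measurableEmbedding_addRight (s - L)) (fun r => g (τ r)) (Ioc L (L + (t - s)))
      rw [image_add_const_Ioc] at e2
      rw [e2]
      refine lintegral_mono_set ?_
      rw [show L + (s - L) = s by ring, show L + (t - s) + (s - L) = t by ring]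
      exact Ioc_subset_Icc_self
  calc pathCost S f g (τ t) ≤ _ := hle
    _ ≤ ENNReal.ofReal (f (σ 0)) + ((∫⁻ r in Icc 0 L, g (σ r)) + ∫⁻ r in Icc s t, g (τ r)) := by
        gcongr
    _ = (ENNReal.ofReal (f (σ 0)) + ∫⁻ r in Icc 0 L, g (σ r)) + ∫⁻ r in Icc s t, g (τ r) := by
        rw [add_assoc]
    _ ≤ (pathCost S f g (τ s) + ε) + ∫⁻ r in Icc s t, g (τ r) := by gcongr
    _ = _ := by rw [add_right_comm]

lemma pathCost_le_add' {τ : ℝ → X} (hτ : LipschitzWith 1 τ) {s t : ℝ} (hst : s ≤ t) :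
    pathCost S f g (τ s) ≤ pathCost S f g (τ t) + ∫⁻ r in Icc s t, g (τ r) := by
  have hτ' : LipschitzWith 1 fun r => τ (-r) := by
    refine LipschitzWith.of_dist_le_mul fun a b => ?_
    have := hτ.dist_le_mul (-a) (-b)
    rwa [dist_neg_neg] at this
  have h := pathCost_le_add (S := S) (f := f) (g := g) hτ' (neg_le_neg hst)
  simp only [neg_neg] at h
  refine h.trans_eq ?_
  congr 1
  have e2 := (Measure.measurePreserving_neg (volume : Measure ℝ)).setLIntegral_comp_emb
    (MeasurableEquiv.neg ℝ).measurableEmbedding (fun r => g (τ r)) (Icc (-t) (-s))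
  have e3 : Neg.neg '' Icc (-t) (-s) = Icc s t := by simp
  rw [e3] at e2
  exact e2

/-- Sublevel sets below `1` of the path cost are sequentially closed. -/
lemma pathCost_le_of_tendsto [ProperSpace X] (hS : IsClosed S) (hf : ContinuousOn f S)
    (hg : LowerSemicontinuous g) (hg1 : ∀ x, 1 ≤ g x) {c : ℝ≥0∞} (hc : c ≤ 1) {x : X} {y : ℕ → X}
    (hy : Tendsto y atTop (nhds x)) (h : ∀ n, pathCost S f g (y n) < c) :
    pathCost S f g x ≤ c := by
  choose σ L h1 h2 h3 h4 h5 using fun n => exists_path_of_pathCost_lt (h n)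
  have hL1 : ∀ n, L n ≤ 1 := fun n => by
    have h6 : ENNReal.ofReal (L n) ≤ ∫⁻ r in Icc 0 (L n), g (σ n r) := by
      calc ENNReal.ofReal (L n) = ∫⁻ r in Icc 0 (L n), 1 := by simp
        _ ≤ _ := lintegral_mono fun r => hg1 _
    have h7 : ENNReal.ofReal (L n) ≤ 1 := h6.trans (le_add_self.trans ((h5 n).le.trans hc))
    simpa using h7
  obtain ⟨R, hR⟩ := (Metric.isBounded_range_of_tendsto y hy).subset_closedBall x
  have hb : ∀ n, σ n 0 ∈ closedBall x (R + 1) := fun n => by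
    have h6 : dist (y n) x ≤ R := hR (mem_range_self n)
    have h7 := (h1 n).dist_le_mul 0 (L n)
    rw [NNReal.coe_one, one_mul, h4, dist_comm (0 : ℝ), Real.dist_0_eq_abs,
      abs_of_nonneg (h2 n)] at h7
    rw [mem_closedBall]
    linarith [dist_triangle (σ n 0) (y n) x, hL1 n]
  obtain ⟨τ, k, hτ, hk, hlim⟩ := exists_subseq_lipschitzWith_tendsto h1 hb
  obtain ⟨l, hl, m, hm, hlm⟩ := (isCompact_Icc (a := (0:ℝ)) (b := 1)).isSeqCompact
    (x := fun n => L (k n)) fun n => ⟨h2 _, hL1 _⟩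
  have hkm : StrictMono fun n => k (m n) := hk.comp hm
  have hlim' : ∀ t, Tendsto (fun n => σ (k (m n)) t) atTop (nhds (τ t)) :=
    fun t => (hlim t).comp hm.tendsto_atTop
  have hlm' : Tendsto (fun n => L (k (m n))) atTop (nhds l) := hlm
  have hτ0 : τ 0 ∈ S := hS.mem_of_tendsto (hlim' 0) (Eventually.of_forall fun n => h3 _)
  have hτl : τ l = x := by
    have t1 : Tendsto (fun n => σ (k (m n)) (L (k (m n)))) atTop (nhds x) := by
      simp only [h4]
      exact hy.comp hkm.tendsto_atTop
    have t2 : Tendsto (fun n => σ (k (m n)) (L (k (m n)))) atTop (nhds (τ l)) := by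
      rw [tendsto_iff_dist_tendsto_zero]
      have t3 : Tendsto (fun n => |L (k (m n)) - l| + dist (σ (k (m n)) l) (τ l)) atTop
          (nhds 0) := by
        have := ((hlm'.sub_const l).abs).add ((tendsto_iff_dist_tendsto_zero).1 (hlim' l))
        simpa using this
      refine squeeze_zero (fun _ => dist_nonneg) (fun n => ?_) t3
      have := (h1 (k (m n))).dist_le_mul (L (k (m n))) l
      rw [NNReal.coe_one, one_mul, Real.dist_eq] at this
      linarith [dist_triangle (σ (k (m n)) (L (k (m n)))) (σ (k (m n)) l) (τ l)]
    exact tendsto_nhds_unique t2 t1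
  have ha : Tendsto (fun n => ENNReal.ofReal (f (σ (k (m n)) 0))) atTop
      (nhds (ENNReal.ofReal (f (τ 0)))) := by
    refine (ENNReal.continuous_ofReal.tendsto _).comp ?_
    exact (hf (τ 0) hτ0).tendsto.comp (tendsto_nhdsWithin_iff.2
      ⟨hlim' 0, Eventually.of_forall fun n => h3 _⟩)
  have hale : ENNReal.ofReal (f (τ 0)) ≤ c :=
    le_of_tendsto ha (Eventually.of_forall fun n => le_self_add.trans (h5 _).le)
  have hfatou : ∫⁻ r in Icc 0 l, g (τ r) ≤ c - ENNReal.ofReal (f (τ 0)) := by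
    rw [← setLIntegral_congr (μ := volume) Ioo_ae_eq_Icc, ← lintegral_indicator measurableSet_Ioo]
    calc ∫⁻ r, (Ioo 0 l).indicator (fun r => g (τ r)) r
        ≤ ∫⁻ r, liminf (fun n => (Icc 0 (L (k (m n)))).indicator
            (fun r => g (σ (k (m n)) r)) r) atTop := by
          refine lintegral_mono fun r => ?_
          by_cases hr : r ∈ Ioo 0 l
          · rw [indicator_of_mem hr]
            refine le_of_forall_lt fun b hb => ?_
            obtain ⟨b', hb', hb''⟩ := exists_between hb
            refine hb'.trans_le (le_liminf_of_le (by isBoundedDefault) ?_)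
            filter_upwards [(hlim' r).eventually (hg (τ r) b' hb''),
              hlm'.eventually (lt_mem_nhds hr.2)] with n hn hn'
            rw [indicator_of_mem (show r ∈ Icc 0 (L (k (m n))) from ⟨hr.1.le, hn'.le⟩)]
            exact hn.le
          · rw [indicator_of_notMem hr]
            exact zero_le
      _ ≤ liminf (fun n => ∫⁻ r, (Icc 0 (L (k (m n)))).indicator
            (fun r => g (σ (k (m n)) r)) r) atTop :=
          lintegral_liminf_le fun n => (hg.measurable.comp (h1 _).continuous.measurable).indicator
            measurableSet_Icc
      _ ≤ liminf (fun n => c - ENNReal.ofReal (f (σ (k (m n)) 0))) atTop := by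
          refine liminf_le_liminf (Eventually.of_forall fun n => ?_)
          rw [lintegral_indicator measurableSet_Icc]
          refine ENNReal.le_sub_of_add_le_left ENNReal.ofReal_ne_top (h5 _).le
      _ = c - ENNReal.ofReal (f (τ 0)) := by
          refine Tendsto.liminf_eq ?_
          exact ENNReal.Tendsto.sub tendsto_const_nhds ha (Or.inr ENNReal.ofReal_ne_top)
  calc pathCost S f g x = pathCost S f g (τ l) := by rw [hτl]
    _ ≤ _ := pathCost_le_of_path hτ hl.1 hτ0
    _ ≤ ENNReal.ofReal (f (τ 0)) + (c - ENNReal.ofReal (f (τ 0))) := by gcongr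
    _ = c := add_tsub_cancel_of_le hale

lemma lowerSemicontinuous_min_pathCost [ProperSpace X] (hS : IsClosed S) (hf : ContinuousOn f S)
    (hg : LowerSemicontinuous g) (hg1 : ∀ x, 1 ≤ g x) :
    LowerSemicontinuous fun x => (min 1 (pathCost S f g x)).toReal := by
  intro x c hcx
  by_contra hcon
  rw [Filter.not_eventually] at hcon
  obtain ⟨y, hy, hyc⟩ := exists_seq_forall_of_frequently hcon
  have hfin : ∀ z, min 1 (pathCost S f g z) ≠ ⊤ := fun z =>
    ne_top_of_le_ne_top one_ne_top (min_le_left _ _)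
  obtain ⟨c', hc1, hc2⟩ := exists_between hcx
  have hc0 : 0 ≤ c := ENNReal.toReal_nonneg.trans (not_lt.1 (hyc 0))
  have hc2' : ENNReal.ofReal c' < min 1 (pathCost S f g x) :=
    (ENNReal.ofReal_lt_iff_lt_toReal (hc0.trans hc1.le) (hfin x)).2 hc2
  refine absurd (pathCost_le_of_tendsto hS hf hg hg1 (c := ENNReal.ofReal c')
    (hc2'.le.trans (min_le_left _ _)) hy fun n => ?_) (not_le.2 (hc2'.trans_le (min_le_right _ _)))
  have h1 : min 1 (pathCost S f g (y n)) < ENNReal.ofReal c' :=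
    (ENNReal.lt_ofReal_iff_toReal_lt (hfin _)).2 ((not_lt.1 (hyc n)).trans_lt hc1)
  rcases min_lt_iff.1 h1 with h2 | h2
  · exact absurd (h2.trans hc2') (not_lt.2 (min_le_left _ _))
  · exact h2

end PathCost

/-- A weak upper gradient is dominated by a function bounding increments along every curve. -/
lemma WUG.exists_forall_incrBound {μ : Measure X} {p : ℝ} (hp : 0 < p) {f : X → ℝ}
    {g : X → ℝ≥0∞} (h : WUG μ p f g univ) (hg : Measurable g) (hgfin : ∫⁻ x, g x ^ p ∂μ < ⊤) :
    ∃ g₁ : X → ℝ≥0∞, Measurable g₁ ∧ ∫⁻ x, g₁ x ^ p ∂μ < ⊤ ∧ (∀ x, g x ≤ g₁ x) ∧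
      ∀ γ : Curve X, ENNReal.ofReal |f (γ.path 0) - f (γ.path γ.len)| ≤ curveLint γ g₁ := by
  obtain ⟨ρ, hρ, hρfin, hρ'⟩ := h
  refine ⟨fun x => g x + ρ x, hg.add hρ, lintegral_rpow_add_lt_top' hp hg hgfin hρfin,
    fun x => le_self_add, fun γ => ?_⟩
  by_cases hγ : curveLint γ ρ < ⊤
  · refine (hρ' γ hγ (fun _ _ => mem_univ _) 0 γ.len le_rfl γ.len_pos.le le_rfl).trans ?_
    rw [← curveLint_eq_path]
    exact curveLint_mono fun x => le_self_add
  · rw [not_lt, top_le_iff] at hγ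
    refine le_top.trans (hγ.symm.le.trans (curveLint_mono fun x => le_add_self))

/-- Approximation from above by lower semicontinuous functions, fixed on a closed set off which
the original function is allowed to vary. -/
lemma exists_lowerSemicontinuous_ge [ProperSpace X] {μ : Measure X} [IsLocallyFiniteMeasure μ]
    {p : ℝ} (hp : 1 < p) {f : X → ℝ} (hf : Measurable f) (hf0 : ∀ x, 0 ≤ f x) (hf1 : ∀ x, f x ≤ 1)
    {g : X → ℝ≥0∞} (h : WUG μ p f g univ) (hg : Measurable g) (hgfin : ∫⁻ x, g x ^ p ∂μ < ⊤)
    {Z : Set X} (hZ : IsClosed Z) {a : ℝ} (hfZ : ∀ x ∈ Z, f x = a) (hZb : μ Zᶜ < ⊤)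
    {ε : ℝ≥0∞} (hε : ε ≠ 0) :
    ∃ F : X → ℝ, LowerSemicontinuous F ∧ (∀ x, f x ≤ F x) ∧ (∀ x, F x ≤ 1) ∧
      (∀ x ∈ Z, F x = f x) ∧ μ {x | f x ≠ F x} ≤ ε ∧
      ∃ e : X → ℝ≥0∞, Measurable e ∧ WUG μ p (fun x => F x - f x) e univ ∧
        ∫⁻ x, e x ^ p ∂μ ≤ ε := by
  have hp0 : 0 < p := by linarith
  obtain ⟨g₁, hg₁, hg₁fin, -, hinc⟩ := h.exists_forall_incrBound hp0 hg hgfin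
  obtain ⟨G, hgG, hG, hGint⟩ := exists_le_lowerSemicontinuous_lintegral_ge μ
    (fun x => g₁ x ^ p) (hg₁.pow_const p) one_ne_zero
  have hGfin : ∫⁻ x, G x ∂μ < ⊤ := hGint.trans_lt (by finiteness)
  set g' : X → ℝ≥0∞ := fun x => G x ^ (1 / p) + 1 with hg'
  have hg'lsc : LowerSemicontinuous g' := by
    refine Continuous.comp_lowerSemicontinuous (g := fun t : ℝ≥0∞ => t ^ (1 / p) + 1)
      (ENNReal.continuous_rpow_const.add continuous_const) hG fun s t hst => ?_
    dsimp only
    gcongr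
  have hg'm := hg'lsc.measurable
  have hg'1 : ∀ x, 1 ≤ g' x := fun x => le_add_self
  have hg₁g' : ∀ x, g₁ x ≤ g' x := fun x => by
    refine le_trans ?_ le_self_add
    rw [← ENNReal.rpow_le_rpow_iff hp0, ← ENNReal.rpow_mul, one_div_mul_cancel hp0.ne',
      ENNReal.rpow_one]
    exact hgG x
  set ν := μ.restrict Zᶜ with hν
  have : IsFiniteMeasure ν := ⟨by simpa [hν] using hZb⟩
  have hEm : Measurable fun x => (g' x + g' x) ^ p := (hg'm.add hg'm).pow_const p
  have hEfin : ∫⁻ x, (g' x + g' x) ^ p ∂ν < ⊤ := by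
    have h1 : ∫⁻ x, (G x ^ (1 / p)) ^ p ∂ν < ⊤ := by
      simp_rw [← ENNReal.rpow_mul, one_div_mul_cancel hp0.ne', ENNReal.rpow_one]
      exact (setLIntegral_le_lintegral _ _).trans_lt hGfin
    have h2 : ∫⁻ _, (1 : ℝ≥0∞) ^ p ∂ν < ⊤ := by
      simp only [ENNReal.one_rpow, lintegral_const, one_mul]
      exact measure_lt_top _ _
    have h3 : ∫⁻ x, g' x ^ p ∂ν < ⊤ := lintegral_rpow_add_lt_top' hp0
      (hG.measurable.pow_const _) h1 h2
    exact lintegral_rpow_add_lt_top' hp0 hg'm h3 h3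
  obtain ⟨δ, hδ, hδtop, hδε⟩ : ∃ δ : ℝ≥0∞, 0 < δ ∧ δ ≠ ⊤ ∧
      ∀ s, ν s < δ → ∫⁻ x in s, (g' x + g' x) ^ p ∂ν < ε := by
    obtain ⟨δ, hδ, hδε⟩ := exists_pos_setLIntegral_lt_of_measure_lt hEfin.ne hε
    exact ⟨min δ 1, lt_min hδ one_pos, ne_top_of_le_ne_top one_ne_top (min_le_right _ _),
      fun s hs => hδε s (hs.trans_le (min_le_left _ _))⟩
  have hη : min ε (δ / 2) ≠ 0 := (lt_min (pos_iff_ne_zero.2 hε) (ENNReal.half_pos hδ.ne')).ne'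
  obtain ⟨K, hK, hfK, hKν⟩ := exists_isClosed_continuousOn (ν := ν) hf hη
  have hSc : IsClosed (K ∪ Z) := hK.union hZ
  have hfS : ContinuousOn f (K ∪ Z) := hfK.union_of_isClosed
    (continuousOn_const.congr hfZ) hK hZ
  have hWZ : (K ∪ Z)ᶜ ⊆ Zᶜ := compl_subset_compl.2 subset_union_right
  have hWm : MeasurableSet (K ∪ Z)ᶜ := hSc.measurableSet.compl
  have hWμ : μ (K ∪ Z)ᶜ ≤ min ε (δ / 2) := by
    rw [← inter_eq_left.2 hWZ, ← Measure.restrict_apply hWm]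
    exact (measure_mono (compl_subset_compl.2 subset_union_left)).trans hKν
  set C := pathCost (K ∪ Z) f g' with hC
  set F : X → ℝ := fun x => (min 1 (C x)).toReal with hF
  have hfin : ∀ x, min 1 (C x) ≠ ⊤ := fun z => ne_top_of_le_ne_top one_ne_top (min_le_left _ _)
  have hFlsc : LowerSemicontinuous F := lowerSemicontinuous_min_pathCost hSc hfS hg'lsc hg'1
  have hfC : ∀ x, ENNReal.ofReal (f x) ≤ C x := by
    intro x
    refine le_iInf₂ fun σ hσ => le_iInf₂ fun L hL => le_iInf₂ fun h0 hx => ?_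
    rcases hL.eq_or_lt with rfl | hL
    · rw [hx]
      exact le_self_add
    let γ : Curve X := ⟨L, hL, σ, hσ.lipschitzOnWith⟩
    have h1 := (hinc γ).trans (curveLint_mono hg₁g')
    rw [γ.path_eq ⟨le_rfl, hL.le⟩, γ.path_eq ⟨hL.le, le_rfl⟩] at h1
    have h2 : ENNReal.ofReal |f (σ 0) - f x| ≤ ∫⁻ r in Icc 0 L, g' (σ r) := by
      rw [← hx]
      exact h1
    refine le_trans ?_ (add_le_add_right h2 _)
    rw [← ENNReal.ofReal_add (hf0 _) (abs_nonneg _)]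
    exact ENNReal.ofReal_le_ofReal (by linarith [neg_abs_le (f (σ 0) - f x)])
  have hfF : ∀ x, f x ≤ F x := fun x => by
    rw [hF, ← ENNReal.ofReal_le_iff_le_toReal (hfin x)]
    exact le_min (by simpa using hf1 x) (hfC x)
  have hFS : ∀ x ∈ K ∪ Z, F x = f x := fun x hx => by
    refine le_antisymm ?_ (hfF x)
    refine ENNReal.toReal_le_of_le_ofReal (hf0 x) ((min_le_right _ _).trans (pathCost_le_self hx))
  have hFinc : ∀ γ : Curve X, IncrBound (fun t => F (γ.path t)) (fun t => g' (γ.path t))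
      0 γ.len := by
    intro γ s t h1 h2 h3
    by_cases htop : ∫⁻ r in Icc s t, g' (γ.path r) = ⊤
    · exact le_top.trans_eq htop.symm
    rw [ENNReal.ofReal_le_iff_le_toReal htop, abs_le]
    have a1 := pathCost_le_add (S := K ∪ Z) (f := f) (g := g') γ.lipschitzWith_path h2
    have a2 := pathCost_le_add' (S := K ∪ Z) (f := f) (g := g') γ.lipschitzWith_path h2
    have key : ∀ A B I : ℝ≥0∞, I ≠ ⊤ → A ≤ B + I →
        (min 1 A).toReal ≤ (min 1 B).toReal + I.toReal := by
      intro A B I hI hAB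
      have hB : min 1 B ≠ ⊤ := ne_top_of_le_ne_top one_ne_top (min_le_left _ _)
      rw [← ENNReal.toReal_add hB hI]
      refine ENNReal.toReal_mono (ENNReal.add_ne_top.2 ⟨hB, hI⟩) ?_
      rw [min_add]
      exact le_min ((min_le_left _ _).trans le_self_add) ((min_le_right _ _).trans hAB)
    have b1 := key _ _ _ htop a1
    have b2 := key _ _ _ htop a2
    simp only [hF, hC]
    constructor <;> linarith
  have hinc' : ∀ γ : Curve X, IncrBound (fun t => f (γ.path t)) (fun t => g' (γ.path t))
      0 γ.len := by
    intro γ s t h1 h2 h3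
    rcases h2.eq_or_lt with rfl | h2
    · simp
    have := (hinc (γ.sub s t h1 h2 h3)).trans (curveLint_mono hg₁g')
    rw [curveLint_sub] at this
    refine le_trans (le_of_eq ?_) this
    beta_reduce
    have hlen : (γ.sub s t h1 h2 h3).len = t - s := rfl
    rw [Curve.path_eq _ ⟨le_rfl, (Curve.len_pos _).le⟩,
      Curve.path_eq _ ⟨(Curve.len_pos _).le, le_rfl⟩,
      hlen, γ.path_eq ⟨h1, h2.le.trans h3⟩, γ.path_eq ⟨h1.trans h2.le, h3⟩]
    simp [Curve.sub]
  have hD : WUG μ p (fun x => F x - f x) (fun x => g' x + g' x) univ :=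
    WUG.add hp0 (PAECurve.of_forall hp0 fun γ _ => hFinc γ)
      (PAECurve.of_forall hp0 fun γ _ => hinc' γ) hg'm fun x y => by
        rw [show F x - f x - (F y - f y) = (F x - F y) - (f x - f y) by ring]
        exact abs_sub _ _
  have hDm : Measurable fun x => F x - f x := hFlsc.measurable.sub hf
  have hL : PLoc μ p (fun x => g' x + g' x) univ := by
    have h1 : PAECurve μ p fun γ => curveLint γ (fun x => G x ^ (1 / p)) < ⊤ :=
      PAECurve.lint_lt_top (hG.measurable.pow_const _) (by
        simp_rw [← ENNReal.rpow_mul, one_div_mul_cancel hp0.ne', ENNReal.rpow_one]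
        exact hGfin)
    refine h1.mono fun γ hγ => ?_
    rw [indicator_univ]
    have h2 : curveLint γ g' < ⊤ := by
      simp only [curveLint, hg']
      rw [lintegral_add_right _ measurable_const]
      refine ENNReal.add_lt_top.2 ⟨hγ, ?_⟩
      simp
    rw [curveLint_eq_path] at h2 ⊢
    rw [lintegral_add_left (f := fun r => g' (γ.path r)) (hg'm.comp γ.measurable_path)]
    exact ENNReal.add_lt_top.2 ⟨h2, h2⟩
  have hsub : {x | f x ≠ F x} ⊆ (K ∪ Z)ᶜ := fun x hx hxS => hx (hFS x hxS).symm
  refine ⟨F, hFlsc, hfF, fun x => ?_, fun x hx => hFS x (Or.inr hx),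
    (measure_mono hsub).trans (hWμ.trans (min_le_left _ _)), _,
    (hg'm.add hg'm).indicator (measurableSet_lt measurable_const hDm),
    WUG.indicator_pos hp0 hD hDm (hg'm.add hg'm) hL fun x => sub_nonneg.2 (hfF x), ?_⟩
  · exact ENNReal.toReal_le_of_le_ofReal zero_le_one (by simp)
  · calc ∫⁻ x, ({x | 0 < F x - f x}.indicator (fun x => g' x + g' x) x) ^ p ∂μ
        ≤ ∫⁻ x, (K ∪ Z)ᶜ.indicator (fun x => (g' x + g' x) ^ p) x ∂μ := by
          refine lintegral_mono fun x => ?_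
          by_cases hx : 0 < F x - f x
          · have hx' : x ∈ (K ∪ Z)ᶜ := hsub (fun e => by rw [e, sub_self] at hx; exact hx.false)
            rw [indicator_of_mem (by exact hx), indicator_of_mem hx']
          · rw [indicator_of_notMem (by exact hx), ENNReal.zero_rpow_of_pos hp0]
            exact zero_le
      _ = ∫⁻ x in (K ∪ Z)ᶜ, (g' x + g' x) ^ p ∂ν := by
          rw [lintegral_indicator hWm, hν, Measure.restrict_restrict hWm, inter_eq_left.2 hWZ]
      _ ≤ ε := (hδε _ (by
          calc ν (K ∪ Z)ᶜ ≤ μ (K ∪ Z)ᶜ := Measure.restrict_apply_le _ _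
            _ ≤ δ / 2 := hWμ.trans (min_le_right _ _)
            _ < δ := ENNReal.half_lt_self hδ.ne' hδtop)).le

/-- `f` is a test function for `cap_p(A, B)` with values in `[0, 1]` and weak upper gradient
`g`. -/
structure Admissible (μ : Measure X) (p : ℝ) (A B : Set X) (f : X → ℝ) (g : X → ℝ≥0∞) : Prop where
  measurable : Measurable f
  nonneg : ∀ x, 0 ≤ f x
  le_one : ∀ x, f x ≤ 1
  eq_one : ∀ x ∈ A, f x = 1
  eq_zero : ∀ x ∉ B, f x = 0
  measurable_grad : Measurable g
  wug : WUG μ p f g univ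

lemma abs_max_const_sub_le (c a b : ℝ) : |max c a - max c b| ≤ |a - b| := by
  simpa using abs_max_sub_max_le_max c a c b

lemma abs_min_const_sub_le (c a b : ℝ) : |min a c - min b c| ≤ |a - b| := by
  simpa using abs_min_sub_min_le_max a c b c

section Capacity

variable {μ : Measure X} {p : ℝ} {A B : Set X} {f : X → ℝ} {g : X → ℝ≥0∞}

lemma lintegral_rpow_le_of_eq_zero (hp : 0 < p) (h1 : ∀ x, |f x| ≤ 1)
    (h0 : ∀ x ∉ B, f x = 0) : ∫⁻ x, ENNReal.ofReal |f x| ^ p ∂μ ≤ μ B := by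
  calc ∫⁻ x, ENNReal.ofReal |f x| ^ p ∂μ ≤ ∫⁻ x, (toMeasurable μ B).indicator 1 x ∂μ := by
        refine lintegral_mono fun x => ?_
        by_cases hx : x ∈ toMeasurable μ B
        · rw [indicator_of_mem hx]
          exact ENNReal.rpow_le_one (ENNReal.ofReal_le_one.2 (h1 x)) hp.le
        · rw [h0 x fun h => hx (subset_toMeasurable μ B h)]
          simp [hp]
    _ = μ B := by
        rw [lintegral_indicator_one (measurableSet_toMeasurable μ B), measure_toMeasurable]

lemma Admissible.varCap_le (hp : 0 < p) (h : Admissible μ p A B f g) (hB : μ B < ⊤) :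
    varCap μ p A B ≤ ∫⁻ x, g x ^ p ∂μ := by
  by_cases htop : ∫⁻ x, g x ^ p ∂μ = ⊤
  · exact le_top.trans_eq htop.symm
  have habs : ∀ x, |f x| ≤ 1 := fun x => abs_le.2 ⟨by linarith [h.nonneg x], h.le_one x⟩
  refine iInf₂_le_of_le f ⟨MemNp.of_wug hp h.measurable ?_ h.measurable_grad h.wug ?_, h.eq_zero⟩ <|
    iInf₂_le_of_le (fun x hx => (h.eq_one x hx).ge) g <|
    iInf₂_le_of_le h.measurable_grad (h.wug.isWeakUpperGradientOn hp) le_rfl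
  · rw [Measure.restrict_univ]
    exact (lintegral_rpow_le_of_eq_zero hp habs h.eq_zero).trans_lt hB
  · rw [Measure.restrict_univ]; exact Ne.lt_top htop

lemma exists_admissible_of_varCap_lt [SFinite μ] (hp : 0 < p) {c : ℝ≥0∞} (h : varCap μ p A B < c) :
    ∃ f g, Admissible μ p A B f g ∧ ∫⁻ x, g x ^ p ∂μ < c := by
  simp only [varCap, iInf_lt_iff] at h
  obtain ⟨f, hf, h1, g, hg, hfg, hlt⟩ := h
  refine ⟨fun x => max 0 (min (f x) 1), g, ⟨?_, fun x => le_max_left _ _,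
    fun x => max_le zero_le_one (min_le_right _ _), fun x hx => ?_, fun x hx => ?_, hg, ?_⟩, hlt⟩
  · exact measurable_const.max (hf.1.1.min measurable_const)
  · rw [min_eq_right (h1 x hx), max_eq_right zero_le_one]
  · rw [hf.2 x hx, min_eq_left zero_le_one, max_self]
  · refine (hfg.wug hp).of_abs_le fun x y => ?_
    exact (abs_max_const_sub_le _ _ _).trans (abs_min_const_sub_le _ _ _)

lemma Admissible.mono {A' B' : Set X} (h : Admissible μ p A B f g) (hA : A' ⊆ A) (hB : B ⊆ B') :
    Admissible μ p A' B' f g :=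
  { h with
    eq_one := fun x hx => h.eq_one x (hA hx)
    eq_zero := fun x hx => h.eq_zero x fun h' => hx (hB h') }

lemma varCap_mono {A' B' : Set X} (hA : A' ⊆ A) (hB : B ⊆ B') :
    varCap μ p A' B' ≤ varCap μ p A B :=
  le_iInf₂ fun f hf => le_iInf₂ fun h1 g => le_iInf₂ fun hg h =>
    iInf₂_le_of_le f ⟨hf.1, fun x hx => hf.2 x fun h' => hx (hB h')⟩ <|
    iInf₂_le_of_le (fun x hx => h1 x (hA hx)) g <| iInf₂_le_of_le hg h le_rfl

/-- A Lipschitz function which is `1` on `ball x s` and `0` outside `ball x t`. -/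
def ballCutoff (x : X) (s t : ℝ) (y : X) : ℝ := max 0 (min ((t - dist y x) / (t - s)) 1)

lemma ballCutoff_nonneg (x : X) (s t : ℝ) (y : X) : 0 ≤ ballCutoff x s t y := le_max_left _ _

lemma ballCutoff_le_one (x : X) (s t : ℝ) (y : X) : ballCutoff x s t y ≤ 1 :=
  max_le zero_le_one (min_le_right _ _)

lemma ballCutoff_eq_one {x y : X} {s t : ℝ} (hst : s < t) (hy : y ∈ closedBall x s) :
    ballCutoff x s t y = 1 := by
  have h1 : (1 : ℝ) ≤ (t - dist y x) / (t - s) := by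
    rw [one_le_div (by linarith)]; linarith [mem_closedBall.1 hy]
  rw [ballCutoff, min_eq_right h1, max_eq_right zero_le_one]

lemma ballCutoff_eq_zero {x y : X} {s t : ℝ} (hst : s < t) (hy : y ∉ ball x t) :
    ballCutoff x s t y = 0 := by
  have h1 : (t - dist y x) / (t - s) ≤ 0 := by
    refine div_nonpos_of_nonpos_of_nonneg ?_ (by linarith)
    rw [mem_ball, not_lt] at hy; linarith
  rw [ballCutoff, max_eq_left ((min_le_left _ _).trans h1)]

lemma lipschitzWith_ballCutoff (x : X) {s t : ℝ} (hst : s < t) :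
    LipschitzWith (Real.toNNReal (1 / (t - s))) (ballCutoff x s t) := by
  refine LipschitzWith.of_dist_le_mul fun y z => ?_
  rw [Real.coe_toNNReal _ (by have : 0 < t - s := by linarith
                              positivity), Real.dist_eq]
  refine (abs_max_const_sub_le _ _ _).trans ((abs_min_const_sub_le _ _ _).trans ?_)
  have h0 : 0 < t - s := by linarith
  have h1 : |(t - dist y x) - (t - dist z x)| ≤ dist y z := by
    have := abs_le.1 (abs_dist_sub_le z y x)
    rw [dist_comm z y] at this
    exact abs_le.2 ⟨by linarith, by linarith⟩
  rw [← sub_div, abs_div, abs_of_pos h0, one_div, inv_mul_eq_div]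
  exact div_le_div_of_nonneg_right h1 h0.le

lemma lipschitz_wug_ballCutoff (hp : 0 < p) (x : X) {s t : ℝ} (hst : s < t) :
    WUG μ p (ballCutoff x s t) (fun _ => (Real.toNNReal (1 / (t - s)) : ℝ≥0∞)) univ :=
  WUG.of_lipschitz hp (lipschitzWith_ballCutoff x hst)

lemma varCap_ball_lt_top [ProperSpace X] [IsLocallyFiniteMeasure μ] (hp : 0 < p) (A : Set X)
    (x : X) {s t : ℝ} (hst : s < t) : varCap μ p (A ∩ ball x s) (ball x t) < ⊤ := by
  set L : ℝ≥0∞ := (Real.toNNReal (1 / (t - s)) : ℝ≥0∞) with hL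
  have hc := (lipschitzWith_ballCutoff x hst).continuous
  have hS : ∀ y ∉ closedBall x t, ballCutoff x s t y = 0 := fun y hy =>
    ballCutoff_eq_zero hst fun h => hy (ball_subset_closedBall h)
  have hmS : MeasurableSet (closedBall x t) := isClosed_closedBall.measurableSet
  have hfin : ∫⁻ y, ((closedBall x t).indicator (fun _ => L) y) ^ p ∂μ < ⊤ := by
    have : ∀ y, ((closedBall x t).indicator (fun _ => L) y) ^ p
        = (closedBall x t).indicator (fun _ => L ^ p) y := fun y => by
      by_cases hy : y ∈ closedBall x t
      · simp only [indicator_of_mem hy]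
      · simp only [indicator_of_notMem hy]; exact ENNReal.zero_rpow_of_pos hp
    simp_rw [this]
    rw [lintegral_indicator_const hmS]
    exact ENNReal.mul_lt_top (by finiteness) measure_closedBall_lt_top
  have h : Admissible μ p (A ∩ ball x s) (ball x t) (ballCutoff x s t)
      ((closedBall x t).indicator fun _ => L) := by
    refine ⟨hc.measurable, ballCutoff_nonneg x s t, ballCutoff_le_one x s t,
      fun y hy => ballCutoff_eq_one hst (ball_subset_closedBall hy.2),
      fun y hy => ballCutoff_eq_zero hst hy, measurable_const.indicator hmS, ?_⟩
    have h1 := (lipschitz_wug_ballCutoff (μ := μ) hp x hst).indicator_pos hp hc.measurable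
      measurable_const (PLoc.const hp ENNReal.coe_ne_top _) (ballCutoff_nonneg x s t)
    refine h1.mono fun y => indicator_le_indicator_of_subset ?_ (fun _ => zero_le) y
    intro z hz
    by_contra hz'
    exact hz.ne' (hS z hz')
  exact (h.varCap_le hp measure_ball_lt_top).trans_lt hfin

lemma varCap_inter_ball_mono {A A' : Set X} (hA : A' ⊆ A) {x x' : X} {s s' t t' : ℝ}
    (hs : dist x x' + s' ≤ s) (ht : dist x x' + t ≤ t') :
    varCap μ p (A' ∩ ball x' s') (ball x' t') ≤ varCap μ p (A ∩ ball x s) (ball x t) := by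
  refine varCap_mono (inter_subset_inter hA (ball_subset_ball' ?_)) (ball_subset_ball' ?_)
  · rw [dist_comm]; linarith
  · linarith

end Capacity

section Truncation

variable {μ : Measure X} {p : ℝ} {A B : Set X} {f : X → ℝ} {g : X → ℝ≥0∞}

lemma exists_pos_of_eventually_nhdsGT {P : ℝ → Prop} (h : ∀ᶠ t in nhdsWithin (0 : ℝ) (Ioi 0), P t) :
    ∃ t, 0 < t ∧ t < 1 ∧ P t := by
  obtain ⟨t, ht, ht1, ht2⟩ := (h.and ((eventually_mem_nhdsWithin).and
    (nhdsWithin_le_nhds (gt_mem_nhds (zero_lt_one (α := ℝ)))))).exists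
  exact ⟨t, ht1, ht2, ht⟩

lemma tendsto_lintegral_inter_pos_lt {q : X → ℝ} (hq : Measurable q) {G : X → ℝ≥0∞}
    (hG : Measurable G) (hfin : ∫⁻ x, G x ∂μ < ⊤) :
    Tendsto (fun τ : ℝ => ∫⁻ x in {x | 0 < q x ∧ q x < τ}, G x ∂μ) (nhdsWithin 0 (Ioi 0))
      (nhds 0) := by
  have hms : ∀ τ : ℝ, MeasurableSet {x | 0 < q x ∧ q x < τ} := fun τ =>
    (measurableSet_lt measurable_const hq).inter (measurableSet_lt hq measurable_const)
  have h0 : (0 : ℝ≥0∞) = ∫⁻ x, 0 ∂μ := by simp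
  simp_rw [← lintegral_indicator (hms _)]
  rw [h0]
  refine tendsto_lintegral_filter_of_dominated_convergence G
    (Eventually.of_forall fun τ => hG.indicator (hms τ))
    (Eventually.of_forall fun τ => Eventually.of_forall fun x => indicator_le_self _ _ x) hfin.ne
    (Eventually.of_forall fun x => ?_)
  refine tendsto_const_nhds.congr' ?_
  by_cases hx : 0 < q x
  · filter_upwards [nhdsWithin_le_nhds (gt_mem_nhds hx)] with τ hτ
    rw [indicator_of_notMem fun h => (h.2.trans hτ).false]
  · exact Eventually.of_forall fun τ => (indicator_of_notMem (fun h => hx h.1) _).symm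

lemma WUG.min_const (hp : 0 < p) {q : X → ℝ} (hq : Measurable q) (hq0 : ∀ x, 0 ≤ q x)
    (h : WUG μ p q g univ) (hg : Measurable g) (hfin : ∫⁻ x, g x ^ p ∂μ < ⊤) {τ : ℝ}
    (hτ : 0 ≤ τ) :
    WUG μ p (fun x => Min.min (q x) τ) ({x | 0 < q x ∧ q x < τ}.indicator g) univ := by
  have hL := PLoc.of_lintegral_univ hp hg MeasurableSet.univ hfin
  have h1 : WUG μ p (fun x => Min.min (q x) τ) g univ :=
    h.of_abs_le fun x y => abs_min_const_sub_le _ _ _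
  have hm : Measurable fun x => Min.min (q x) τ := hq.min measurable_const
  have h2 := h1.indicator_pos hp hm hg hL fun x => le_min (hq0 x) hτ
  have hms : MeasurableSet {x | 0 < Min.min (q x) τ} := measurableSet_lt measurable_const hm
  have h3 : WUG μ p (fun x => τ - Min.min (q x) τ) ({x | 0 < Min.min (q x) τ}.indicator g) univ :=
    h2.of_abs_le fun x y => by
      rw [_root_.sub_sub_sub_cancel_left, abs_sub_comm]
  have hfin' : ∫⁻ x, ({x | 0 < Min.min (q x) τ}.indicator g x) ^ p ∂μ < ⊤ :=
    (lintegral_mono fun x => ENNReal.rpow_le_rpow (indicator_le_self _ _ x) hp.le).trans_lt hfin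
  have h4 := h3.indicator_pos hp (measurable_const.sub hm) (hg.indicator hms)
    (PLoc.of_lintegral_univ hp (hg.indicator hms) MeasurableSet.univ hfin')
    fun x => sub_nonneg.2 (min_le_right _ _)
  refine (h4.of_abs_le (f₁ := fun x => Min.min (q x) τ) fun x y => ?_).mono fun x => ?_
  · rw [_root_.sub_sub_sub_cancel_left, abs_sub_comm]
  · rw [indicator_indicator]
    refine indicator_le_indicator_of_subset ?_ (fun _ => zero_le) x
    rintro y ⟨hy1, hy2⟩
    refine ⟨(lt_min_iff.1 hy2).1, ?_⟩
    by_contra hlt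
    have : 0 < τ - Min.min (q y) τ := hy1
    rw [min_eq_right (not_lt.1 hlt)] at this
    linarith

lemma exists_upperSemicontinuous_le [ProperSpace X] [IsLocallyFiniteMeasure μ] (hp : 1 < p)
    (hf : Measurable f) (hf0 : ∀ x, 0 ≤ f x) (hf1 : ∀ x, f x ≤ 1) (h : WUG μ p f g univ)
    (hg : Measurable g) (hgfin : ∫⁻ x, g x ^ p ∂μ < ⊤) {Z : Set X} (hZ : IsClosed Z) {a : ℝ}
    (hfZ : ∀ x ∈ Z, f x = a) (hZb : μ Zᶜ < ⊤) {ε : ℝ≥0∞} (hε : ε ≠ 0) :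
    ∃ q : X → ℝ, UpperSemicontinuous q ∧ (∀ x, q x ≤ f x) ∧ (∀ x, 0 ≤ q x) ∧
      (∀ x ∈ Z, q x = f x) ∧ μ {x | f x ≠ q x} ≤ ε ∧ ∃ e : X → ℝ≥0∞, Measurable e ∧
        WUG μ p (fun x => f x - q x) e univ ∧ ∫⁻ x, e x ^ p ∂μ ≤ ε := by
  obtain ⟨F, hF, hle, hF1, hFZ, hμ, e, he, hew, hei⟩ := exists_lowerSemicontinuous_ge (μ := μ) hp
    (f := fun x => 1 - f x) (measurable_const.sub hf) (fun x => sub_nonneg.2 (hf1 x))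
    (fun x => by linarith [hf0 x]) (h.of_abs_le fun x y => by
      rw [_root_.sub_sub_sub_cancel_left, abs_sub_comm]) hg hgfin hZ (a := 1 - a)
    (fun x hx => by rw [hfZ x hx]) hZb hε
  refine ⟨fun x => 1 - F x, ?_, fun x => by linarith [hle x], fun x => by linarith [hF1 x],
    fun x hx => by linarith [hFZ x hx], (measure_mono fun x hx => ?_).trans hμ, e, he, ?_, hei⟩
  · intro x c hc
    filter_upwards [hF x (1 - c) (by linarith)] with y hy
    linarith
  · intro h'
    exact hx (by linarith)
  · exact hew.congr fun x => by ring

/-- A function vanishing on a closed set with complement of finite measure can be approximated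
from below by the truncation of an upper semicontinuous function. -/
lemma exists_truncation [ProperSpace X] [IsLocallyFiniteMeasure μ] (hp : 1 < p)
    (hf : Measurable f) (hf0 : ∀ x, 0 ≤ f x) (hf1 : ∀ x, f x ≤ 1) (h : WUG μ p f g univ)
    (hg : Measurable g) (hgfin : ∫⁻ x, g x ^ p ∂μ < ⊤) {Z : Set X} (hZ : IsClosed Z)
    (hfZ : ∀ x ∈ Z, f x = 0) (hZb : μ Zᶜ < ⊤) {ε : ℝ≥0∞} (hε : ε ≠ 0) :
    ∃ q : X → ℝ, UpperSemicontinuous q ∧ (∀ x, q x ≤ f x) ∧ (∀ x, 0 ≤ q x) ∧ ∃ τ : ℝ, 0 < τ ∧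
      ∃ e : X → ℝ≥0∞, Measurable e ∧ WUG μ p (fun x => f x - max (q x - τ) 0) e univ ∧
        ∫⁻ x, e x ^ p ∂μ ≤ ε ∧ ∫⁻ x, ENNReal.ofReal (f x - max (q x - τ) 0) ^ p ∂μ ≤ ε := by
  have hp0 : 0 < p := by linarith
  have h2p : (2 : ℝ≥0∞) ^ p ≠ 0 := (ENNReal.rpow_pos (by norm_num) (by norm_num)).ne'
  have h2p' : (2 : ℝ≥0∞) ^ p ≠ ⊤ := by finiteness
  set δ : ℝ≥0∞ := min 1 ε / 2 ^ p with hδ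
  have hδ0 : 0 < δ := ENNReal.div_pos (lt_min one_pos (pos_iff_ne_zero.2 hε)).ne' h2p'
  have hδε : δ * 2 ^ p ≤ ε := by
    rw [hδ, ENNReal.div_mul_cancel h2p h2p']; exact min_le_right _ _
  have hδε2 : δ + δ ≤ ε := by
    rw [← mul_two]
    refine le_trans ?_ hδε
    gcongr
    calc (2 : ℝ≥0∞) = 2 ^ (1 : ℝ) := (ENNReal.rpow_one 2).symm
      _ ≤ 2 ^ p := ENNReal.rpow_le_rpow_of_exponent_le (by norm_num) hp.le
  have hδtop : δ < ⊤ := ENNReal.div_lt_top ((min_le_left _ _).trans_lt one_lt_top).ne h2p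
  obtain ⟨q, hq, hqf, hq0, hqZ, hμ, e, he, hew, hei⟩ := exists_upperSemicontinuous_le hp hf hf0 hf1
    h hg hgfin hZ hfZ hZb hδ0.ne'
  have hqm : Measurable q := hq.measurable
  have hqw : WUG μ p q (fun x => g x + e x) univ := h.add hp0 hew hg fun x y => by
    have : q x - q y = (f x - f y) - ((f x - q x) - (f y - q y)) := by ring
    rw [this]; exact abs_sub _ _
  have hGfin : ∫⁻ x, (g x + e x) ^ p ∂μ < ⊤ :=
    lintegral_rpow_add_lt_top' hp0 hg hgfin (hei.trans_lt hδtop)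
  have hms : ∀ τ : ℝ, MeasurableSet {x | 0 < q x ∧ q x < τ} := fun τ =>
    (measurableSet_lt measurable_const hqm).inter (measurableSet_lt hqm measurable_const)
  have ht1 : ∀ᶠ τ : ℝ in nhdsWithin 0 (Ioi 0),
      ∫⁻ x in {x | 0 < q x ∧ q x < τ}, (g x + e x) ^ p ∂μ < δ :=
    (tendsto_lintegral_inter_pos_lt hqm ((hg.add he).pow_const p) hGfin).eventually
      (gt_mem_nhds hδ0)
  have ht2 : ∀ᶠ τ : ℝ in nhdsWithin 0 (Ioi 0), ENNReal.ofReal τ ^ p * μ Zᶜ < δ := by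
    refine nhdsWithin_le_nhds (Tendsto.eventually (f := fun τ : ℝ => ENNReal.ofReal τ ^ p * μ Zᶜ)
      (l₂ := nhds 0) ?_ (gt_mem_nhds hδ0))
    have : (0 : ℝ≥0∞) = ENNReal.ofReal 0 ^ p * μ Zᶜ := by
      rw [ENNReal.ofReal_zero, ENNReal.zero_rpow_of_pos hp0, zero_mul]
    rw [this]
    refine ENNReal.Tendsto.mul_const ?_ (Or.inr hZb.ne)
    exact (ENNReal.continuous_rpow_const.comp ENNReal.continuous_ofReal).tendsto 0
  obtain ⟨τ, hτ0, hτ1, hτi, hτμ⟩ := exists_pos_of_eventually_nhdsGT (ht1.and ht2)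
  have hdec : ∀ x, f x - max (q x - τ) 0 = (f x - q x) + Min.min (q x) τ := fun x => by
    rcases le_total (q x) τ with hx | hx
    · rw [min_eq_left hx, max_eq_right (by linarith)]; ring
    · rw [min_eq_right hx, max_eq_left (by linarith)]; ring
  refine ⟨q, hq, hqf, hq0, τ, hτ0, fun x => e x + {x | 0 < q x ∧ q x < τ}.indicator
    (fun x => g x + e x) x, he.add ((hg.add he).indicator (hms τ)), ?_, ?_, ?_⟩
  · refine hew.add hp0 (hqw.min_const hp0 hqm hq0 (hg.add he) hGfin hτ0.le) he fun x y => ?_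
    rw [hdec, hdec, add_sub_add_comm]
    exact abs_add_le _ _
  · calc ∫⁻ x, (e x + {x | 0 < q x ∧ q x < τ}.indicator (fun x => g x + e x) x) ^ p ∂μ
        ≤ ∫⁻ x, 2 ^ (p - 1) * (e x ^ p +
            ({x | 0 < q x ∧ q x < τ}.indicator (fun x => g x + e x) x) ^ p) ∂μ :=
          lintegral_mono fun x => ENNReal.rpow_add_le_mul_rpow_add_rpow _ _ hp.le
      _ = 2 ^ (p - 1) * (∫⁻ x, e x ^ p ∂μ +
            ∫⁻ x in {x | 0 < q x ∧ q x < τ}, (g x + e x) ^ p ∂μ) := by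
          rw [lintegral_const_mul' _ _ (by finiteness), lintegral_add_left (he.pow_const p),
            ← lintegral_indicator (hms τ)]
          congr 3
          ext x
          by_cases hx : x ∈ {x | 0 < q x ∧ q x < τ}
          · simp only [indicator_of_mem hx]
          · simp only [indicator_of_notMem hx]; exact ENNReal.zero_rpow_of_pos hp0
      _ ≤ 2 ^ (p - 1) * (δ + δ) := by gcongr
      _ = δ * 2 ^ p := by
          rw [← mul_two, mul_comm, mul_assoc]
          congr 1
          nth_rewrite 1 [← ENNReal.rpow_one 2]
          rw [← ENNReal.rpow_add _ _ (by norm_num) (by norm_num)]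
          congr 1; ring
      _ ≤ ε := hδε
  · calc ∫⁻ x, ENNReal.ofReal (f x - max (q x - τ) 0) ^ p ∂μ
        ≤ ∫⁻ x, ((toMeasurable μ {x | f x ≠ q x}).indicator 1 x +
            Zᶜ.indicator (fun _ => ENNReal.ofReal τ ^ p) x) ∂μ := by
          refine lintegral_mono fun x => ?_
          by_cases hx : x ∈ toMeasurable μ {x | f x ≠ q x}
          · rw [indicator_of_mem hx]
            refine le_add_right (ENNReal.rpow_le_one (ENNReal.ofReal_le_one.2 ?_) hp0.le)
            linarith [hf1 x, le_max_right (q x - τ) 0]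
          · have hfq : f x = q x := by
              by_contra h'
              exact hx (subset_toMeasurable _ _ h')
            rw [indicator_of_notMem hx, zero_add]
            by_cases hxZ : x ∈ Z
            · have h1 : max (q x - τ) 0 = 0 := max_eq_right (by
                rw [hqZ x hxZ, hfZ x hxZ]; linarith)
              rw [h1, hfZ x hxZ]
              simp [hp0]
            · rw [indicator_of_mem (by exact hxZ)]
              gcongr
              rw [hdec, hfq, sub_self, zero_add]
              exact min_le_right _ _
      _ = μ {x | f x ≠ q x} + ENNReal.ofReal τ ^ p * μ Zᶜ := by
          rw [lintegral_add_left (measurable_one.indicator (measurableSet_toMeasurable _ _)),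
            lintegral_indicator_one (measurableSet_toMeasurable _ _), measure_toMeasurable,
            lintegral_indicator_const hZ.measurableSet.compl]
      _ ≤ δ + δ := by gcongr
      _ ≤ ε := hδε2

end Truncation

section CapacityContinuity

variable {μ : Measure X} {p : ℝ} {A B : Set X}

lemma lintegral_add_rpow_le (hp : 1 ≤ p) {a b : X → ℝ≥0∞} (ha : Measurable a) :
    ∫⁻ x, (a x + b x) ^ p ∂μ ≤ 2 ^ (p - 1) * (∫⁻ x, a x ^ p ∂μ + ∫⁻ x, b x ^ p ∂μ) := by
  calc ∫⁻ x, (a x + b x) ^ p ∂μ ≤ ∫⁻ x, 2 ^ (p - 1) * (a x ^ p + b x ^ p) ∂μ :=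
        lintegral_mono fun x => ENNReal.rpow_add_le_mul_rpow_add_rpow _ _ hp
    _ = _ := by
        rw [lintegral_const_mul' _ _ (by finiteness), lintegral_add_left (ha.pow_const p)]

/-- Almost every curve avoids `P`. -/
def CurveNull (μ : Measure X) (p : ℝ) (P : Set X) : Prop :=
  PAECurve μ p fun γ => ∀ t ∈ Icc 0 γ.len, γ.path t ∉ P

lemma varCap_union_inter_of_curveNull [SFinite μ] (hp : 0 < p) {P D : Set X} (hP : CurveNull μ p P)
    (hPm : MeasurableSet P) (hD : MeasurableSet D) (hDB : D ⊆ B) (hB : μ B < ⊤) (A : Set X) :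
    varCap μ p ((A ∪ P) ∩ D) B = varCap μ p (A ∩ D) B := by
  classical
  refine le_antisymm (le_of_forall_gt fun c hc => ?_)
    (varCap_mono (inter_subset_inter_left _ subset_union_left) le_rfl)
  obtain ⟨f, g, h, hlt⟩ := exists_admissible_of_varCap_lt hp hc
  refine (Admissible.varCap_le (f := (P ∩ D).piecewise (fun _ => 1) f) (g := g) hp
    ⟨Measurable.piecewise (hPm.inter hD) measurable_const h.measurable, fun x => ?_, fun x => ?_,
      fun x hx => ?_, fun x hx => ?_, h.measurable_grad, ?_⟩ hB).trans_lt hlt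
  · by_cases hx : x ∈ P ∩ D
    · rw [piecewise_eq_of_mem _ _ _ hx]; exact zero_le_one
    · rw [piecewise_eq_of_notMem _ _ _ hx]; exact h.nonneg x
  · by_cases hx : x ∈ P ∩ D
    · rw [piecewise_eq_of_mem _ _ _ hx]
    · rw [piecewise_eq_of_notMem _ _ _ hx]; exact h.le_one x
  · by_cases hx' : x ∈ P ∩ D
    · rw [piecewise_eq_of_mem _ _ _ hx']
    · rw [piecewise_eq_of_notMem _ _ _ hx']
      exact h.eq_one x ⟨hx.1.resolve_right fun h' => hx' ⟨h', hx.2⟩, hx.2⟩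
  · rw [piecewise_eq_of_notMem _ _ _ fun h' => hx (hDB h'.2)]
    exact h.eq_zero x hx
  · refine (PAECurve.and hp hP h.wug).mono fun γ hγ hU s t hs hst ht => ?_
    have h1 : ∀ r ∈ Icc 0 γ.len, (P ∩ D).piecewise (fun _ => (1 : ℝ)) f (γ.path r)
        = f (γ.path r) := fun r hr =>
      piecewise_eq_of_notMem _ _ _ fun h' => hγ.1 r hr h'.1
    beta_reduce
    rw [h1 s ⟨hs, hst.trans ht⟩, h1 t ⟨hs.trans hst, ht⟩]
    exact hγ.2 hU s t hs hst ht

lemma exists_lt_varCap_ball_lt [ProperSpace X] [IsLocallyFiniteMeasure μ] (hp : 1 < p) {x : X}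
    {s t₀ : ℝ} (hs : s < t₀) {c : ℝ≥0∞} (hc : varCap μ p (A ∩ ball x s) (ball x t₀) < c) :
    ∃ t, s < t ∧ t < t₀ ∧ varCap μ p (A ∩ ball x s) (ball x t) < c := by
  have hp0 : 0 < p := by linarith
  obtain ⟨f, g, h, hlt⟩ := exists_admissible_of_varCap_lt hp0 hc
  have hgfin : ∫⁻ x, g x ^ p ∂μ < ⊤ := hlt.trans_le le_top
  obtain ⟨η, hη, hηc⟩ : ∃ η : ℝ≥0∞, η ≠ 0 ∧ (∫⁻ x, g x ^ p ∂μ) + η < c := by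
    obtain ⟨η, hη0, hη⟩ := ENNReal.lt_iff_exists_add_pos_lt.1 hlt
    exact ⟨η, by simpa using hη0.ne', hη⟩
  obtain ⟨ε, hε, hadd⟩ := exists_energy_add_le (μ := μ) (V := univ) hp.le h.measurable_grad
    (by rwa [Measure.restrict_univ]) hη
  simp only [Measure.restrict_univ] at hadd
  set s' := (s + t₀) / 2 with hs'
  have hss' : s < s' := by rw [hs']; linarith
  have hst' : s' < t₀ := by rw [hs']; linarith
  set L : NNReal := Real.toNNReal (1 / (s' - s)) with hL
  have hK0 : (1 + (L : ℝ≥0∞)) ^ p ≠ 0 :=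
    (ENNReal.rpow_pos (by positivity) (by finiteness)).ne'
  have h2 : (2 : ℝ≥0∞) ^ (p - 1) ≠ 0 := (ENNReal.rpow_pos (by norm_num) (by norm_num)).ne'
  set δ : ℝ≥0∞ := min 1 ε / (2 ^ (p - 1) * (1 + (L : ℝ≥0∞)) ^ p) with hδ
  have hden0 : (2 : ℝ≥0∞) ^ (p - 1) * (1 + (L : ℝ≥0∞)) ^ p ≠ 0 := mul_ne_zero h2 hK0
  have hdent : (2 : ℝ≥0∞) ^ (p - 1) * (1 + (L : ℝ≥0∞)) ^ p ≠ ⊤ := by finiteness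
  have hδ0 : δ ≠ 0 := (ENNReal.div_pos (lt_min one_pos hε).ne' hdent).ne'
  obtain ⟨q, hq, hqf, hq0, τ, hτ, e, he, hew, hei, hfi⟩ := exists_truncation (μ := μ) hp
    h.measurable h.nonneg h.le_one h.wug h.measurable_grad hgfin (Z := (ball x t₀)ᶜ)
    isOpen_ball.isClosed_compl (fun y hy => h.eq_zero y hy)
    (by rw [compl_compl]; exact measure_ball_lt_top) (ε := δ / 2) (ENNReal.half_pos hδ0).ne'
  set h' : X → ℝ := fun y => f y - max (q y - τ) 0 with hh'
  have hqm : Measurable q := hq.measurable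
  have hh'm : Measurable h' :=
    h.measurable.sub ((hqm.sub measurable_const).max measurable_const)
  have hmax : ∀ y, max (q y - τ) 0 ≤ f y := fun y =>
    max_le (by linarith [hqf y]) (h.nonneg y)
  have hh'0 : ∀ y, 0 ≤ h' y := fun y => sub_nonneg.2 (hmax y)
  have hh'1 : ∀ y, h' y ≤ 1 := fun y => by
    have := h.le_one y
    have := le_max_right (q y - τ) 0
    simp only [hh']; linarith
  obtain ⟨t', ht', hKt'⟩ := exists_lt_subset_ball (s := q ⁻¹' Ici τ) (x := x) (r := t₀)
    (hq.isClosed_preimage τ) fun y hy => by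
      by_contra hy'
      have h1 : τ ≤ q y := hy
      linarith [hqf y, h.eq_zero y hy']
  set e' : X → ℝ≥0∞ := fun y => e y + L * ENNReal.ofReal (h' y) with he'
  have he'm : Measurable e' := he.add (hh'm.ennreal_ofReal.const_mul _)
  have hδt : δ < ⊤ := ENNReal.div_lt_top ((min_le_left _ _).trans_lt one_lt_top).ne hden0
  have he'i : ∫⁻ y, e' y ^ p ∂μ ≤ ε := by
    calc ∫⁻ y, e' y ^ p ∂μ
        ≤ 2 ^ (p - 1) * (∫⁻ y, e y ^ p ∂μ + ∫⁻ y, (L * ENNReal.ofReal (h' y)) ^ p ∂μ) :=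
          lintegral_add_rpow_le hp.le he
      _ ≤ 2 ^ (p - 1) * ((1 + L) ^ p * (δ / 2) + (1 + L) ^ p * (δ / 2)) := by
          rw [lintegral_const_mul_rpow μ hp0 hh'm.ennreal_ofReal]
          gcongr
          · refine hei.trans (le_mul_of_one_le_left zero_le ?_)
            exact ENNReal.one_le_rpow le_self_add hp0
          · exact le_add_self
      _ = 2 ^ (p - 1) * (1 + (L : ℝ≥0∞)) ^ p * δ := by
          rw [← mul_add, ENNReal.add_halves, mul_assoc]
      _ ≤ ε := by
          rw [hδ, ENNReal.mul_div_cancel hden0 hdent]; exact min_le_right _ _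
  set χ : X → ℝ := ballCutoff x s s' with hχ
  have hχw : WUG μ p (fun y => 1 - χ y) (fun _ => (L : ℝ≥0∞)) univ :=
    (lipschitz_wug_ballCutoff hp0 x hss').of_abs_le fun y z => by
      rw [_root_.sub_sub_sub_cancel_left, abs_sub_comm]
  have hei_lt : ∫⁻ y, e y ^ p ∂μ < ⊤ := hei.trans_lt ((ENNReal.half_le_self).trans_lt hδt)
  have hmw : WUG μ p (fun y => (1 - χ y) * h' y) e' univ := by
    refine hχw.mul (W := univ) hp0 hew measurable_const he he'm
      (PLoc.const hp0 ENNReal.coe_ne_top _)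
      (PLoc.of_lintegral_univ hp0 he MeasurableSet.univ hei_lt) (by simp) (fun y => ?_)
      (fun y => ?_) fun y _ => ?_
    · have h1 := ballCutoff_nonneg x s s' y
      have h2 := ballCutoff_le_one x s s' y
      exact abs_le.2 ⟨by linarith, by linarith⟩
    · exact abs_le.2 ⟨by linarith [hh'0 y], hh'1 y⟩
    · have h1 := ballCutoff_nonneg x s s' y
      have h2 := ballCutoff_le_one x s s' y
      rw [abs_of_nonneg (hh'0 y), abs_of_nonneg (by linarith : 0 ≤ 1 - χ y), mul_comm, add_comm]
      refine add_le_add (mul_le_of_le_one_left zero_le (ENNReal.ofReal_le_one.2 (by linarith)))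
        le_rfl
  have hχm : Measurable χ := (lipschitzWith_ballCutoff x hss').continuous.measurable
  have hval : ∀ y, f y - (1 - χ y) * h' y = χ y * f y + (1 - χ y) * max (q y - τ) 0 := fun y => by
    simp only [hh']; ring
  have hadm : Admissible μ p (A ∩ ball x s) (ball x (max s' t'))
      (fun y => f y - (1 - χ y) * h' y) (fun y => g y + e' y) := by
    refine ⟨h.measurable.sub ((measurable_const.sub hχm).mul hh'm), fun y => ?_, fun y => ?_,
      fun y hy => ?_, fun y hy => ?_, h.measurable_grad.add he'm,
      h.wug.add hp0 hmw h.measurable_grad fun y z => ?_⟩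
    · rw [hval]
      have h1 := ballCutoff_nonneg x s s' y
      have h2 := ballCutoff_le_one x s s' y
      have h3 := h.nonneg y
      have h4 := le_max_right (q y - τ) 0
      have h5 : 0 ≤ 1 - χ y := by linarith
      positivity
    · have h2 := ballCutoff_le_one x s s' y
      have := mul_nonneg (by linarith : 0 ≤ 1 - χ y) (hh'0 y)
      linarith [h.le_one y]
    · rw [hχ, ballCutoff_eq_one hss' (ball_subset_closedBall hy.2), h.eq_one y hy]; ring
    · have h1 : y ∉ ball x s' := fun h' => hy (ball_subset_ball (le_max_left _ _) h')
      have h2 : y ∉ q ⁻¹' Ici τ := fun h' => hy (ball_subset_ball (le_max_right _ _) (hKt' h'))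
      have h3 : q y < τ := not_le.1 h2
      rw [hval, hχ, ballCutoff_eq_zero hss' h1, max_eq_right (by linarith)]
      ring
    · rw [sub_sub_sub_comm]
      exact abs_sub _ _
  exact ⟨max s' t', lt_max_of_lt_left hss', max_lt hst' ht',
    ((hadm.varCap_le hp0 measure_ball_lt_top).trans (hadd e' he'm he'i)).trans_lt hηc⟩

end CapacityContinuity

section UniformConvexity

lemma exists_uniform_convexity_unit {p : ℝ} (hp : 1 < p) {η : ℝ} (hη : 0 < η) :
    ∃ C : ℝ, 0 < C ∧ ∀ t ∈ Icc (0 : ℝ) 1,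
      |1 - 2 * t| ^ p ≤ η * (t ^ p + (1 - t) ^ p) +
        C * ((t ^ p + (1 - t) ^ p) / 2 - (1 / 2) ^ p) := by
  have hp0 : 0 < p := by linarith
  set h : ℝ → ℝ := fun t => (t ^ p + (1 - t) ^ p) / 2 - (1 / 2) ^ p with hh
  set k : ℝ → ℝ := fun t => |1 - 2 * t| ^ p - η * (t ^ p + (1 - t) ^ p) with hk
  have hc1 : Continuous fun t : ℝ => t ^ p := Real.continuous_rpow_const hp0.le
  have hc2 : Continuous fun t : ℝ => (1 - t) ^ p := hc1.comp (continuous_const.sub continuous_id)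
  have hc3 : Continuous fun t : ℝ => |1 - 2 * t| ^ p :=
    hc1.comp (continuous_const.sub (continuous_const.mul continuous_id)).abs
  have hch : Continuous h := ((hc1.add hc2).div_const 2).sub continuous_const
  have hck : Continuous k := hc3.sub (continuous_const.mul (hc1.add hc2))
  have hpos : ∀ t ∈ Icc (0 : ℝ) 1, 0 ≤ t ^ p + (1 - t) ^ p := fun t ht =>
    add_nonneg (Real.rpow_nonneg ht.1 _) (Real.rpow_nonneg (by linarith [ht.2]) _)
  have hh0 : ∀ t ∈ Icc (0 : ℝ) 1, 0 ≤ h t := fun t ht => by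
    have := (convexOn_rpow hp.le).2 (mem_Ici.2 ht.1) (mem_Ici.2 (by linarith [ht.2] : 0 ≤ 1 - t))
      (by norm_num : (0 : ℝ) ≤ 1 / 2) (by norm_num : (0 : ℝ) ≤ 1 / 2) (by norm_num)
    simp only [smul_eq_mul] at this
    rw [show 1 / 2 * t + 1 / 2 * (1 - t) = 1 / 2 by ring] at this
    simp only [hh]; linarith
  have hhpos : ∀ t ∈ Icc (0 : ℝ) 1, t ≠ 1 / 2 → 0 < h t := fun t ht hne => by
    have := (strictConvexOn_rpow hp).2 (mem_Ici.2 ht.1)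
      (mem_Ici.2 (by linarith [ht.2] : 0 ≤ 1 - t)) (fun h' => hne (by linarith))
      (by norm_num : (0 : ℝ) < 1 / 2) (by norm_num : (0 : ℝ) < 1 / 2) (by norm_num)
    simp only [smul_eq_mul] at this
    rw [show 1 / 2 * t + 1 / 2 * (1 - t) = 1 / 2 by ring] at this
    simp only [hh]; linarith
  set K : Set ℝ := Icc 0 1 ∩ {t | 0 ≤ k t} with hK
  have hKc : IsCompact K := isCompact_Icc.inter_right (isClosed_le continuous_const hck)
  have hK2 : ∀ t ∈ K, 0 < h t := fun t ht => hhpos t ht.1 fun h' => by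
    have h1 : 0 ≤ k t := ht.2
    simp only [hk, h'] at h1
    norm_num at h1
    rw [Real.zero_rpow hp0.ne'] at h1
    have : (0 : ℝ) < (1 / 2) ^ p := by positivity
    nlinarith
  have hk1 : ∀ t ∈ Icc (0 : ℝ) 1, k t ≤ 1 := fun t ht => by
    have h1 : |1 - 2 * t| ^ p ≤ 1 := Real.rpow_le_one (abs_nonneg _)
      (abs_le.2 ⟨by linarith [ht.2], by linarith [ht.1]⟩) hp0.le
    have := mul_nonneg hη.le (hpos t ht)
    simp only [hk]; linarith
  have hgoal : ∃ C : ℝ, 0 < C ∧ ∀ t ∈ K, k t ≤ C * h t := by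
    rcases K.eq_empty_or_nonempty with h0 | hne
    · exact ⟨1, one_pos, fun t ht => by simp [h0] at ht⟩
    · obtain ⟨t₀, ht₀, hmin⟩ := hKc.exists_isMinOn hne hch.continuousOn
      refine ⟨1 / h t₀, one_div_pos.2 (hK2 t₀ ht₀), fun t ht => (hk1 t ht.1).trans ?_⟩
      rw [one_div_mul_eq_div, one_le_div (hK2 t₀ ht₀)]
      exact hmin ht
  obtain ⟨C, hC, hCk⟩ := hgoal
  refine ⟨C, hC, fun t ht => ?_⟩
  have h2 : k t ≤ C * h t := by
    by_cases hkt : 0 ≤ k t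
    · exact hCk t ⟨ht, hkt⟩
    · exact (not_le.1 hkt).le.trans (mul_nonneg hC.le (hh0 t ht))
  simp only [hk, hh] at h2
  linarith

lemma exists_uniform_convexity_real {p : ℝ} (hp : 1 < p) {η : ℝ} (hη : 0 < η) :
    ∃ C : ℝ, 0 < C ∧ ∀ a b : ℝ, 0 ≤ a → 0 ≤ b →
      |b - a| ^ p + C * ((a + b) / 2) ^ p ≤ η * (a ^ p + b ^ p) + C * ((a ^ p + b ^ p) / 2) := by
  have hp0 : 0 < p := by linarith
  obtain ⟨C, hC, h⟩ := exists_uniform_convexity_unit hp hη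
  refine ⟨C, hC, fun a b ha hb => ?_⟩
  rcases (add_nonneg ha hb).eq_or_lt with h0 | hs
  · have ha0 : a = 0 := by linarith
    have hb0 : b = 0 := by linarith
    simp [ha0, hb0, hp0.ne']
  have h1 := h (a / (a + b)) ⟨by positivity, by rw [div_le_one hs]; linarith⟩
  have e1 : 1 - a / (a + b) = b / (a + b) := by field_simp; ring
  have e2 : 1 - 2 * (a / (a + b)) = (b - a) / (a + b) := by field_simp; ring
  rw [e1, e2, abs_div, abs_of_pos hs, Real.div_rpow (abs_nonneg _) hs.le,
    Real.div_rpow ha hs.le, Real.div_rpow hb hs.le] at h1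
  have e3 : ((a + b) / 2) ^ p = (a + b) ^ p * (1 / 2) ^ p := by
    rw [← Real.mul_rpow hs.le (by norm_num)]; ring_nf
  have hsp : 0 < (a + b) ^ p := by positivity
  rw [e3]
  have h2 := mul_le_mul_of_nonneg_left h1 hsp.le
  have e4 : (a + b) ^ p * (|b - a| ^ p / (a + b) ^ p) = |b - a| ^ p := by field_simp
  have e5 : (a + b) ^ p * (η * (a ^ p / (a + b) ^ p + b ^ p / (a + b) ^ p) +
      C * ((a ^ p / (a + b) ^ p + b ^ p / (a + b) ^ p) / 2 - (1 / 2) ^ p)) =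
      η * (a ^ p + b ^ p) + C * ((a ^ p + b ^ p) / 2) - C * ((a + b) ^ p * (1 / 2) ^ p) := by
    field_simp
    ring
  rw [e4, e5] at h2
  linarith

lemma exists_uniform_convexity {p : ℝ} (hp : 1 < p) {η : ℝ} (hη : 0 < η) :
    ∃ C : ℝ≥0∞, 0 < C ∧ C < ⊤ ∧ ∀ a b : ℝ≥0∞,
      (b - a) ^ p + C * ((a + b) / 2) ^ p ≤
        ENNReal.ofReal η * (a ^ p + b ^ p) + C * ((a ^ p + b ^ p) / 2) := by
  have hp0 : 0 < p := by linarith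
  obtain ⟨C, hC, h⟩ := exists_uniform_convexity_real hp hη
  refine ⟨ENNReal.ofReal C, ENNReal.ofReal_pos.2 hC, ENNReal.ofReal_lt_top, fun a b => ?_⟩
  have htop : ENNReal.ofReal η * ⊤ = ⊤ := ENNReal.mul_top (ENNReal.ofReal_pos.2 hη).ne'
  by_cases ha : a = ⊤
  · refine le_top.trans_eq ?_
    rw [ha, ENNReal.top_rpow_of_pos hp0, top_add, htop, top_add]
  by_cases hb : b = ⊤
  · refine le_top.trans_eq ?_
    rw [hb, ENNReal.top_rpow_of_pos hp0, add_top, htop, top_add]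
  lift a to NNReal using ha
  lift b to NNReal using hb
  have h1 := h a b a.coe_nonneg b.coe_nonneg
  have e1 : ((b : ℝ≥0∞) - a) ^ p ≤ ENNReal.ofReal (|(b : ℝ) - a| ^ p) := by
    rw [← ENNReal.ofReal_rpow_of_nonneg (abs_nonneg _) hp0.le]
    gcongr
    rw [← ENNReal.ofReal_coe_nnreal (p := a), ← ENNReal.ofReal_coe_nnreal (p := b),
      ← ENNReal.ofReal_sub _ a.coe_nonneg]
    exact ENNReal.ofReal_le_ofReal (le_abs_self _)
  have e2 : ((a : ℝ≥0∞) + b) / 2 = ENNReal.ofReal (((a : ℝ) + b) / 2) := by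
    rw [ENNReal.ofReal_div_of_pos (by norm_num), ENNReal.ofReal_add a.coe_nonneg b.coe_nonneg]
    simp
  have e3 : (a : ℝ≥0∞) ^ p = ENNReal.ofReal ((a : ℝ) ^ p) := by
    rw [← ENNReal.ofReal_rpow_of_nonneg a.coe_nonneg hp0.le, ENNReal.ofReal_coe_nnreal]
  have e4 : (b : ℝ≥0∞) ^ p = ENNReal.ofReal ((b : ℝ) ^ p) := by
    rw [← ENNReal.ofReal_rpow_of_nonneg b.coe_nonneg hp0.le, ENNReal.ofReal_coe_nnreal]
  have ha := Real.rpow_nonneg a.coe_nonneg p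
  have hb := Real.rpow_nonneg b.coe_nonneg p
  have hab : (0 : ℝ) ≤ ((a : ℝ) + b) / 2 := by positivity
  refine (add_le_add_left e1 _).trans ?_
  rw [e2, e3, e4, ENNReal.ofReal_rpow_of_nonneg hab hp0.le,
    ← ENNReal.ofReal_mul hC.le, ← ENNReal.ofReal_add (by positivity) (by positivity),
    ← ENNReal.ofReal_add ha hb, ← ENNReal.ofReal_mul hη.le,
    show (2 : ℝ≥0∞) = ENNReal.ofReal 2 by simp, ← ENNReal.ofReal_div_of_pos (by norm_num),
    ← ENNReal.ofReal_mul hC.le, ← ENNReal.ofReal_add (by positivity) (by positivity)]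
  exact ENNReal.ofReal_le_ofReal h1

end UniformConvexity

section CapacityUnion

variable {μ : Measure X} {p : ℝ} {A B : Set X}

lemma Admissible.average (hp : 0 < p) {f f' : X → ℝ} {g g' : X → ℝ≥0∞}
    (h : Admissible μ p A B f g) (h' : Admissible μ p A B f' g') :
    Admissible μ p A B (fun x => (f x + f' x) / 2) (fun x => (g x + g' x) / 2) where
  measurable := (h.measurable.add h'.measurable).div_const _
  nonneg x := by have := h.nonneg x; have := h'.nonneg x; positivity
  le_one x := by linarith [h.le_one x, h'.le_one x]
  eq_one x hx := by rw [h.eq_one x hx, h'.eq_one x hx]; norm_num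
  eq_zero x hx := by rw [h.eq_zero x hx, h'.eq_zero x hx]; norm_num
  measurable_grad := (h.measurable_grad.add h'.measurable_grad).div_const _
  wug := by
    have h1 : WUG μ p (fun x => f x + f' x) (fun x => g x + g' x) univ :=
      h.wug.add hp h'.wug h.measurable_grad fun x y => by
        rw [show f x + f' x - (f y + f' y) = (f x - f y) + (f' x - f' y) by ring]
        exact abs_add_le _ _
    refine ((h1.const_mul (1 / 2)).congr fun x => by ring).mono fun x => ?_
    rw [show ENNReal.ofReal |1 / 2| = 2⁻¹ by
      rw [abs_of_pos (by norm_num), one_div, ENNReal.ofReal_inv_of_pos (by norm_num)]; simp,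
      mul_comm, div_eq_mul_inv]

lemma exists_lintegral_sub_rpow_le (hp : 1 < p) (hB : μ B < ⊤) {L ε : ℝ≥0∞} (hL : L < ⊤)
    (hε : 0 < ε) :
    ∃ δ : ℝ≥0∞, 0 < δ ∧ ∀ (A : Set X) (f f' : X → ℝ) (g g' : X → ℝ≥0∞),
      L ≤ varCap μ p A B + δ → Admissible μ p A B f g → Admissible μ p A B f' g' →
      ∫⁻ x, g x ^ p ∂μ ≤ L + δ → ∫⁻ x, g' x ^ p ∂μ ≤ L + δ →
      ∫⁻ x, (g' x - g x) ^ p ∂μ ≤ ε := by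
  have hp0 : 0 < p := by linarith
  obtain ⟨e, he0, heε⟩ := ENNReal.lt_iff_exists_nnreal_btwn.1 hε
  have he : (0 : ℝ) < e := by exact_mod_cast he0
  lift L to NNReal using hL.ne
  have hLn : (0 : ℝ) ≤ L := L.coe_nonneg
  set η : ℝ := e / (4 * (L + 1)) with hη
  have hηp : 0 < η := by positivity
  obtain ⟨C, hC0, hCt, hC⟩ := exists_uniform_convexity hp hηp
  lift C to NNReal using hCt.ne
  have hCp : (0 : ℝ) < C := by exact_mod_cast hC0
  set d : ℝ := min 1 (e / (4 * C)) with hd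
  have hdp : 0 < d := lt_min one_pos (by positivity)
  refine ⟨ENNReal.ofReal d, ENNReal.ofReal_pos.2 hdp, fun A f f' g g' hA h h' hg hg' =>
    le_trans ?_ heε.le⟩
  have hav := (h.average hp0 h').varCap_le hp0 hB
  set I := varCap μ p A B
  have hIt : I < ⊤ := ((h.varCap_le hp0 hB).trans hg).trans_lt (by finiteness)
  have hm := h.measurable_grad
  have hm' := h'.measurable_grad
  have hgint : ∫⁻ x, (g' x - g x) ^ p ∂μ + C * ∫⁻ x, ((g x + g' x) / 2) ^ p ∂μ ≤
      ENNReal.ofReal η * (∫⁻ x, g x ^ p ∂μ + ∫⁻ x, g' x ^ p ∂μ) +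
        C * ((∫⁻ x, g x ^ p ∂μ + ∫⁻ x, g' x ^ p ∂μ) / 2) := by
    have hma : Measurable fun x => g x ^ p := hm.pow_const p
    have hmb : Measurable fun x => g' x ^ p := hm'.pow_const p
    have hmc : Measurable fun x => (g' x - g x) ^ p := (hm'.sub hm).pow_const p
    have hmd : Measurable fun x => ((g x + g' x) / 2) ^ p := ((hm.add hm').div_const 2).pow_const p
    have hme : Measurable fun x => g x ^ p + g' x ^ p := hma.add hmb
    have hmf : Measurable fun x => (g x ^ p + g' x ^ p) / 2 := hme.div_const 2
    have hmh : Measurable fun x => ENNReal.ofReal η * (g x ^ p + g' x ^ p) := hme.const_mul _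
    calc _ = ∫⁻ x, (g' x - g x) ^ p + C * ((g x + g' x) / 2) ^ p ∂μ := by
          rw [lintegral_add_left hmc, lintegral_const_mul _ hmd]
      _ ≤ ∫⁻ x, ENNReal.ofReal η * (g x ^ p + g' x ^ p) +
            C * ((g x ^ p + g' x ^ p) / 2) ∂μ := lintegral_mono fun x => hC _ _
      _ = _ := by
          rw [lintegral_add_left hmh, lintegral_const_mul _ hme, lintegral_const_mul _ hmf]
          simp only [div_eq_mul_inv]
          rw [lintegral_mul_const _ hme, lintegral_add_left hma]
  set a := ∫⁻ x, g x ^ p ∂μ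
  set b := ∫⁻ x, g' x ^ p ∂μ
  set E := ∫⁻ x, (g' x - g x) ^ p ∂μ
  have hab : a + b ≤ ENNReal.ofReal (2 * (L + d)) := by
    refine (add_le_add hg hg').trans_eq ?_
    rw [ENNReal.ofReal_mul (by norm_num), ENNReal.ofReal_add hLn hdp.le,
      ENNReal.ofReal_coe_nnreal]
    simp [two_mul]
  have h1 : E + C * I ≤ ENNReal.ofReal (η * (2 * (L + d)) + C * (L + d)) := by
    refine (add_le_add_right (mul_le_mul_right hav _) _).trans (hgint.trans ?_)
    refine (add_le_add (mul_le_mul_right hab _)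
      (mul_le_mul_right (ENNReal.div_le_div_right hab _) _)).trans_eq ?_
    rw [ENNReal.ofReal_add (by positivity) (by positivity), ENNReal.ofReal_mul hηp.le,
      ENNReal.ofReal_mul hCp.le, ENNReal.ofReal_coe_nnreal]
    congr 2
    rw [show (2 : ℝ≥0∞) = ENNReal.ofReal 2 by simp, ← ENNReal.ofReal_div_of_pos (by norm_num)]
    congr 1; ring
  clear_value I E
  lift I to NNReal using hIt.ne
  have hEt : E ≠ ⊤ := by
    intro hE
    rw [hE, top_add] at h1
    exact absurd h1 (by simp)
  lift E to NNReal using hEt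
  have h2 : (E : ℝ) + C * I ≤ η * (2 * (L + d)) + C * (L + d) := by
    rw [← ENNReal.ofReal_coe_nnreal (p := E), ← ENNReal.ofReal_coe_nnreal (p := C),
      ← ENNReal.ofReal_coe_nnreal (p := I), ← ENNReal.ofReal_mul hCp.le,
      ← ENNReal.ofReal_add E.coe_nonneg (by positivity)] at h1
    exact (ENNReal.ofReal_le_ofReal_iff (by positivity)).1 h1
  have h3 : (L : ℝ) ≤ I + d := by
    rw [← ENNReal.ofReal_coe_nnreal (p := L), ← ENNReal.ofReal_coe_nnreal (p := I),
      ← ENNReal.ofReal_add I.coe_nonneg hdp.le] at hA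
    exact (ENNReal.ofReal_le_ofReal_iff (by positivity)).1 hA
  have h4 : C * (L + d) ≤ C * I + (e / 2 : ℝ) := by
    have : C * d ≤ (e / 4 : ℝ) := by
      calc (C : ℝ) * d ≤ C * (e / (4 * C)) := by gcongr; exact min_le_right _ _
        _ = e / 4 := by field_simp
    nlinarith
  have h5 : η * (2 * (L + d)) ≤ (e / 2 : ℝ) := by
    calc η * (2 * (L + d)) ≤ η * (2 * (L + 1)) := by gcongr; exact min_le_left _ _
      _ = e / 2 := by rw [hη]; field_simp; norm_num
  have h6 : (E : ℝ) ≤ e := by linarith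
  exact_mod_cast h6

lemma lintegral_add_sum_rpow_le (hp : 1 ≤ p) {g₀ : X → ℝ≥0∞} {d : ℕ → X → ℝ≥0∞}
    (hg : Measurable g₀) (hd : ∀ n, Measurable (d n)) {c : ℝ≥0∞} {θ : ℕ → ℝ≥0∞}
    (hg0 : ∫⁻ x, g₀ x ^ p ∂μ ≤ c) (hdθ : ∀ n, ∫⁻ x, d n x ^ p ∂μ ≤ θ n ^ p) (n : ℕ) :
    (∫⁻ x, (g₀ x + ∑ k ∈ Finset.range n, d k x) ^ p ∂μ) ^ (1 / p) ≤
      c ^ (1 / p) + ∑ k ∈ Finset.range n, θ k := by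
  have hp0 : 0 < p := by linarith
  induction n with
  | zero => simpa using ENNReal.rpow_le_rpow hg0 (by positivity)
  | succ n ih =>
    simp only [Finset.sum_range_succ, ← add_assoc]
    have hm : Measurable fun x => g₀ x + ∑ k ∈ Finset.range n, d k x :=
      hg.add (Finset.measurable_sum _ fun i _ => hd i)
    refine (ENNReal.lintegral_Lp_add_le hm.aemeasurable (hd n).aemeasurable hp).trans ?_
    refine add_le_add ih ?_
    refine (ENNReal.rpow_le_rpow (hdθ n) (by positivity)).trans_eq ?_
    rw [← ENNReal.rpow_mul, mul_one_div_cancel hp0.ne', ENNReal.rpow_one]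

lemma exists_add_rpow_add_rpow_le (hp : 0 < p) {L η : ℝ≥0∞} (hL : L < ⊤) (hη : 0 < η) :
    ∃ θ : ℝ≥0∞, 0 < θ ∧ ((L + θ) ^ (1 / p) + θ) ^ p ≤ L + η := by
  have hc : Continuous fun θ : ℝ≥0∞ => ((L + θ) ^ (1 / p) + θ) ^ p := by
    refine (ENNReal.continuous_rpow_const).comp (Continuous.add ?_ continuous_id)
    exact (ENNReal.continuous_rpow_const).comp (continuous_const.add continuous_id)
  have h0 : ((L + 0) ^ (1 / p) + 0) ^ p < L + η := by
    rw [add_zero, add_zero, ← ENNReal.rpow_mul, one_div_mul_cancel hp.ne', ENNReal.rpow_one]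
    exact ENNReal.lt_add_right hL.ne hη.ne'
  have h1 := (hc.tendsto 0).eventually (gt_mem_nhds h0)
  have : (nhdsWithin (0 : ℝ≥0∞) (Ioi 0)).NeBot := nhdsGT_neBot_of_exists_gt ⟨1, one_pos⟩
  obtain ⟨θ, h2, h3⟩ := ((h1.filter_mono (nhdsWithin_le_nhds (s := Ioi 0))).and
    (self_mem_nhdsWithin : Ioi (0 : ℝ≥0∞) ∈ nhdsWithin 0 (Ioi 0))).exists
  exact ⟨θ, h3, h2.le⟩

lemma varCap_iUnion_le [SFinite μ] (hp : 1 < p) (hB : μ B < ⊤) {A : ℕ → Set X}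
    (hA : Monotone A) : varCap μ p (⋃ n, A n) B ≤ ⨆ n, varCap μ p (A n) B := by
  have hp0 : 0 < p := by linarith
  set L := ⨆ n, varCap μ p (A n) B with hLdef
  refine ENNReal.le_of_forall_pos_le_add fun η hη hL => ?_
  obtain ⟨θ, hθ, hθη⟩ := exists_add_rpow_add_rpow_le hp0 hL (ENNReal.coe_pos.2 hη)
  obtain ⟨θs, hθs, hθsum⟩ := ENNReal.exists_pos_sum_of_countable hθ.ne' ℕ
  have hδ : ∀ k, ∃ δ : ℝ≥0∞, 0 < δ ∧ ∀ (A : Set X) (f f' : X → ℝ) (g g' : X → ℝ≥0∞),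
      L ≤ varCap μ p A B + δ → Admissible μ p A B f g → Admissible μ p A B f' g' →
      ∫⁻ x, g x ^ p ∂μ ≤ L + δ → ∫⁻ x, g' x ^ p ∂μ ≤ L + δ →
      ∫⁻ x, (g' x - g x) ^ p ∂μ ≤ (θs k : ℝ≥0∞) ^ p := fun k =>
    exists_lintegral_sub_rpow_le hp hB hL
      (ENNReal.rpow_pos (ENNReal.coe_pos.2 (hθs k)) ENNReal.coe_ne_top)
  choose δ hδ0 hδ1 using hδ
  have hm : ∀ k, ∃ m, L ≤ varCap μ p (A m) B + δ k := fun k => by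
    by_contra! hcon
    have h1 : L + δ k ≤ L := by
      rw [hLdef, ENNReal.iSup_add]
      exact iSup_le fun m => (hcon m).le
    exact absurd h1 (not_le.2 (ENNReal.lt_add_right hL.ne (hδ0 k).ne'))
  choose m hm using hm
  set N : ℕ → ℕ := fun k => ∑ j ∈ Finset.range (k + 1), (m j + 1) with hN
  have hNmono : Monotone N := monotone_nat_of_le_succ fun k => by
    simp only [hN]; rw [Finset.sum_range_succ _ (k + 1)]; exact Nat.le_add_right _ _
  have hNm : ∀ k, m k ≤ N k := fun k => by
    simp only [hN]; rw [Finset.sum_range_succ]; omega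
  have hNk : ∀ k, k ≤ N k := fun k => by
    simp only [hN]; rw [Finset.sum_add_distrib]; simp; omega
  have hadm : ∀ k, ∃ f g, Admissible μ p (A (N k)) B f g ∧
      ∫⁻ x, g x ^ p ∂μ < L + min θ (min (δ k) (δ (k - 1))) := fun k =>
    exists_admissible_of_varCap_lt hp0 <| (le_iSup (fun n => varCap μ p (A n) B) (N k)).trans_lt
      (ENNReal.lt_add_right hL.ne (lt_min hθ (lt_min (hδ0 _) (hδ0 _))).ne')
  choose f g hfg hgint using hadm
  have hsub : ∀ k, ∫⁻ x, (g (k + 1) x - g k x) ^ p ∂μ ≤ (θs k : ℝ≥0∞) ^ p := fun k =>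
    hδ1 k (A (N k)) (f k) (f (k + 1)) (g k) (g (k + 1))
      ((hm k).trans (add_le_add_left (varCap_mono (hA (hNm k)) le_rfl) _)) (hfg k)
      ((hfg (k + 1)).mono (hA (hNmono (Nat.le_succ k))) le_rfl)
      ((hgint k).le.trans (add_le_add_right ((min_le_right _ _).trans (min_le_left _ _)) _))
      ((hgint (k + 1)).le.trans (add_le_add_right ((min_le_right _ _).trans (min_le_right _ _)) _))
  set H : ℕ → X → ℝ≥0∞ := fun n x => g 0 x + ∑ k ∈ Finset.range n, (g (k + 1) x - g k x) with hH
  have hgm : ∀ k, Measurable (g k) := fun k => (hfg k).measurable_grad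
  have hHm : ∀ n, Measurable (H n) := fun n =>
    (hgm 0).add (Finset.measurable_sum _ fun i _ => (hgm (i + 1)).sub (hgm i))
  have hHmono : Monotone H := monotone_nat_of_le_succ fun n x => by
    simp only [hH]; rw [Finset.sum_range_succ, ← add_assoc]; exact le_self_add
  have hgH : ∀ n x, g n x ≤ H n x := fun n x => by
    induction n with
    | zero => simp [hH]
    | succ n ih =>
      have : H (n + 1) x = H n x + (g (n + 1) x - g n x) := by
        simp only [hH]; rw [Finset.sum_range_succ, ← add_assoc]
      rw [this]
      exact le_add_tsub.trans (add_le_add_left ih _)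
  have hHint : ∀ n, ∫⁻ x, H n x ^ p ∂μ ≤ ((L + θ) ^ (1 / p) + θ) ^ p := fun n => by
    have h1 := lintegral_add_sum_rpow_le hp.le (hgm 0)
      (fun n => (hgm (n + 1)).sub (hgm n)) (c := L + θ) (θ := fun k => θs k)
      ((hgint 0).le.trans (add_le_add_right (min_le_left _ _) _)) hsub n
    have h2 : (∫⁻ x, H n x ^ p ∂μ) ^ (1 / p) ≤ (L + θ) ^ (1 / p) + θ :=
      h1.trans (add_le_add_right ((ENNReal.sum_le_tsum _).trans hθsum.le) _)
    have h3 := ENNReal.rpow_le_rpow h2 hp0.le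
    rwa [← ENNReal.rpow_mul, one_div_mul_cancel hp0.ne', ENNReal.rpow_one] at h3
  have hbdd : ∀ x, BddAbove (range fun n => f n x) := fun x =>
    ⟨1, by rintro _ ⟨n, rfl⟩; exact (hfg n).le_one x⟩
  have hF : Admissible μ p (⋃ n, A n) B (fun x => ⨆ n, f n x) (fun x => ⨆ n, H n x) :=
    { measurable := Measurable.iSup fun n => (hfg n).measurable
      nonneg := fun x => Real.iSup_nonneg fun n => (hfg n).nonneg x
      le_one := fun x => ciSup_le fun n => (hfg n).le_one x
      eq_one := fun x hx => by
        obtain ⟨n, hn⟩ := mem_iUnion.1 hx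
        refine le_antisymm (ciSup_le fun n => (hfg n).le_one x) ?_
        refine le_trans ?_ (le_ciSup (hbdd x) n)
        exact ((hfg n).eq_one x (hA (hNk n) hn)).ge
      eq_zero := fun x hx => by simp [fun n => (hfg n).eq_zero x hx]
      measurable_grad := Measurable.iSup hHm
      wug := WUG.iSup hp0 (fun n => (hfg n).wug.mono (hgH n)) hbdd }
  refine (hF.varCap_le hp0 hB).trans ?_
  simp only [iSup_rpow _ hp0]
  rw [lintegral_iSup (fun n => (hHm n).pow_const p)
    fun a b hab x => ENNReal.rpow_le_rpow (hHmono hab x) hp0.le]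
  exact iSup_le fun n => (hHint n).trans hθη

end CapacityUnion

section GoodRadius

variable {μ : Measure X} {p : ℝ} {A : Set X}

/-- The capacity of the part of `A` in `B(x,s)` relative to `B(x,t)`. -/
def ballCap (μ : Measure X) (p : ℝ) (A : Set X) (x : X) (s t : ℝ) : ℝ≥0∞ :=
  varCap μ p (A ∩ ball x s) (ball x t)

lemma ballCap_mono {A' : Set X} (hA : A' ⊆ A) {x x' : X} {s s' t t' : ℝ}
    (hs : dist x x' + s' ≤ s) (ht : dist x x' + t ≤ t') :
    ballCap μ p A' x' s' t' ≤ ballCap μ p A x s t :=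
  varCap_inter_ball_mono hA hs ht

lemma ballCap_mono_radii {A' : Set X} (hA : A' ⊆ A) {x : X} {s s' t t' : ℝ}
    (hs : s' ≤ s) (ht : t ≤ t') : ballCap μ p A' x s' t' ≤ ballCap μ p A x s t :=
  ballCap_mono hA (by simpa using hs) (by simpa using ht)

/-- The capacities `cap(A ∩ B(x,s), B(x,t))` are continuous at `(s,t) = (r,2r)`. -/
def GoodRad (μ : Measure X) (p : ℝ) (A : Set X) (x : X) (r : ℝ) : Prop :=
  (∀ c, ballCap μ p A x r (2 * r) < c → ∃ d, 0 < d ∧ ballCap μ p A x (r + d) (2 * r - d) < c) ∧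
    ∀ c, c < ballCap μ p A x r (2 * r) → ∃ d, 0 < d ∧ c < ballCap μ p A x (r - d) (2 * r + d)

lemma exists_lt_ballCap_of_lt [ProperSpace X] [IsLocallyFiniteMeasure μ] (hp : 1 < p) {x : X}
    {s t : ℝ} {c : ℝ≥0∞} (hc : c < ballCap μ p A x s t) :
    ∃ s' < s, c < ballCap μ p A x s' t := by
  have hB : μ (ball x t) < ⊤ := measure_ball_lt_top
  have hU : A ∩ ball x s = ⋃ n : ℕ, A ∩ ball x (s - 1 / ((n : ℝ) + 1)) := by
    ext y
    simp only [mem_inter_iff, mem_ball, mem_iUnion]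
    constructor
    · rintro ⟨hy, hd⟩
      obtain ⟨n, hn⟩ := exists_nat_one_div_lt (sub_pos.2 hd)
      exact ⟨n, hy, by linarith⟩
    · rintro ⟨n, hy, hd⟩
      exact ⟨hy, hd.trans (by have : 0 < 1 / ((n : ℝ) + 1) := by positivity
                              linarith)⟩
  have hmono : Monotone fun n : ℕ => A ∩ ball x (s - 1 / ((n : ℝ) + 1)) := fun a b hab =>
    inter_subset_inter_right _ (ball_subset_ball (by
      have : 1 / ((b : ℝ) + 1) ≤ 1 / ((a : ℝ) + 1) := Nat.one_div_le_one_div hab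
      linarith))
  have h1 : c < ⨆ n : ℕ, ballCap μ p A x (s - 1 / ((n : ℝ) + 1)) t := by
    refine hc.trans_le ?_
    rw [ballCap, hU]
    exact varCap_iUnion_le hp hB hmono
  obtain ⟨n, hn⟩ := lt_iSup_iff.1 h1
  exact ⟨_, by have : 0 < 1 / ((n : ℝ) + 1) := by positivity
               linarith, hn⟩

lemma countable_not_goodRad [ProperSpace X] [IsLocallyFiniteMeasure μ] (hp : 1 < p) (A : Set X)
    (x : X) : {r : ℝ | 0 < r ∧ ¬ GoodRad μ p A x r}.Countable := by
  set D₁ : Set ℝ := ⋃ q : ℚ, {s | ¬ ContinuousAt (fun s => ballCap μ p A x s q) s}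
  set D₂ : Set ℝ := ⋃ q : ℚ, {t | ¬ ContinuousAt (fun t => ballCap μ p A x q t) t}
  have h1 : D₁.Countable := countable_iUnion fun q =>
    Monotone.countable_not_continuousAt fun a b hab => ballCap_mono_radii le_rfl hab le_rfl
  have h2 : D₂.Countable := countable_iUnion fun q =>
    Antitone.countable_not_continuousAt fun a b hab => ballCap_mono_radii le_rfl le_rfl hab
  have h3 : ((fun r : ℝ => 2 * r) ⁻¹' D₂).Countable :=
    h2.preimage (mul_right_injective₀ two_ne_zero)
  refine (h1.union h3).mono ?_
  rintro r ⟨hr, hbad⟩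
  by_contra hnot
  simp only [mem_union, not_or] at hnot
  obtain ⟨hn1, hn2⟩ := hnot
  refine hbad ⟨fun c hc => ?_, fun c hc => ?_⟩
  · obtain ⟨t, ht1, ht2, htc⟩ := exists_lt_varCap_ball_lt (by linarith)
      (by linarith : r < 2 * r) (show varCap μ p (A ∩ ball x r) (ball x (2 * r)) < c from hc)
    obtain ⟨q, hq1, hq2⟩ := exists_rat_btwn ht2
    have hcont : ContinuousAt (fun s => ballCap μ p A x s q) r := by
      by_contra h; exact hn1 (mem_iUnion.2 ⟨q, h⟩)
    have hlt : ballCap μ p A x r q < c :=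
      (ballCap_mono_radii le_rfl le_rfl hq1.le).trans_lt htc
    obtain ⟨e, he, hball⟩ := Metric.eventually_nhds_iff.1 (hcont.eventually (gt_mem_nhds hlt))
    refine ⟨min (e / 2) (2 * r - q), lt_min (by positivity) (by linarith), ?_⟩
    have h4 := @hball (r + min (e / 2) (2 * r - q)) (by
      rw [Real.dist_eq, add_sub_cancel_left, abs_of_pos (lt_min (by positivity) (by linarith))]
      linarith [min_le_left (e / 2) (2 * r - q)])
    exact (ballCap_mono_radii le_rfl le_rfl
      (by linarith [min_le_right (e / 2) (2 * r - q)])).trans_lt h4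
  · obtain ⟨s, hs, hcs⟩ := exists_lt_ballCap_of_lt hp hc
    obtain ⟨q, hq1, hq2⟩ := exists_rat_btwn hs
    have hcont : ContinuousAt (fun t => ballCap μ p A x q t) (2 * r) := by
      by_contra h; exact hn2 (mem_iUnion.2 ⟨q, h⟩)
    have hlt : c < ballCap μ p A x q (2 * r) :=
      hcs.trans_le (ballCap_mono_radii le_rfl hq1.le le_rfl)
    obtain ⟨e, he, hball⟩ := Metric.eventually_nhds_iff.1 (hcont.eventually (lt_mem_nhds hlt))
    refine ⟨min (e / 2) (r - q), lt_min (by positivity) (by linarith), ?_⟩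
    have h4 := @hball (2 * r + min (e / 2) (r - q)) (by
      rw [Real.dist_eq, add_sub_cancel_left, abs_of_pos (lt_min (by positivity) (by linarith))]
      linarith [min_le_left (e / 2) (r - q)])
    exact h4.trans_le (ballCap_mono_radii le_rfl
      (by linarith [min_le_right (e / 2) (r - q)]) le_rfl)

lemma GoodRad.continuousAt {x : X} {r : ℝ} (h : GoodRad μ p A x r) :
    ContinuousAt (fun z : X × ℝ => ballCap μ p A z.1 z.2 (2 * z.2)) (x, r) := by
  have hnear : ∀ d : ℝ, 0 < d → ∀ᶠ z : X × ℝ in nhds (x, r),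
      dist x z.1 < d / 4 ∧ |z.2 - r| < d / 4 := fun d hd => by
    have h1 : ∀ᶠ z : X × ℝ in nhds (x, r), dist z (x, r) < d / 4 :=
      Metric.ball_mem_nhds _ (by positivity)
    filter_upwards [h1] with z hz
    rw [Prod.dist_eq, max_lt_iff] at hz
    exact ⟨by rw [dist_comm]; exact hz.1, by rw [← Real.dist_eq]; exact hz.2⟩
  refine tendsto_order.2 ⟨fun c hc => ?_, fun c hc => ?_⟩
  · obtain ⟨d, hd, hcd⟩ := h.2 c hc
    filter_upwards [hnear d hd] with z hz
    have h2 := abs_lt.1 hz.2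
    refine hcd.trans_le (ballCap_mono le_rfl ?_ ?_) <;> rw [dist_comm] <;> linarith [hz.1]
  · obtain ⟨d, hd, hcd⟩ := h.1 c hc
    filter_upwards [hnear d hd] with z hz
    have h2 := abs_lt.1 hz.2
    refine lt_of_le_of_lt (ballCap_mono le_rfl ?_ ?_) hcd <;> linarith [hz.1]

lemma thinIntegrand_eq (A : Set X) (x : X) (r : ℝ) :
    thinIntegrand μ p A x r = if ballCap μ p univ x r (2 * r) = 0 then 1
      else (ballCap μ p A x r (2 * r) / ballCap μ p univ x r (2 * r)) ^ (1 / (p - 1)) := by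
  simp [thinIntegrand, ballCap]

lemma thinIntegrand_mono (hp : 1 < p) {A' : Set X} (hA : A' ⊆ A) (x : X) (r : ℝ) :
    thinIntegrand μ p A' x r ≤ thinIntegrand μ p A x r := by
  rw [thinIntegrand_eq, thinIntegrand_eq]
  split_ifs with h
  · exact le_rfl
  · exact ENNReal.rpow_le_rpow (ENNReal.div_le_div_right
      (ballCap_mono_radii hA le_rfl le_rfl) _) (one_div_nonneg.2 (by linarith))

lemma thinIntegrand_le_one (hp : 1 < p) (A : Set X) (x : X) (r : ℝ) :
    thinIntegrand μ p A x r ≤ 1 := by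
  rw [thinIntegrand_eq]
  split_ifs with h
  · exact le_rfl
  · refine ENNReal.rpow_le_one ?_ (one_div_nonneg.2 (by linarith))
    exact (ENNReal.div_le_div_right
      (ballCap_mono_radii (subset_univ A) le_rfl le_rfl) _).trans ENNReal.div_self_le_one

lemma ballCap_lt_top [ProperSpace X] [IsLocallyFiniteMeasure μ] (hp : 0 < p) (A : Set X) (x : X)
    {s t : ℝ} (hst : s < t) : ballCap μ p A x s t < ⊤ :=
  varCap_ball_lt_top hp A x hst

lemma continuousAt_thinIntegrand [ProperSpace X] [IsLocallyFiniteMeasure μ] (hp : 1 < p) {x : X}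
    {r : ℝ} (hr : 0 < r) (hA : GoodRad μ p A x r) (hu : GoodRad μ p univ x r)
    (h0 : ballCap μ p univ x r (2 * r) ≠ 0) :
    ContinuousAt (fun z : X × ℝ => thinIntegrand μ p A z.1 z.2) (x, r) := by
  have hc := hu.continuousAt
  have hpos : ∀ᶠ z : X × ℝ in nhds (x, r), ballCap μ p univ z.1 z.2 (2 * z.2) ≠ 0 :=
    hc.eventually_ne h0
  have h1 : ContinuousAt (fun z : X × ℝ => (ballCap μ p A z.1 z.2 (2 * z.2) /
      ballCap μ p univ z.1 z.2 (2 * z.2)) ^ (1 / (p - 1))) (x, r) := by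
    refine (ENNReal.continuous_rpow_const).continuousAt.comp_of_eq ?_ rfl
    exact ENNReal.Tendsto.div hA.continuousAt (Or.inr h0) hc
      (Or.inl (ballCap_lt_top (by linarith) _ _ (by linarith)).ne)
  refine h1.congr ?_
  filter_upwards [hpos] with z hz
  rw [thinIntegrand_eq, if_neg hz]

lemma aemeasurable_thinIntegrand [ProperSpace X] [IsLocallyFiniteMeasure μ] (hp : 1 < p)
    (A : Set X) (x : X) {r₀ : ℝ}
    (h0 : ∀ r, 0 < r → r < r₀ → ballCap μ p univ x r (2 * r) ≠ 0) :
    AEMeasurable (fun r => thinIntegrand μ p A x r) (volume.restrict (Ioo 0 r₀)) := by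
  set D : Set ℝ := {r : ℝ | 0 < r ∧ ¬ GoodRad μ p A x r} ∪ {r : ℝ | 0 < r ∧ ¬ GoodRad μ p univ x r}
  have hD : D.Countable := (countable_not_goodRad hp A x).union (countable_not_goodRad hp univ x)
  have h1 : AEMeasurable (fun r => thinIntegrand μ p A x r) (volume.restrict (Ioo 0 r₀ \ D)) := by
    refine ContinuousOn.aemeasurable (fun r hr => ?_) (measurableSet_Ioo.diff hD.measurableSet)
    have hg : GoodRad μ p A x r := by
      by_contra h; exact hr.2 (Or.inl ⟨hr.1.1, h⟩)
    have hg' : GoodRad μ p univ x r := by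
      by_contra h; exact hr.2 (Or.inr ⟨hr.1.1, h⟩)
    have h2 := continuousAt_thinIntegrand hp hr.1.1 hg hg' (h0 r hr.1.1 hr.1.2)
    exact (h2.comp (f := fun r : ℝ => (x, r)) (by fun_prop)).continuousWithinAt
  rwa [Measure.restrict_congr_set (sdiff_null_ae_eq_self (hD.measure_zero _))] at h1

end GoodRadius

section Positivity

variable {μ : Measure X} {p : ℝ}

lemma exists_wug_zero_of_varCap_eq_zero [SFinite μ] (hp : 0 < p) {A B : Set X}
    (h0 : varCap μ p A B = 0) :
    ∃ f : X → ℝ, Measurable f ∧ (∀ x ∈ A, f x = 1) ∧ (∀ x ∉ B, f x = 0) ∧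
      WUG μ p f (fun _ => 0) univ := by
  classical
  set c : ℕ → ℝ≥0∞ := fun m => (2 : ℝ≥0∞) ^ m with hcdef
  have hc0 : ∀ m, c m ≠ 0 := fun m => by simp [hcdef]
  have hct : ∀ m, c m ≠ ⊤ := fun m => by simp [hcdef]
  have hadm : ∀ m : ℕ, ∃ f g, Admissible μ p A B f g ∧
      ∫⁻ x, g x ^ p ∂μ < (2 : ℝ≥0∞)⁻¹ ^ m / c m ^ p := fun m =>
    exists_admissible_of_varCap_lt hp <| by
      rw [h0]
      exact ENNReal.div_pos (by simp) (ENNReal.rpow_ne_top_of_nonneg hp.le (hct m))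
  choose f g hfg hgint using hadm
  set S : Set X := {x | Tendsto (fun m => f m x) atTop (nhds 1)} with hS
  have hSm : MeasurableSet S := measurableSet_tendsto _ fun m => (hfg m).measurable
  refine ⟨S.indicator fun _ => 1, measurable_const.indicator hSm, fun x hx => ?_,
    fun x hx => ?_, ?_⟩
  · refine indicator_of_mem (?_ : x ∈ S) _
    simp only [hS, mem_ofPred_eq, fun m => (hfg m).eq_one x hx]
    exact tendsto_const_nhds
  · refine indicator_of_notMem (fun h : x ∈ S => ?_) _
    simp only [hS, mem_ofPred_eq, fun m => (hfg m).eq_zero x hx] at h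
    exact zero_ne_one (tendsto_nhds_unique tendsto_const_nhds h)
  have hgm : ∀ m, Measurable (g m) := fun m => (hfg m).measurable_grad
  have hρ : PAECurve μ p fun γ => curveLint γ (fun x => ⨆ m, c m * g m x) < ⊤ := by
    refine ⟨fun x => ⨆ m, c m * g m x, Measurable.iSup fun m => (hgm m).const_mul _, ?_,
      fun γ h => h⟩
    refine (lintegral_iSup_rpow_le μ hp _ fun m => (hgm m).const_mul _).trans_lt ?_
    have h1 : ∀ m, ∫⁻ x, (c m * g m x) ^ p ∂μ ≤ (2 : ℝ≥0∞)⁻¹ ^ m := fun m => by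
      rw [lintegral_const_mul_rpow μ hp (hgm m)]
      exact ENNReal.mul_le_of_le_div' (hgint m).le
    refine (ENNReal.tsum_le_tsum h1).trans_lt ?_
    rw [ENNReal.tsum_geometric]
    simp
  have hall := PAECurve.all hp fun m => (hfg m).wug
  refine (hρ.and hp hall).mono fun γ hγ hU s t hs hst ht => ?_
  obtain ⟨hγ1, hγ2⟩ := hγ
  have hlim : Tendsto (fun m => f m (γ.path s) - f m (γ.path t)) atTop (nhds 0) := by
    have hb : ∀ m, ENNReal.ofReal |f m (γ.path s) - f m (γ.path t)| ≤
        (2 : ℝ≥0∞)⁻¹ ^ m * curveLint γ (fun x => ⨆ m, c m * g m x) := fun m => by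
      refine (hγ2 m hU s t hs hst ht).trans ?_
      refine (lintegral_mono_set (Icc_subset_Icc hs ht)).trans ?_
      rw [← curveLint_eq_path, ← ENNReal.inv_pow, mul_comm, ← div_eq_mul_inv,
        ENNReal.le_div_iff_mul_le (Or.inl (hc0 m)) (Or.inl (hct m)), mul_comm,
        ← curveLint_const_mul (hct m)]
      exact curveLint_mono fun x => le_iSup (fun m => c m * g m x) m
    have h1 : Tendsto (fun m : ℕ => (2 : ℝ≥0∞)⁻¹ ^ m *
        curveLint γ (fun x => ⨆ m, c m * g m x)) atTop (nhds 0) := by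
      have := ENNReal.Tendsto.mul_const (b := curveLint γ (fun x => ⨆ m, c m * g m x))
        (ENNReal.tendsto_pow_atTop_nhds_zero_of_lt_one (r := 2⁻¹) (by simp)) (Or.inr hγ1.ne)
      simpa using this
    have h2 := tendsto_of_tendsto_of_tendsto_of_le_of_le tendsto_const_nhds h1
      (fun m => zero_le) hb
    have h3 := (ENNReal.tendsto_toReal ENNReal.zero_ne_top).comp h2
    refine (tendsto_zero_iff_abs_tendsto_zero _).2 ?_
    simpa [Function.comp_def] using h3
  have hiff : γ.path s ∈ S ↔ γ.path t ∈ S := by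
    constructor
    · intro h
      have := Tendsto.sub (show Tendsto (fun m => f m (γ.path s)) atTop (nhds 1) from h) hlim
      simpa [hS] using this
    · intro h
      have := Tendsto.add (show Tendsto (fun m => f m (γ.path t)) atTop (nhds 1) from h) hlim
      simpa [hS] using this
  by_cases h : γ.path s ∈ S
  · simp [indicator_of_mem h, indicator_of_mem (hiff.1 h)]
  · simp [indicator_of_notMem h, indicator_of_notMem (fun h' => h (hiff.2 h'))]

lemma ballCap_univ_ne_zero [ProperSpace X] [IsLocallyFiniteMeasure μ] (hp : 1 < p)
    (hpos : ∀ (x : X) (r : ℝ), 0 < r → 0 < μ (ball x r)) (hPI : PoincareInequality μ p)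
    {x y : X} {r : ℝ} (hr : 0 < r) (hxy : 2 * r < dist x y) :
    ballCap μ p univ x r (2 * r) ≠ 0 := by
  have hp0 : 0 < p := by linarith
  intro h0
  obtain ⟨f, hfm, hf1, hf0, hf⟩ := exists_wug_zero_of_varCap_eq_zero hp0 h0
  obtain ⟨C, -, lam, hlam, hC⟩ := hPI
  set R := dist x y + 1 + r with hR
  have hRp : 0 < R := by positivity
  have h1 := hC x R hRp f (fun _ => 0) hfm measurable_const (hf.isWeakUpperGradientOn hp0)
  simp only [ENNReal.zero_rpow_of_pos hp0, lintegral_zero, mul_zero,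
    ENNReal.zero_rpow_of_pos (one_div_pos.2 hp0)] at h1
  set a := ⨍ z in ball x R, f z ∂μ
  have h2 : ∫⁻ z in ball x R, ENNReal.ofReal |f z - a| ∂μ = 0 := by
    rcases mul_eq_zero.1 (le_antisymm h1 zero_le) with h | h
    · exact absurd (ENNReal.inv_eq_zero.1 h) measure_ball_lt_top.ne
    · exact h
  rw [lintegral_eq_zero_iff (by fun_prop)] at h2
  have hfind : ∀ (z : X) (s : ℝ), 0 < s → ball z s ⊆ ball x R → ∃ w ∈ ball z s, f w = a := by
    intro z s hs hsub
    by_contra! hcon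
    have h3 : ∀ᵐ w ∂(μ.restrict (ball z s)), ENNReal.ofReal |f w - a| = 0 :=
      ae_restrict_of_ae_restrict_of_subset hsub h2
    have h4 : ∀ᵐ w ∂(μ.restrict (ball z s)), False := by
      filter_upwards [h3, ae_restrict_mem measurableSet_ball] with w hw hwb
      rw [ENNReal.ofReal_eq_zero, abs_nonpos_iff, sub_eq_zero] at hw
      exact hcon w hwb hw
    rw [ae_iff] at h4
    simp only [not_false_eq_true, Measure.restrict_apply_univ, Set.ofPred_true] at h4
    exact (hpos z s hs).ne' h4
  obtain ⟨w, hw, hwa⟩ := hfind x r hr (ball_subset_ball (by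
    have := dist_nonneg (x := x) (y := y); linarith))
  have hsp : 0 < min 1 (dist x y - 2 * r) := lt_min one_pos (by linarith)
  obtain ⟨w', hw', hwa'⟩ := hfind y (min 1 (dist x y - 2 * r)) hsp (ball_subset_ball' (by
    rw [dist_comm y x]; linarith [min_le_left 1 (dist x y - 2 * r)]))
  have e1 : f w = 1 := hf1 w ⟨mem_univ _, hw⟩
  have e2 : f w' = 0 := hf0 w' fun h => by
    have h5 := dist_triangle x w' y
    rw [mem_ball] at h hw'
    rw [dist_comm x w'] at h5
    linarith [min_le_right 1 (dist x y - 2 * r)]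
  linarith

lemma exists_forall_ballCap_univ_ne_zero [ProperSpace X] [IsLocallyFiniteMeasure μ]
    [Nontrivial X] (hp : 1 < p) (hpos : ∀ (x : X) (r : ℝ), 0 < r → 0 < μ (ball x r))
    (hPI : PoincareInequality μ p) :
    ∃ r₀, 0 < r₀ ∧ r₀ < 1 ∧
      ∀ (x : X) (r : ℝ), 0 < r → r < r₀ → ballCap μ p univ x r (2 * r) ≠ 0 := by
  obtain ⟨a, b, hab⟩ := exists_pair_ne X
  have hd : 0 < dist a b := dist_pos.2 hab
  refine ⟨min (1 / 2) (dist a b / 8), lt_min (by norm_num) (by positivity),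
    (min_le_left _ _).trans_lt (by norm_num), fun x r hr hr0 => ?_⟩
  have h1 := hr0.trans_le (min_le_right _ _)
  have h2 := dist_triangle a x b
  rw [dist_comm a x] at h2
  rcases le_total (dist x a) (dist x b) with h | h
  · exact ballCap_univ_ne_zero hp hpos hPI hr (y := b) (by linarith)
  · exact ballCap_univ_ne_zero hp hpos hPI hr (y := a) (by linarith)

lemma thin_iff_of_pos (hp : 1 < p) {E : Set X} {x : X} {r₀ : ℝ} (h0 : 0 < r₀) (h1 : r₀ < 1) :
    Thin μ p E x ↔
      ∫⁻ r in Ioo 0 r₀, thinIntegrand μ p E x r / ENNReal.ofReal r < ⊤ := by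
  refine ⟨fun h => (lintegral_mono_set (Ioo_subset_Ioo_right h1.le)).trans_lt h, fun h => ?_⟩
  have hU : Ioo (0 : ℝ) 1 = Ioo 0 r₀ ∪ Ico r₀ 1 := (Ioo_union_Ico_eq_Ioo h0 h1.le).symm
  rw [Thin, hU]
  refine (lintegral_union_le _ _ _).trans_lt (ENNReal.add_lt_top.2 ⟨h, ?_⟩)
  refine (setLIntegral_mono (g := fun _ => (ENNReal.ofReal r₀)⁻¹) measurable_const
    fun r hr => ?_).trans_lt ?_
  · rw [div_eq_mul_inv, ← one_mul (ENNReal.ofReal r₀)⁻¹]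
    exact mul_le_mul' (thinIntegrand_le_one hp _ _ _)
      (ENNReal.inv_le_inv.2 (ENNReal.ofReal_le_ofReal hr.1))
  · rw [setLIntegral_const]
    exact ENNReal.mul_lt_top (ENNReal.inv_lt_top.2 (ENNReal.ofReal_pos.2 h0)) (by simp)

end Positivity

section Thickening

variable {μ : Measure X} {p : ℝ} {A B : Set X}

lemma exists_isOpen_varCap_lt [ProperSpace X] [IsLocallyFiniteMeasure μ] (hp : 1 < p)
    (hB : IsOpen B) (hμB : μ B < ⊤) {c : ℝ≥0∞} (hc : varCap μ p A B < c) :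
    ∃ O, IsOpen O ∧ A ⊆ O ∧ varCap μ p O B < c := by
  have hp0 : 0 < p := by linarith
  obtain ⟨f, g, hfg, hgint⟩ := exists_admissible_of_varCap_lt hp0 hc
  obtain ⟨r, hr, hrc⟩ := ENNReal.lt_iff_exists_add_pos_lt.1 hgint
  obtain ⟨ε, hε, he⟩ := exists_energy_add_le (V := univ) (μ := μ) hp.le hfg.measurable_grad
    (by simpa using hgint.trans_le le_top) (ENNReal.coe_ne_zero.2 hr.ne')
  simp only [Measure.restrict_univ] at he
  obtain ⟨F, hF, hfF, hF1, hFZ, -, e, hem, hew, hei⟩ :=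
    exists_lowerSemicontinuous_ge hp hfg.measurable hfg.nonneg hfg.le_one hfg.wug
      hfg.measurable_grad (hgint.trans_le le_top) hB.isClosed_compl (a := 0)
      (fun x hx => hfg.eq_zero x hx) (by simpa using hμB) hε.ne'
  set E := ∫⁻ x, (g x + e x) ^ p ∂μ
  have hE : E < c := (he e hem hei).trans_lt hrc
  have hFw : WUG μ p F (fun x => g x + e x) univ :=
    hfg.wug.add hp0 hew hfg.measurable_grad fun x y => by
      have := abs_add_le (f x - f y) ((F x - f x) - (F y - f y))
      rwa [show f x - f y + (F x - f x - (F y - f y)) = F x - F y by ring] at this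
  have hlim : Tendsto (fun t : ℝ => ENNReal.ofReal |1 + t| ^ p * E) (nhdsWithin 0 (Ioi 0))
      (nhds E) := by
    have h1 : Continuous fun t : ℝ => ENNReal.ofReal |1 + t| ^ p :=
      (ENNReal.continuous_rpow_const).comp
        (ENNReal.continuous_ofReal.comp (by fun_prop))
    have h2 := ENNReal.Tendsto.mul_const (b := E) (h1.tendsto 0) (Or.inr (hE.trans_le le_top).ne)
    simp only [add_zero, abs_one, ENNReal.ofReal_one, ENNReal.one_rpow, one_mul] at h2
    exact h2.mono_left nhdsWithin_le_nhds
  obtain ⟨t, ht, -, htc⟩ := exists_pos_of_eventually_nhdsGT (hlim.eventually (gt_mem_nhds hE))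
  refine ⟨{x | 1 / (1 + t) < F x}, hF.isOpen_preimage _, fun x hx => ?_, ?_⟩
  · show 1 / (1 + t) < F x
    have h1 : 1 / (1 + t) < 1 := by rw [div_lt_one (by linarith)]; linarith
    have h2 := hfF x
    rw [hfg.eq_one x hx] at h2
    linarith
  have hF0 : ∀ x, 0 ≤ F x := fun x => (hfg.nonneg x).trans (hfF x)
  have hadm : Admissible μ p {x | 1 / (1 + t) < F x} B (fun x => min ((1 + t) * F x) 1)
      (fun x => ENNReal.ofReal |1 + t| * (g x + e x)) :=
    { measurable := (hF.measurable.const_mul _).min measurable_const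
      nonneg := fun x => le_min (mul_nonneg (by linarith) (hF0 x)) zero_le_one
      le_one := fun x => min_le_right _ _
      eq_one := fun x hx => by
        have hx' : 1 / (1 + t) < F x := hx
        rw [div_lt_iff₀ (by linarith)] at hx'
        exact min_eq_right (by linarith)
      eq_zero := fun x hx => by
        rw [hFZ x hx, hfg.eq_zero x hx]; simp
      measurable_grad := (hfg.measurable_grad.add hem).const_mul _
      wug := (hFw.const_mul (1 + t)).of_abs_le fun x y => abs_min_const_sub_le _ _ _ }
  refine (hadm.varCap_le hp0 hμB).trans_lt ?_
  rwa [lintegral_const_mul_rpow μ hp0 (ρ := fun x => g x + e x) (hfg.measurable_grad.add hem)]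

lemma exists_ballCap_union_cthickening_lt [ProperSpace X] [IsLocallyFiniteMeasure μ] (hp : 1 < p)
    {C : Set X} (hC : IsCompact C) (hCA : C ⊆ A) {x : X} {s s' t : ℝ} (hs : s' < s) {c : ℝ≥0∞}
    (hc : ballCap μ p A x s t < c) :
    ∃ ε, 0 < ε ∧ ballCap μ p (A ∪ cthickening ε C) x s' t < c := by
  obtain ⟨O, hO, hAO, hOc⟩ := exists_isOpen_varCap_lt hp isOpen_ball measure_ball_lt_top hc
  have hK : IsCompact (C ∩ closedBall x ((s' + s) / 2)) := hC.inter_right isClosed_closedBall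
  have hKO : C ∩ closedBall x ((s' + s) / 2) ⊆ O := fun y hy =>
    hAO ⟨hCA hy.1, (mem_closedBall.1 hy.2).trans_lt (by linarith)⟩
  obtain ⟨δ, hδ, hδO⟩ := hK.exists_cthickening_subset_open hO hKO
  refine ⟨min δ ((s - s') / 2), lt_min hδ (by linarith), ?_⟩
  refine (varCap_mono ?_ le_rfl).trans_lt hOc
  rintro y ⟨hy | hy, hyb⟩
  · exact hAO ⟨hy, ball_subset_ball hs.le hyb⟩
  · rw [hC.cthickening_eq_biUnion_closedBall (lt_min hδ (by linarith)).le] at hy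
    obtain ⟨z, hz, hyz⟩ := mem_iUnion₂.1 hy
    have h1 := le_min_iff.1 (mem_closedBall.1 hyz)
    refine hδO (mem_cthickening_of_dist_le y z δ _ ⟨hz, ?_⟩ h1.1)
    rw [mem_closedBall]
    rw [mem_ball] at hyb
    have := dist_triangle z y x
    rw [dist_comm z y] at this
    linarith [h1.2]

lemma GoodRad.tendsto_union_cthickening [ProperSpace X] [IsLocallyFiniteMeasure μ] (hp : 1 < p)
    {C : Set X} (hC : IsCompact C) (hCA : C ⊆ A) {x : X} {r : ℝ} (h : GoodRad μ p A x r)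
    {xs : ℕ → X} (hx : Tendsto xs atTop (nhds x)) {ε : ℕ → ℝ} (hε : Tendsto ε atTop (nhds 0)) :
    Tendsto (fun n => ballCap μ p (A ∪ cthickening (ε n) C) (xs n) r (2 * r)) atTop
      (nhds (ballCap μ p A x r (2 * r))) := by
  refine tendsto_order.2 ⟨fun c hc => ?_, fun c hc => ?_⟩
  · have h1 := (h.continuousAt.comp_of_eq (f := fun y : X => (y, r)) (x := x)
      (by fun_prop) rfl).tendsto.comp hx
    filter_upwards [h1.eventually (lt_mem_nhds hc)] with n hn
    exact hn.trans_le (ballCap_mono_radii subset_union_left le_rfl le_rfl)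
  · obtain ⟨d, hd, hcd⟩ := h.1 c hc
    obtain ⟨e, he, hce⟩ := exists_ballCap_union_cthickening_lt hp hC hCA
      (show r + d / 2 < r + d by linarith) hcd
    have h1 : ∀ᶠ n in atTop, dist (xs n) x < d / 2 := by
      have := tendsto_iff_dist_tendsto_zero.1 hx
      exact this.eventually (gt_mem_nhds (by positivity))
    filter_upwards [h1, hε.eventually (gt_mem_nhds he)] with n hn hn'
    refine lt_of_le_of_lt (ballCap_mono
      (union_subset_union_right _ (cthickening_mono hn'.le _)) ?_ ?_) hce <;>
    rw [dist_comm] <;> linarith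

lemma tendsto_thinIntegrand_union_cthickening [ProperSpace X] [IsLocallyFiniteMeasure μ]
    (hp : 1 < p) {C : Set X} (hC : IsCompact C) (hCA : C ⊆ A) {x : X} {r : ℝ} (hr : 0 < r)
    (hA : GoodRad μ p A x r) (hu : GoodRad μ p univ x r)
    (h0 : ∀ y, ballCap μ p univ y r (2 * r) ≠ 0)
    {xs : ℕ → X} (hx : Tendsto xs atTop (nhds x)) {ε : ℕ → ℝ} (hε : Tendsto ε atTop (nhds 0)) :
    Tendsto (fun n => thinIntegrand μ p (A ∪ cthickening (ε n) C) (xs n) r) atTop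
      (nhds (thinIntegrand μ p A x r)) := by
  simp only [thinIntegrand_eq, if_neg (h0 _)]
  refine ((ENNReal.continuous_rpow_const).tendsto _).comp ?_
  have hcu := (hu.continuousAt.comp_of_eq (f := fun y : X => (y, r)) (x := x)
      (by fun_prop) rfl).tendsto.comp hx
  exact ENNReal.Tendsto.div (hA.tendsto_union_cthickening hp hC hCA hx hε) (Or.inr (h0 x)) hcu
    (Or.inl (ballCap_lt_top (by linarith) _ _ (by linarith)).ne)

lemma exists_forall_lintegral_thinIntegrand_le [ProperSpace X] [IsLocallyFiniteMeasure μ]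
    (hp : 1 < p) {r₀ : ℝ}
    (h0 : ∀ (y : X) (r : ℝ), 0 < r → r < r₀ → ballCap μ p univ y r (2 * r) ≠ 0)
    {C Y : Set X} (hC : IsCompact C) (hCA : C ⊆ A) (hY : IsCompact Y) {a : ℝ} (ha : 0 < a)
    {δ : ℝ≥0∞} (hδ : 0 < δ) :
    ∃ ε, 0 < ε ∧ ∀ x ∈ Y,
      ∫⁻ r in Ioo a r₀, thinIntegrand μ p (A ∪ cthickening ε C) x r / ENNReal.ofReal r ≤
        (∫⁻ r in Ioo a r₀, thinIntegrand μ p A x r / ENNReal.ofReal r) + δ := by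
  by_contra! hcon
  choose! x hxY hx using fun n : ℕ => hcon (1 / ((n : ℝ) + 1)) (by positivity)
  obtain ⟨y, -, φ, hφ, hlim⟩ := hY.tendsto_subseq hxY
  set ε : ℕ → ℝ := fun n => 1 / ((φ n : ℝ) + 1) with hε
  have hε0 : Tendsto ε atTop (nhds 0) :=
    (tendsto_one_div_add_atTop_nhds_zero_nat (𝕜 := ℝ)).comp hφ.tendsto_atTop
  have hεn : Tendsto (fun n : ℕ => (0 : ℝ)) atTop (nhds 0) := tendsto_const_nhds
  set ν := (volume : Measure ℝ).restrict (Ioo a r₀) with hν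
  have hmeas : ∀ (A : Set X) (x : X), AEMeasurable
      (fun r => thinIntegrand μ p A x r / ENNReal.ofReal r) ν := fun A x =>
    (((aemeasurable_thinIntegrand hp A x (h0 x)).mono_measure
      (Measure.restrict_mono (Ioo_subset_Ioo_left ha.le) le_rfl))).div
      (by fun_prop)
  set F : ℕ → ℝ → ℝ≥0∞ := fun n r =>
    thinIntegrand μ p (A ∪ cthickening (ε n) C) (x (φ n)) r / ENNReal.ofReal r -
      thinIntegrand μ p A (x (φ n)) r / ENNReal.ofReal r with hF
  have hFm : ∀ n, AEMeasurable (F n) ν := fun n => (hmeas _ _).sub (hmeas _ _)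
  have hFb : ∀ n, F n ≤ᵐ[ν] fun _ => (ENNReal.ofReal a)⁻¹ := fun n => by
    filter_upwards [ae_restrict_mem measurableSet_Ioo] with r hr
    refine tsub_le_self.trans ?_
    rw [div_eq_mul_inv, ← one_mul (ENNReal.ofReal a)⁻¹]
    exact mul_le_mul' (thinIntegrand_le_one hp _ _ _)
      (ENNReal.inv_le_inv.2 (ENNReal.ofReal_le_ofReal hr.1.le))
  have hfin : ∫⁻ _, (ENNReal.ofReal a)⁻¹ ∂ν ≠ ⊤ := by
    rw [lintegral_const]
    refine ENNReal.mul_ne_top (ENNReal.inv_ne_top.2 (ENNReal.ofReal_pos.2 ha).ne') ?_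
    simp [hν]
  have hgood : ∀ᵐ r ∂ν, GoodRad μ p A y r ∧ GoodRad μ p univ y r ∧ r ∈ Ioo a r₀ := by
    have hb : ∀ A : Set X, ∀ᵐ r : ℝ, ¬ (0 < r ∧ ¬ GoodRad μ p A y r) := fun A =>
      (countable_not_goodRad hp A y).ae_notMem _
    filter_upwards [ae_restrict_of_ae (hb A), ae_restrict_of_ae (hb univ),
      ae_restrict_mem measurableSet_Ioo] with r h1 h2 hr
    have hr0 : 0 < r := ha.trans hr.1
    exact ⟨by by_contra h; exact h1 ⟨hr0, h⟩, by by_contra h; exact h2 ⟨hr0, h⟩, hr⟩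
  have hFl : ∀ᵐ r ∂ν, Tendsto (fun n => F n r) atTop (nhds 0) := by
    filter_upwards [hgood] with r hr
    obtain ⟨h1, h2, hr⟩ := hr
    have hr0 : 0 < r := ha.trans hr.1
    have hor := (ENNReal.ofReal_pos.2 hr0).ne'
    have t1 := tendsto_thinIntegrand_union_cthickening hp hC hCA hr0 h1 h2
      (fun z => h0 z r hr0 hr.2) hlim hε0
    have t2 : Tendsto (fun n => thinIntegrand μ p A (x (φ n)) r) atTop
        (nhds (thinIntegrand μ p A y r)) :=
      ((continuousAt_thinIntegrand hp hr0 h1 h2 (h0 y r hr0 hr.2)).comp_of_eq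
        (f := fun z : X => (z, r)) (x := y) (by fun_prop) rfl).tendsto.comp hlim
    have hne : thinIntegrand μ p A y r / ENNReal.ofReal r ≠ ⊤ :=
      ENNReal.div_ne_top ((thinIntegrand_le_one hp _ _ _).trans_lt one_lt_top).ne hor
    have t3 := ENNReal.Tendsto.sub (ENNReal.Tendsto.div_const t1 (Or.inr hor))
      (ENNReal.Tendsto.div_const t2 (Or.inr hor)) (Or.inl hne)
    rwa [tsub_self] at t3
  have hI := tendsto_lintegral_of_dominated_convergence' _ hFm hFb hfin hFl
  rw [lintegral_zero] at hI
  obtain ⟨n, hn⟩ := (hI.eventually (gt_mem_nhds hδ)).exists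
  refine absurd (hx (φ n)) (not_lt.2 ?_)
  calc _ ≤ ∫⁻ r, (thinIntegrand μ p A (x (φ n)) r / ENNReal.ofReal r + F n r) ∂ν :=
        lintegral_mono fun r => le_add_tsub
    _ = _ := lintegral_add_left' (hmeas _ _) _
    _ ≤ _ := add_le_add_right hn.le _

end Thickening

section ThinLimit

variable {μ : Measure X} {p : ℝ} {A M : Set X} {x : X}

lemma thinIntegrand_union_of_disjoint {r : ℝ} (h : Disjoint M (ball x r)) :
    thinIntegrand μ p (A ∪ M) x r = thinIntegrand μ p A x r := by
  have : (A ∪ M) ∩ ball x r = A ∩ ball x r := by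
    rw [union_inter_distrib_right, h.inter_eq, union_empty]
  rw [thinIntegrand, thinIntegrand, this]

lemma exists_disjoint_ball_of_isClosed (hM : IsClosed M) (hx : x ∉ M) :
    ∃ a, 0 < a ∧ Disjoint M (ball x a) := by
  obtain ⟨a, ha, hsub⟩ := Metric.isOpen_iff.1 hM.isOpen_compl x hx
  exact ⟨a, ha, disjoint_left.2 fun y hy hya => hsub hya hy⟩

lemma Thin.union_isClosed (hp : 1 < p) (h : Thin μ p A x) (hM : IsClosed M) (hx : x ∉ M) :
    Thin μ p (A ∪ M) x := by
  obtain ⟨a, ha, hdis⟩ := exists_disjoint_ball_of_isClosed hM hx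
  refine lt_of_le_of_lt (setLIntegral_mono' (g := fun r =>
    thinIntegrand μ p A x r / ENNReal.ofReal r + (ENNReal.ofReal a)⁻¹) measurableSet_Ioo
    fun r hr => ?_) ?_
  · rcases le_or_gt r a with hra | hra
    · rw [thinIntegrand_union_of_disjoint (hdis.mono_right (ball_subset_ball hra))]
      exact le_self_add
    · refine le_trans ?_ le_add_self
      rw [div_eq_mul_inv, ← one_mul (ENNReal.ofReal a)⁻¹]
      exact mul_le_mul' (thinIntegrand_le_one hp _ _ _)
        (ENNReal.inv_le_inv.2 (ENNReal.ofReal_le_ofReal hra.le))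
  · rw [lintegral_add_right _ measurable_const]
    refine ENNReal.add_lt_top.2 ⟨h, ?_⟩
    rw [setLIntegral_const]
    exact ENNReal.mul_lt_top (ENNReal.inv_lt_top.2 (ENNReal.ofReal_pos.2 ha)) (by simp)

lemma lintegral_thinIntegrand_union_le {a r₀ : ℝ} {δ : ℝ≥0∞} (ha : 0 < a)
    (hdis : Disjoint M (ball x a))
    (h : ∫⁻ r in Ioo a r₀, thinIntegrand μ p (A ∪ M) x r / ENNReal.ofReal r ≤
      (∫⁻ r in Ioo a r₀, thinIntegrand μ p A x r / ENNReal.ofReal r) + δ) :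
    ∫⁻ r in Ioo 0 r₀, thinIntegrand μ p (A ∪ M) x r / ENNReal.ofReal r ≤
      (∫⁻ r in Ioo 0 r₀, thinIntegrand μ p A x r / ENNReal.ofReal r) + δ := by
  have hdiff : Ioo 0 r₀ \ Iic a = Ioo a r₀ := by
    ext r
    simp only [Set.mem_sdiff, mem_Ioo, mem_Iic, not_le]
    exact ⟨fun h => ⟨h.2, h.1.2⟩, fun h => ⟨⟨ha.trans h.1, h.2⟩, h.1⟩⟩
  rw [← lintegral_inter_add_sdiff _ (Ioo 0 r₀) (measurableSet_Iic (a := a)),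
    ← lintegral_inter_add_sdiff (fun r => thinIntegrand μ p A x r / ENNReal.ofReal r)
      (Ioo 0 r₀) (measurableSet_Iic (a := a)), hdiff, add_assoc]
  refine add_le_add (setLIntegral_congr_fun (measurableSet_Ioo.inter measurableSet_Iic)
    fun r hr => ?_).le h
  rw [thinIntegrand_union_of_disjoint (hdis.mono_right (ball_subset_ball hr.2))]

lemma thinIntegrand_iUnion_le [ProperSpace X] [IsLocallyFiniteMeasure μ] (hp : 1 < p)
    {A : ℕ → Set X} (hA : Monotone A) (x : X) (r : ℝ) :
    thinIntegrand μ p (⋃ n, A n) x r ≤ ⨆ n, thinIntegrand μ p (A n) x r := by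
  simp only [thinIntegrand_eq]
  split_ifs with h
  · exact le_iSup (fun _ : ℕ => (1 : ℝ≥0∞)) 0
  · have hq : 0 < 1 / (p - 1) := one_div_pos.2 (by linarith)
    rw [← iSup_rpow _ hq, ← ENNReal.iSup_div]
    refine ENNReal.rpow_le_rpow (ENNReal.div_le_div_right ?_ _) hq.le
    simp only [ballCap]
    rw [iUnion_inter]
    exact varCap_iUnion_le hp measure_ball_lt_top fun a b hab =>
      inter_subset_inter_left _ (hA hab)

lemma thin_iUnion [ProperSpace X] [IsLocallyFiniteMeasure μ] (hp : 1 < p) {r₀ : ℝ}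
    (hr₀ : 0 < r₀) (hr₁ : r₀ < 1)
    (h0 : ∀ (y : X) (r : ℝ), 0 < r → r < r₀ → ballCap μ p univ y r (2 * r) ≠ 0)
    {A M : ℕ → Set X} (hA : ∀ k, A (k + 1) = A k ∪ M k) (hM : ∀ k, IsClosed (M k))
    (hx : ∀ k, x ∉ M k) (hthin : Thin μ p (A 0) x) {δ : ℕ → ℝ≥0∞} (hδ : ∑' k, δ k ≠ ⊤) {k₀ : ℕ}
    (h : ∀ k, k₀ ≤ k → ∃ a, 0 < a ∧ Disjoint (M k) (ball x a) ∧
      ∫⁻ r in Ioo a r₀, thinIntegrand μ p (A k ∪ M k) x r / ENNReal.ofReal r ≤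
      (∫⁻ r in Ioo a r₀, thinIntegrand μ p (A k) x r / ENNReal.ofReal r) + δ k) :
    Thin μ p (⋃ k, A k) x := by
  have hmono : Monotone A := monotone_nat_of_le_succ fun k => by
    rw [hA]; exact subset_union_left
  have hth : ∀ k, Thin μ p (A k) x := fun k => by
    induction k with
    | zero => exact hthin
    | succ k ih => rw [hA]; exact ih.union_isClosed hp (hM k) (hx k)
  set I : ℕ → ℝ≥0∞ := fun k =>
    ∫⁻ r in Ioo 0 r₀, thinIntegrand μ p (A k) x r / ENNReal.ofReal r with hI
  have hIfin : ∀ k, I k < ⊤ := fun k => (thin_iff_of_pos hp hr₀ hr₁).1 (hth k)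
  have hImono : Monotone I := fun a b hab => lintegral_mono fun r =>
    ENNReal.div_le_div_right (thinIntegrand_mono hp (hmono hab) _ _) _
  have hstep : ∀ k, k₀ ≤ k → I (k + 1) ≤ I k + δ k := fun k hk => by
    obtain ⟨a, ha, hd, hle⟩ := h k hk
    simp only [hI, hA]
    exact lintegral_thinIntegrand_union_le ha hd hle
  have hbound : ∀ n, I (k₀ + n) ≤ I k₀ + ∑ j ∈ Finset.range n, δ (k₀ + j) := fun n => by
    induction n with
    | zero => simp
    | succ n ih =>
      rw [Finset.sum_range_succ, ← add_assoc, ← add_assoc]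
      exact (hstep _ (Nat.le_add_right _ _)).trans (add_le_add_left ih _)
  have hsum : ∀ n, ∑ j ∈ Finset.range n, δ (k₀ + j) ≤ ∑' k, δ k := fun n =>
    (ENNReal.sum_le_tsum _).trans
      (ENNReal.tsum_comp_le_tsum_of_injective (add_right_injective k₀) δ)
  have hle : ∀ n, I n ≤ I k₀ + ∑' k, δ k := fun n =>
    (hImono (Nat.le_add_left n k₀)).trans ((hbound n).trans (add_le_add_right (hsum n) _))
  refine (thin_iff_of_pos hp hr₀ hr₁).2 ?_
  calc ∫⁻ r in Ioo 0 r₀, thinIntegrand μ p (⋃ k, A k) x r / ENNReal.ofReal r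
      ≤ ∫⁻ r in Ioo 0 r₀, ⨆ k, thinIntegrand μ p (A k) x r / ENNReal.ofReal r :=
        lintegral_mono fun r => by
          rw [← ENNReal.iSup_div]
          exact ENNReal.div_le_div_right (thinIntegrand_iUnion_le hp hmono _ _) _
    _ = ⨆ k, I k := lintegral_iSup'
        (fun k => (aemeasurable_thinIntegrand hp (A k) x (h0 x)).div (by fun_prop))
        (ae_of_all _ fun r a b hab =>
          ENNReal.div_le_div_right (thinIntegrand_mono hp (hmono hab) _ _) _)
    _ ≤ I k₀ + ∑' k, δ k := iSup_le hle
    _ < ⊤ := ENNReal.add_lt_top.2 ⟨hIfin k₀, hδ.lt_top⟩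

lemma thin_union_of_curveNull [SFinite μ] [ProperSpace X] [IsLocallyFiniteMeasure μ] (hp : 1 < p)
    {P : Set X} (hP : CurveNull μ p P) (hPm : MeasurableSet P) (h : Thin μ p A x) :
    Thin μ p (A ∪ P) x := by
  refine lt_of_le_of_lt (setLIntegral_mono' measurableSet_Ioo fun r hr => ?_) h
  have e : ballCap μ p (A ∪ P) x r (2 * r) = ballCap μ p A x r (2 * r) :=
    varCap_union_inter_of_curveNull (by linarith) hP hPm measurableSet_ball
      (ball_subset_ball (by linarith [hr.1])) measure_ball_lt_top A
  rw [thinIntegrand_eq, thinIntegrand_eq, e]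

end ThinLimit

section Hull

variable {μ : Measure X} {p : ℝ} {A : Set X}

/-- A function with values in `[0,1]`, vanishing on `A`, with `p`-integrable gradient `g`. -/
structure Separating (μ : Measure X) (p : ℝ) (A : Set X) (h : X → ℝ) (g : X → ℝ≥0∞) : Prop where
  measurable : Measurable h
  nonneg : ∀ x, 0 ≤ h x
  le_one : ∀ x, h x ≤ 1
  eq_zero : ∀ x ∈ A, h x = 0
  measurable_grad : Measurable g
  wug : WUG μ p h g univ
  energy : ∫⁻ x, g x ^ p ∂μ < ⊤

lemma abs_one_sub_mul_sub_le {a b c d : ℝ} (ha : 0 ≤ a) (ha' : a ≤ 1)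
    (hd : 0 ≤ d) (hd' : d ≤ 1) : |(1 - a) * c - (1 - b) * d| ≤ |c - d| + |a - b| := by
  have : (1 - a) * c - (1 - b) * d = (1 - a) * (c - d) - (a - b) * d := by ring
  rw [this]
  refine (abs_sub _ _).trans (add_le_add ?_ ?_) <;> rw [abs_mul]
  · exact mul_le_of_le_one_left (abs_nonneg _) (abs_le.2 ⟨by linarith, by linarith⟩)
  · exact mul_le_of_le_one_right (abs_nonneg _) (abs_le.2 ⟨by linarith, by linarith⟩)

lemma exists_separating_of_ballCap_lt [ProperSpace X] [IsLocallyFiniteMeasure μ] (hp : 1 < p)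
    {x : X} {s' s t : ℝ} (hs : s' < s) {c : ℝ≥0∞} (hc : ballCap μ p A x s t < c) :
    ∃ H g, Separating μ p A H g ∧ ballCap μ p {y | H y = 0} x s' t < c := by
  have hp0 : 0 < p := by linarith
  obtain ⟨f, gf, hf, hfc⟩ := exists_admissible_of_varCap_lt hp0 hc
  by_cases hctop : ∫⁻ x, gf x ^ p ∂μ = ⊤
  · exact absurd hfc (by simp [hctop])
  set L : ℝ≥0∞ := (Real.toNNReal (1 / (s - s')) : ℝ≥0∞) with hL
  have hLt : L ≠ ⊤ := ENNReal.coe_ne_top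
  clear_value L
  set H : X → ℝ := fun y => (1 - f y) * ballCutoff x s' s y with hH
  have hcm : Measurable (ballCutoff x s' s) := (lipschitzWith_ballCutoff x hs).continuous.measurable
  have hHm : Measurable H := (measurable_const.sub hf.measurable).mul hcm
  have hH0 : ∀ y, 0 ≤ H y := fun y =>
    mul_nonneg (by linarith [hf.le_one y]) (ballCutoff_nonneg _ _ _ _)
  have hm : Measurable fun y => gf y + L := hf.measurable_grad.add_const _
  have hw : WUG μ p H (fun y => gf y + L) univ := by
    have hcw : WUG μ p (ballCutoff x s' s) (fun _ => L) univ := by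
      rw [hL]; exact lipschitz_wug_ballCutoff hp0 x hs
    refine (hf.wug.add hp0 hcw hf.measurable_grad fun a b => ?_)
    rw [add_comm]
    exact abs_one_sub_mul_sub_le (hf.nonneg a) (hf.le_one a) (ballCutoff_nonneg _ _ _ _)
      (ballCutoff_le_one _ _ _ _)
  have hloc : PLoc μ p (fun y => gf y + L) univ := by
    refine (PAECurve.lint_lt_top (p := p) hf.measurable_grad (lt_top_iff_ne_top.2 hctop)).mono
      fun γ hγ => ?_
    simp only [indicator_univ, curveLint] at hγ ⊢
    rw [lintegral_add_right _ measurable_const]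
    refine ENNReal.add_lt_top.2 ⟨hγ, ?_⟩
    simp only [setLIntegral_const, Real.volume_Icc]
    exact ENNReal.mul_lt_top hLt.lt_top ofReal_lt_top
  refine ⟨H, {y | 0 < H y}.indicator fun y => gf y + L, ⟨hHm, hH0, fun y => ?_, fun y hy => ?_,
    hm.indicator (measurableSet_lt measurable_const hHm), hw.indicator_pos hp0 hHm hm hloc hH0,
    ?_⟩, ?_⟩
  · exact mul_le_one₀ (by linarith [hf.nonneg y]) (ballCutoff_nonneg _ _ _ _)
      (ballCutoff_le_one _ _ _ _)
  · by_cases hyb : y ∈ ball x s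
    · simp [hH, hf.eq_one y ⟨hy, hyb⟩]
    · simp [hH, ballCutoff_eq_zero hs hyb]
  · calc ∫⁻ y, ({y | 0 < H y}.indicator (fun y => gf y + L) y) ^ p ∂μ
        ≤ ∫⁻ y in ball x s, (gf y + L) ^ p ∂μ := by
          rw [← lintegral_indicator measurableSet_ball]
          refine lintegral_mono fun y => ?_
          by_cases hy : y ∈ ball x s
          · rw [indicator_of_mem hy]
            exact ENNReal.rpow_le_rpow (indicator_le_self _ _ y) hp0.le
          · rw [indicator_of_notMem (by simp [hH, ballCutoff_eq_zero hs hy]),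
              ENNReal.zero_rpow_of_pos hp0]
            exact zero_le
      _ ≤ _ := lintegral_add_rpow_le hp.le hf.measurable_grad
      _ < ⊤ := by
          refine ENNReal.mul_lt_top (by finiteness) (ENNReal.add_lt_top.2
            ⟨(setLIntegral_le_lintegral _ _).trans_lt (lt_top_iff_ne_top.2 hctop), ?_⟩)
          rw [setLIntegral_const]
          exact ENNReal.mul_lt_top (ENNReal.rpow_lt_top_of_nonneg hp0.le hLt) measure_ball_lt_top
  · refine lt_of_le_of_lt (Admissible.varCap_le hp0 (f := f) (g := gf) ?_ measure_ball_lt_top) hfc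
    refine ⟨hf.measurable, hf.nonneg, hf.le_one, fun y hy => ?_, hf.eq_zero, hf.measurable_grad,
      hf.wug⟩
    have h1 : H y = 0 := hy.1
    simp only [hH, ballCutoff_eq_one hs (ball_subset_closedBall hy.2), mul_one] at h1
    linarith

lemma Separating.zero (hp : 0 < p) (A : Set X) : Separating μ p A (fun _ => 0) (fun _ => 0) where
  measurable := measurable_const
  nonneg _ := le_rfl
  le_one _ := zero_le_one
  eq_zero _ _ := rfl
  measurable_grad := measurable_const
  wug := by simpa using WUG.of_lipschitz (μ := μ) (U := univ) hp (LipschitzWith.const (0 : ℝ))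
  energy := by simp [ENNReal.zero_rpow_of_pos hp]

lemma exists_separating_iSup (hp : 0 < p) {H : ℕ → X → ℝ} {g : ℕ → X → ℝ≥0∞}
    (h : ∀ n, Separating μ p A (H n) (g n)) :
    ∃ h' g', Separating μ p A h' g' ∧ ∀ x, h' x = 0 → ∀ n, H n x = 0 := by
  have h2 : ∀ n : ℕ, (0 : ℝ≥0∞) < 2⁻¹ ^ n := fun n => by
    exact ENNReal.pow_pos (by simp) n
  choose c hc0 hct hc1 hc using fun n => exists_mul_rpow_le hp (h n).energy (h2 n)
  have hcr : ∀ n, 0 < (c n).toReal := fun n => ENNReal.toReal_pos (hc0 n) (hct n)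
  have hcr1 : ∀ n, (c n).toReal ≤ 1 := fun n => ENNReal.toReal_le_of_le_ofReal zero_le_one
    (by simpa using hc1 n)
  have hle : ∀ n x, (c n).toReal * H n x ≤ 1 := fun n x =>
    mul_le_one₀ (hcr1 n) ((h n).nonneg x) ((h n).le_one x)
  have hnn : ∀ n x, 0 ≤ (c n).toReal * H n x := fun n x =>
    mul_nonneg (hcr n).le ((h n).nonneg x)
  have hb : ∀ x, BddAbove (range fun n => (c n).toReal * H n x) := fun x =>
    ⟨1, by rintro _ ⟨n, rfl⟩; exact hle n x⟩
  refine ⟨fun x => ⨆ n, (c n).toReal * H n x, fun x => ⨆ n, c n * g n x,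
    ⟨.iSup fun n => (h n).measurable.const_mul _, fun x => Real.iSup_nonneg (hnn · x),
      fun x => ciSup_le (hle · x), fun x hx => ?_,
      .iSup fun n => (h n).measurable_grad.const_mul _, ?_, ?_⟩, fun x hx n => ?_⟩
  · simp [(h _).eq_zero x hx]
  · refine WUG.iSup hp (fun n => ((h n).wug.const_mul _).mono fun x => ?_) hb
    rw [abs_of_pos (hcr n), ENNReal.ofReal_toReal (hct n)]
  · refine (lintegral_iSup_rpow_le μ hp _ fun n => (h n).measurable_grad.const_mul _).trans_lt ?_
    calc ∑' n, ∫⁻ x, (c n * g n x) ^ p ∂μ ≤ ∑' n : ℕ, (2⁻¹ : ℝ≥0∞) ^ n :=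
          ENNReal.tsum_le_tsum fun n => by
            rw [lintegral_const_mul_rpow μ hp (h n).measurable_grad]; exact hc n
      _ < ⊤ := by rw [ENNReal.tsum_geometric, ENNReal.one_sub_inv_two, inv_inv]; simp
  · have h1 : (c n).toReal * H n x ≤ 0 := (le_ciSup (hb x) n).trans_eq hx
    have h3 := (h n).nonneg x
    by_contra hne
    exact absurd h1 (not_le.2 (mul_pos (hcr n) (lt_of_le_of_ne h3 (Ne.symm hne))))

lemma exists_separating_ballCap_le [ProperSpace X] [IsLocallyFiniteMeasure μ] (hp : 1 < p)
    (A : Set X) {φ : X → ℝ} {gφ : X → ℝ≥0∞} (hφ : Separating μ p A φ gφ) :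
    ∃ h g, Separating μ p A h g ∧ (∀ x, h x = 0 → φ x = 0) ∧ ∀ x r, 0 < r → GoodRad μ p A x r →
      ballCap μ p {y | h y = 0} x r (2 * r) ≤ ballCap μ p A x r (2 * r) := by
  have hp0 : 0 < p := by linarith
  rcases isEmpty_or_nonempty X with hX | hX
  · exact ⟨φ, gφ, hφ, fun _ h => h, fun x => hX.elim x⟩
  have key : ∀ i : ℕ × ℚ × ℚ × ℚ × ℕ, ∃ H g, Separating μ p A H g ∧
      ((i.2.1 : ℝ) < i.2.2.1 → (i.2.2.1 : ℝ) < i.2.2.2.1 →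
        ballCap μ p {y | H y = 0} (TopologicalSpace.denseSeq X i.1) i.2.1 i.2.2.2.1 <
          ballCap μ p A (TopologicalSpace.denseSeq X i.1) i.2.2.1 i.2.2.2.1 +
            ((i.2.2.2.2 : ℝ≥0∞) + 1)⁻¹) := by
    rintro ⟨i, s', s, t, m⟩
    by_cases hst : (s' : ℝ) < s ∧ (s : ℝ) < t
    · obtain ⟨H, g, h1, h2⟩ := exists_separating_of_ballCap_lt (A := A) hp hst.1
        (ENNReal.lt_add_right (ballCap_lt_top (μ := μ) hp0 A (TopologicalSpace.denseSeq X i)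
          hst.2).ne (b := ((m : ℝ≥0∞) + 1)⁻¹) (by simp))
      exact ⟨H, g, h1, fun _ _ => h2⟩
    · exact ⟨_, _, .zero hp0 A, fun h1 h2 => absurd ⟨h1, h2⟩ hst⟩
  choose H g hH hHc using key
  obtain ⟨e, he⟩ := exists_surjective_nat (Option (ℕ × ℚ × ℚ × ℚ × ℕ))
  obtain ⟨h, g', hh, hz⟩ := exists_separating_iSup (A := A) (μ := μ) hp0
    (H := fun n => (e n).elim φ H) (g := fun n => (e n).elim gφ g) fun n => by
      cases e n
      · exact hφ
      · exact hH _
  refine ⟨h, g', hh, fun x hx => ?_, fun x r hr hgood => le_of_forall_gt_imp_ge_of_dense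
    fun c hc => ?_⟩
  · obtain ⟨n, hn⟩ := he none
    simpa [hn] using hz x hx n
  obtain ⟨d₀, hd₀, hdc₀⟩ := hgood.1 c hc
  obtain ⟨d, hd, hdr, hdc⟩ : ∃ d, 0 < d ∧ d < r / 4 ∧
      ballCap μ p A x (r + d) (2 * r - d) < c :=
    ⟨min d₀ (r / 8), lt_min hd₀ (by linarith), (min_le_right _ _).trans_lt (by linarith),
      (ballCap_mono_radii Subset.rfl (by linarith [min_le_left d₀ (r / 8)])
        (by linarith [min_le_left d₀ (r / 8)])).trans_lt hdc₀⟩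
  obtain ⟨i, hy⟩ := (TopologicalSpace.denseRange_denseSeq X).exists_mem_open isOpen_ball
    ⟨x, mem_ball_self (by linarith : (0 : ℝ) < d / 8)⟩
  rw [mem_ball] at hy
  obtain ⟨s', hs'1, hs'2⟩ := exists_rat_btwn (by linarith : r + d / 8 < r + d / 4)
  obtain ⟨s, hs1, hs2⟩ := exists_rat_btwn (by linarith : r + d / 4 < r + d / 2)
  obtain ⟨t, ht1, ht2⟩ := exists_rat_btwn (by linarith : 2 * r - d / 2 < 2 * r - d / 4)
  have hle : ballCap μ p A (TopologicalSpace.denseSeq X i) s t < c :=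
    (ballCap_mono Subset.rfl (by rw [dist_comm]; linarith)
      (by rw [dist_comm]; linarith)).trans_lt hdc
  obtain ⟨m, hm⟩ : ∃ m : ℕ, ballCap μ p A (TopologicalSpace.denseSeq X i) s t +
      ((m : ℝ≥0∞) + 1)⁻¹ ≤ c := by
    obtain ⟨δ, hδ, hlt⟩ := ENNReal.lt_iff_exists_add_pos_lt.1 hle
    obtain ⟨m, hm⟩ := ENNReal.exists_inv_nat_lt (a := δ) (by simpa using hδ.ne')
    refine ⟨m, le_trans (add_le_add_right (le_trans ?_ hm.le) _) hlt.le⟩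
    exact ENNReal.inv_le_inv.2 le_self_add
  obtain ⟨n, hn⟩ := he (some (i, s', s, t, m))
  calc ballCap μ p {y | h y = 0} x r (2 * r)
      ≤ ballCap μ p {y | H (i, s', s, t, m) y = 0} (TopologicalSpace.denseSeq X i) s' t :=
        ballCap_mono (fun y hy => by simpa [hn] using hz y hy n) (by linarith) (by linarith)
    _ ≤ _ := (hHc (i, s', s, t, m) (by simp only; linarith) (by simp only; linarith)).le
    _ ≤ c := hm

end Hull

section Quasicontinuity

variable {μ : Measure X} {p : ℝ} {A : Set X}

lemma exists_two_rpow_mul_add_le {η : ℝ≥0∞} (hη : η ≠ 0) :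
    ∃ ε : ℝ≥0∞, ε ≠ 0 ∧ 2 ^ (p - 1) * (ε + ε) ≤ η ∧ ε + ε ≤ η := by
  have hK0 : (2 : ℝ≥0∞) ^ (p - 1) ≠ 0 := (ENNReal.rpow_pos (by simp) (by simp)).ne'
  have hKt : (2 : ℝ≥0∞) ^ (p - 1) ≠ ⊤ := by finiteness
  refine ⟨min (η / 2 / 2 ^ (p - 1)) (η / 2), ?_, ?_, ?_⟩
  · refine (lt_min (ENNReal.div_pos ?_ hKt) (ENNReal.div_pos hη (by simp))).ne'
    exact (ENNReal.div_pos hη (by simp)).ne'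
  · rw [mul_add]
    calc _ ≤ η / 2 + η / 2 := by
          gcongr <;>
          · refine (mul_le_mul_right (min_le_left _ _) _).trans ?_
            rw [ENNReal.mul_div_cancel hK0 hKt]
      _ = η := ENNReal.add_halves η
  · exact (add_le_add (min_le_right _ _) (min_le_right _ _)).trans_eq (ENNReal.add_halves η)

lemma Separating.exists_semicontinuous_between [ProperSpace X] [IsLocallyFiniteMeasure μ]
    (hp : 1 < p) {h : X → ℝ} {g : X → ℝ≥0∞} (hh : Separating μ p A h g) {Z : Set X}
    (hZ : IsClosed Z) (hZA : Z ⊆ A) (hZb : μ Zᶜ < ⊤) {η : ℝ≥0∞} (hη : η ≠ 0) :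
    ∃ F q : X → ℝ, LowerSemicontinuous F ∧ UpperSemicontinuous q ∧ (∀ x, h x ≤ F x) ∧
      (∀ x, q x ≤ h x) ∧ (∀ x, 0 ≤ q x) ∧ ∃ e : X → ℝ≥0∞, Measurable e ∧
        WUG μ p (fun x => F x - q x) e univ ∧ ∫⁻ x, e x ^ p ∂μ ≤ η ∧
        ∫⁻ x, ENNReal.ofReal |F x - q x| ^ p ∂μ ≤ η := by
  have hp0 : 0 < p := by linarith
  obtain ⟨ε, hε0, hε1, hε2⟩ := exists_two_rpow_mul_add_le (p := p) hη
  have hz : ∀ x ∈ Z, h x = 0 := fun x hx => hh.eq_zero x (hZA hx)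
  obtain ⟨F, hF, hhF, hF1, -, hFμ, e₁, he₁, hw₁, hi₁⟩ := exists_lowerSemicontinuous_ge hp
    hh.measurable hh.nonneg hh.le_one hh.wug hh.measurable_grad hh.energy hZ hz hZb hε0
  obtain ⟨q, hq, hqh, hq0, -, hqμ, e₂, he₂, hw₂, hi₂⟩ := exists_upperSemicontinuous_le hp
    hh.measurable hh.nonneg hh.le_one hh.wug hh.measurable_grad hh.energy hZ hz hZb hε0
  refine ⟨F, q, hF, hq, hhF, hqh, hq0, fun x => e₁ x + e₂ x, he₁.add he₂,
    hw₁.add hp0 hw₂ he₁ fun x y => ?_, ?_, ?_⟩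
  · rw [show F x - q x - (F y - q y) = (F x - h x - (F y - h y)) + (h x - q x - (h y - q y)) by
      ring]
    exact abs_add_le _ _
  · exact (lintegral_add_rpow_le hp.le he₁).trans
      ((mul_le_mul_right (add_le_add hi₁ hi₂) _).trans hε1)
  · refine (lintegral_rpow_le_of_eq_zero (B := {x | h x ≠ F x} ∪ {x | h x ≠ q x}) hp0
      (fun x => ?_) fun x hx => ?_).trans ((measure_union_le _ _).trans
        ((add_le_add hFμ hqμ).trans hε2))
    · rw [abs_le]
      constructor <;> linarith [hhF x, hqh x, hq0 x, hF1 x]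
    · simp only [mem_union, mem_ofPred_eq, not_or, not_not] at hx
      rw [← hx.1, ← hx.2, sub_self]

/-- If `4 ^ k * (D k, e k)` is bounded in `L^p` summably, almost every curve avoids
the sets `{D k > 2 ^ (-k)}` for large `k`. -/
lemma pAECurve_avoids {D : ℕ → X → ℝ} {e : ℕ → X → ℝ≥0∞} (hp : 0 < p)
    (hD : ∀ k, Measurable (D k)) (he : ∀ k, Measurable (e k))
    (hw : ∀ k, WUG μ p (D k) (e k) univ)
    (hei : ∀ k : ℕ, ∫⁻ x, (4 ^ k * e k x) ^ p ∂μ ≤ 2⁻¹ ^ k)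
    (hDi : ∀ k : ℕ, ∫⁻ x, (4 ^ k * ENNReal.ofReal |D k x|) ^ p ∂μ ≤ 2⁻¹ ^ k) :
    PAECurve μ p fun γ => ∃ k, ∀ j, k ≤ j → ∀ t ∈ Icc 0 γ.len, D j (γ.path t) ≤ 2⁻¹ ^ j := by
  have hgeo : ∑' k : ℕ, (2⁻¹ : ℝ≥0∞) ^ k < ⊤ := by
    rw [ENNReal.tsum_geometric, ENNReal.one_sub_inv_two, inv_inv]; simp
  have hme : ∀ k : ℕ, Measurable fun x => 4 ^ k * e k x := fun k => (he k).const_mul _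
  have hmD : ∀ k : ℕ, Measurable fun x => 4 ^ k * ENNReal.ofReal |D k x| := fun k =>
    ((hD k).abs.ennreal_ofReal).const_mul _
  have h1 := PAECurve.lint_lt_top (p := p) (μ := μ) (Measurable.iSup hme)
    (((lintegral_iSup_rpow_le μ hp _ hme).trans (ENNReal.tsum_le_tsum hei)).trans_lt hgeo)
  have h2 := PAECurve.lint_lt_top (p := p) (μ := μ) (Measurable.iSup hmD)
    (((lintegral_iSup_rpow_le μ hp _ hmD).trans (ENNReal.tsum_le_tsum hDi)).trans_lt hgeo)
  refine ((h1.and hp h2).and hp (PAECurve.all hp hw)).mono fun γ ⟨⟨hγ1, hγ2⟩, hγ3⟩ => ?_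
  set a := curveLint γ fun x => ⨆ k : ℕ, 4 ^ k * e k x with ha
  set b := curveLint γ fun x => ⨆ k : ℕ, 4 ^ k * ENNReal.ofReal |D k x| with hb
  have hak : ∀ k : ℕ, 4 ^ k * curveLint γ (e k) ≤ a := fun k => by
    rw [← curveLint_const_mul (by finiteness)]
    exact curveLint_mono fun x => le_iSup (fun k : ℕ => 4 ^ k * e k x) k
  have hbk : ∀ k : ℕ, 4 ^ k * curveLint γ (fun x => ENNReal.ofReal |D k x|) ≤ b := fun k => by
    rw [← curveLint_const_mul (by finiteness)]
    exact curveLint_mono fun x => le_iSup (fun k : ℕ => 4 ^ k * ENNReal.ofReal |D k x|) k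
  set l := ENNReal.ofReal γ.len with hl
  have hl0 : l ≠ 0 := by simpa [hl] using γ.len_pos
  set c := b + l * a with hc
  have hct : c ≠ ⊤ := (ENNReal.add_lt_top.2 ⟨hγ2, ENNReal.mul_lt_top ofReal_lt_top hγ1⟩).ne
  have key : ∀ k : ℕ, ∀ t ∈ Icc 0 γ.len, 2⁻¹ ^ k < D k (γ.path t) → 2 ^ k * l ≤ c := by
    intro k t ht hlt
    have hstep : ∀ s ∈ Icc 0 γ.len, (2⁻¹ : ℝ≥0∞) ^ k ≤
        ENNReal.ofReal |D k (γ.path s)| + curveLint γ (e k) := by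
      intro s hs
      have hinc : ENNReal.ofReal |D k (γ.path t) - D k (γ.path s)| ≤ curveLint γ (e k) := by
        rw [curveLint_eq_path]
        have hB := hγ3 k (fun _ _ => mem_univ _)
        rcases le_total s t with hst | hst
        · rw [abs_sub_comm]
          exact (hB s t hs.1 hst ht.2).trans (lintegral_mono_set (Icc_subset_Icc hs.1 ht.2))
        · exact (hB t s ht.1 hst hs.2).trans (lintegral_mono_set (Icc_subset_Icc ht.1 hs.2))
      calc (2⁻¹ : ℝ≥0∞) ^ k = ENNReal.ofReal (2⁻¹ ^ k) := by
            rw [ENNReal.ofReal_pow (by norm_num), ENNReal.ofReal_inv_of_pos (by norm_num)]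
            norm_num
        _ ≤ ENNReal.ofReal (|D k (γ.path s)| + |D k (γ.path t) - D k (γ.path s)|) := by
            refine ENNReal.ofReal_le_ofReal (hlt.le.trans ?_)
            linarith [le_abs_self (D k (γ.path s)), le_abs_self (D k (γ.path t) - D k (γ.path s))]
        _ ≤ _ := ENNReal.ofReal_add_le.trans (add_le_add_right hinc _)
    have hgint : (2⁻¹ : ℝ≥0∞) ^ k * l ≤
        curveLint γ (fun x => ENNReal.ofReal |D k x|) + l * curveLint γ (e k) := by
      calc (2⁻¹ : ℝ≥0∞) ^ k * l = ∫⁻ _ in Icc 0 γ.len, (2⁻¹ : ℝ≥0∞) ^ k := by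
            rw [setLIntegral_const, Real.volume_Icc, sub_zero]
        _ ≤ ∫⁻ s in Icc 0 γ.len, (ENNReal.ofReal |D k (γ.path s)| + curveLint γ (e k)) :=
            setLIntegral_mono' measurableSet_Icc hstep
        _ = _ := by
            rw [lintegral_add_right _ measurable_const, setLIntegral_const, Real.volume_Icc,
              sub_zero,
              curveLint_eq_path γ fun x => ENNReal.ofReal |D k x|, mul_comm l]
    have h4 : (4 : ℝ≥0∞) ^ k * 2⁻¹ ^ k = 2 ^ k := by
      rw [← mul_pow]
      congr 1
      rw [show (4 : ℝ≥0∞) = 2 * 2 by norm_num, mul_assoc, ENNReal.mul_inv_cancel (by simp)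
        (by simp), mul_one]
    calc 2 ^ k * l = 4 ^ k * (2⁻¹ ^ k * l) := by rw [← mul_assoc, h4]
      _ ≤ 4 ^ k * _ := mul_le_mul_right hgint _
      _ = 4 ^ k * curveLint γ (fun x => ENNReal.ofReal |D k x|) +
          l * (4 ^ k * curveLint γ (e k)) := by ring
      _ ≤ c := add_le_add (hbk k) (mul_le_mul_right (hak k) _)
  obtain ⟨k, hk⟩ : ∃ k : ℕ, c / l < 2 ^ k := by
    obtain ⟨n, hn⟩ := ENNReal.exists_nat_gt (ENNReal.div_lt_top hct hl0).ne
    exact ⟨n, hn.trans (by exact_mod_cast Nat.lt_two_pow_self)⟩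
  refine ⟨k, fun j hj t ht => le_of_not_gt fun hlt => ?_⟩
  have h5 : (2 : ℝ≥0∞) ^ j ≤ c / l :=
    (ENNReal.le_div_iff_mul_le (Or.inl hl0) (Or.inl ofReal_ne_top)).2 (key j t ht hlt)
  exact absurd (h5.trans_lt hk) (not_lt.2 (pow_le_pow_right₀ (by norm_num) hj))

lemma Separating.exists_isOpen_antitone [ProperSpace X] [IsLocallyFiniteMeasure μ] (hp : 1 < p)
    {h : X → ℝ} {g : X → ℝ≥0∞} (hh : Separating μ p A h g) {Z : Set X}
    (hZ : IsClosed Z) (hZA : Z ⊆ A) (hZb : μ Zᶜ < ⊤) :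
    ∃ G : ℕ → Set X, (∀ k, IsOpen (G k)) ∧ Antitone G ∧ (∀ k, IsClosed ({x | h x = 0} \ G k)) ∧
      PAECurve μ p fun γ => ∃ k, ∀ t ∈ Icc 0 γ.len, γ.path t ∉ G k := by
  have hp0 : 0 < p := by linarith
  have hη : ∀ k : ℕ, ∃ η : ℝ≥0∞, η ≠ 0 ∧ (4 ^ k : ℝ≥0∞) ^ p * η ≤ 2⁻¹ ^ k := fun k => by
    have h0 : (4 ^ k : ℝ≥0∞) ^ p ≠ 0 := (ENNReal.rpow_pos (by positivity) (by finiteness)).ne'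
    have ht : (4 ^ k : ℝ≥0∞) ^ p ≠ ⊤ := by finiteness
    refine ⟨2⁻¹ ^ k / (4 ^ k : ℝ≥0∞) ^ p, (ENNReal.div_pos ?_ ht).ne',
      (ENNReal.mul_div_cancel h0 ht).le⟩
    exact (ENNReal.pow_pos (by simp) k).ne'
  choose η hη0 hη1 using hη
  choose F q hF hq hhF hqh hq0 e he hw hei hDi using fun k =>
    hh.exists_semicontinuous_between hp hZ hZA hZb (hη0 k)
  have hFm : ∀ k, Measurable (F k) := fun k => (hF k).measurable
  have hqm : ∀ k, Measurable (q k) := fun k => (hq k).measurable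
  have hO : ∀ k (a : ℝ), IsOpen {x | a < F k x - q k x} := fun k a => by
    have h1 : LowerSemicontinuous fun x => F k x + -q k x := (hF k).add
      (continuous_neg.comp_upperSemicontinuous_antitone (hq k) fun _ _ h => neg_le_neg h)
    simp only [sub_eq_add_neg]
    exact h1.isOpen_preimage a
  have hcur := pAECurve_avoids hp0 (fun k => (hFm k).sub (hqm k)) he hw
    (fun k => by
      rw [lintegral_const_mul_rpow μ hp0 (he k)]
      exact (mul_le_mul_right (hei k) _).trans (hη1 k))
    (fun k => by
      rw [lintegral_const_mul_rpow μ hp0 ((hFm k).sub (hqm k)).abs.ennreal_ofReal]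
      exact (mul_le_mul_right (hDi k) _).trans (hη1 k))
  refine ⟨fun k => ⋃ j, ⋃ _ : k ≤ j, {x | 2⁻¹ ^ j < F j x - q j x},
    fun k => isOpen_iUnion fun j => isOpen_iUnion fun _ => hO j _,
    fun a b hab => iUnion_mono fun j => iUnion_subset fun hj => subset_iUnion_of_subset
      (hab.trans hj) Subset.rfl, fun k => ?_, hcur.mono fun γ ⟨k, hk⟩ => ⟨k, fun t ht => ?_⟩⟩
  · set G := ⋃ j, ⋃ _ : k ≤ j, {x | 2⁻¹ ^ j < F j x - q j x} with hG
    have hGo : IsOpen G := isOpen_iUnion fun j => isOpen_iUnion fun _ => hO j _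
    have e : {x | h x = 0} \ G = (⋂ j, ⋂ _ : k ≤ j, {x | F j x ≤ 2⁻¹ ^ j}) ∩ Gᶜ := by
      ext x
      simp only [Set.mem_sdiff, mem_inter_iff, mem_compl_iff, mem_iInter, mem_ofPred_eq]
      refine and_congr_left fun hx => ⟨fun h0 j hj => ?_, fun H => ?_⟩
      · simp only [hG, mem_iUnion, mem_ofPred_eq, not_exists, not_lt] at hx
        have h0' : h x = 0 := h0
        linarith [hx j hj, hqh j x]
      · refine le_antisymm (ge_of_tendsto (tendsto_pow_atTop_nhds_zero_of_lt_one
          (r := (2⁻¹ : ℝ)) (by norm_num) (by norm_num)) ?_) (hh.nonneg x)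
        exact (eventually_ge_atTop k).mono fun j hj => (hhF j x).trans (H j hj)
    rw [e]
    exact (isClosed_iInter fun j => isClosed_iInter fun _ =>
      (hF j).isClosed_preimage _).inter hGo.isClosed_compl
  · simp only [mem_iUnion, mem_ofPred_eq, not_exists, not_lt]
    exact fun j hj => hk j hj t ht

end Quasicontinuity

section Enlargement

variable {μ : Measure X} {p : ℝ} {A : Set X}

lemma exists_closed_enlargement [ProperSpace X] [IsLocallyFiniteMeasure μ] (hp : 1 < p) {r₀ : ℝ}
    (h0 : ∀ (y : X) (r : ℝ), 0 < r → r < r₀ → ballCap μ p univ y r (2 * r) ≠ 0)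
    {C O Q Y : Set X} (hC : IsCompact C) (hCA : C ⊆ A) (hY : IsCompact Y) (hO : IsOpen O)
    (hCO : C ⊆ O) (hQ : IsOpen Q) (hCQ : C ⊆ Q) {δ : ℝ≥0∞} (hδ : 0 < δ) :
    ∃ ε a : ℝ, 0 < ε ∧ ε ≤ a ∧ cthickening ε C ⊆ Q ∧ thickening (2 * a) C ⊆ O ∧
      ∀ x ∈ Y, ∫⁻ r in Ioo a r₀, thinIntegrand μ p (A ∪ cthickening ε C) x r / ENNReal.ofReal r ≤
        (∫⁻ r in Ioo a r₀, thinIntegrand μ p A x r / ENNReal.ofReal r) + δ := by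
  obtain ⟨b, hb, hbO⟩ := hC.exists_thickening_subset_open hO hCO
  obtain ⟨c, hc, hcQ⟩ := hC.exists_cthickening_subset_open hQ hCQ
  obtain ⟨ε, hε, hεY⟩ := exists_forall_lintegral_thinIntegrand_le (μ := μ) hp h0 hC hCA hY
    (half_pos hb) hδ
  refine ⟨min ε (min c (b / 2)), b / 2, lt_min hε (lt_min hc (half_pos hb)),
    (min_le_right _ _).trans (min_le_right _ _), (cthickening_mono ((min_le_right _ _).trans
      (min_le_left _ _)) _).trans hcQ, by rwa [mul_div_cancel₀ _ two_ne_zero],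
    fun x hx => le_trans (lintegral_mono fun r => ENNReal.div_le_div_right
      (thinIntegrand_mono hp (union_subset_union_right _ (cthickening_mono (min_le_left _ _) _))
        _ _) _) (hεY x hx)⟩

/-- A thin set may be enlarged by closed neighbourhoods of its compact parts. -/
lemma exists_enlargement [ProperSpace X] [IsLocallyFiniteMeasure μ] (hp : 1 < p) {r₀ : ℝ}
    (hr₀ : 0 < r₀) (hr₁ : r₀ < 1)
    (h0 : ∀ (y : X) (r : ℝ), 0 < r → r < r₀ → ballCap μ p univ y r (2 * r) ≠ 0)
    {C G : ℕ → Set X} {Q Y : Set X} (hC : ∀ k, IsCompact (C k)) (hCA : ∀ k, C k ⊆ A)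
    (hG : ∀ k, IsOpen (G k)) (hGanti : Antitone G) (hCG : ∀ k, C (k + 1) ⊆ C k ∪ G k)
    (hY : IsCompact Y) (hQ : IsOpen Q) (hCQ : ∀ k, C k ⊆ Q) :
    ∃ M : ℕ → Set X, (∀ k, IsClosed (M k)) ∧ (∀ k, C k ⊆ interior (M k)) ∧ (∀ k, M k ⊆ Q) ∧
      ∀ x ∈ Y, Thin μ p A x → (∀ k, x ∉ M k) → (∃ k, x ∉ G k) → Thin μ p (A ∪ ⋃ k, M k) x := by
  have step : ∀ (k : ℕ) (A' O : Set X), ∃ ε a : ℝ, C k ⊆ A' → IsOpen O → C k ⊆ O →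
      0 < ε ∧ ε ≤ a ∧ cthickening ε (C k) ⊆ Q ∧ thickening (2 * a) (C k) ⊆ O ∧
      ∀ x ∈ Y, ∫⁻ r in Ioo a r₀,
          thinIntegrand μ p (A' ∪ cthickening ε (C k)) x r / ENNReal.ofReal r ≤
        (∫⁻ r in Ioo a r₀, thinIntegrand μ p A' x r / ENNReal.ofReal r) + 2⁻¹ ^ k := by
    intro k A' O
    by_cases h : C k ⊆ A' ∧ IsOpen O ∧ C k ⊆ O
    · obtain ⟨ε, a, H⟩ := exists_closed_enlargement (μ := μ) hp h0 (hC k) h.1 hY h.2.1 h.2.2 hQ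
        (hCQ k) (δ := 2⁻¹ ^ k) (ENNReal.pow_pos (by simp) k)
      exact ⟨ε, a, fun _ _ _ => H⟩
    · exact ⟨0, 0, fun h1 h2 h3 => absurd ⟨h1, h2, h3⟩ h⟩
  choose ε a H using step
  let S : ℕ → Set X × Set X := fun k => Nat.rec (A, univ) (fun k s =>
    (s.1 ∪ cthickening (ε k s.1 s.2) (C k), thickening (ε k s.1 s.2) (C k) ∪ G k)) k
  let e : ℕ → ℝ := fun k => ε k (S k).1 (S k).2
  have hS1 : ∀ k, (S (k + 1)).1 = (S k).1 ∪ cthickening (e k) (C k) := fun _ => rfl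
  have hS2 : ∀ k, (S (k + 1)).2 = thickening (e k) (C k) ∪ G k := fun _ => rfl
  have hAS : ∀ k, A ⊆ (S k).1 := fun k => by
    induction k with
    | zero => exact Subset.rfl
    | succ k ih => rw [hS1]; exact ih.trans subset_union_left
  have hCS : ∀ k, IsOpen (S k).2 ∧ C k ⊆ (S k).2 ∧ 0 < e k := fun k => by
    induction k with
    | zero => exact ⟨isOpen_univ, subset_univ _,
        (H 0 _ _ (hCA 0) isOpen_univ (subset_univ _)).1⟩
    | succ k ih =>
      have h1 : IsOpen (S (k + 1)).2 := by rw [hS2]; exact isOpen_thickening.union (hG k)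
      have h2 : C (k + 1) ⊆ (S (k + 1)).2 := by
        rw [hS2]
        exact (hCG k).trans (union_subset_union_left _ (self_subset_thickening ih.2.2 _))
      exact ⟨h1, h2, (H (k + 1) (S (k + 1)).1 _ ((hCA _).trans (hAS (k + 1))) h1 h2).1⟩
  have HS := fun k => H k (S k).1 (S k).2 ((hCA k).trans (hAS k)) (hCS k).1 (hCS k).2.1
  refine ⟨fun k => cthickening (e k) (C k), fun k => isClosed_cthickening, fun k =>
    (self_subset_thickening (hCS k).2.2 _).trans (thickening_subset_interior_cthickening _ _),
    fun k => (HS k).2.2.1, fun x hxY hthin hx ⟨m, hm⟩ => ?_⟩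
  have hU : A ∪ ⋃ k, cthickening (e k) (C k) ⊆ ⋃ k, (S k).1 := by
    refine union_subset (subset_iUnion (fun k => (S k).1) 0) (iUnion_subset fun k => ?_)
    exact subset_iUnion_of_subset (k + 1) (by rw [hS1]; exact subset_union_right)
  refine lt_of_le_of_lt (lintegral_mono fun r => ENNReal.div_le_div_right
    (thinIntegrand_mono hp hU _ _) _) (thin_iUnion hp hr₀ hr₁ h0 hS1
      (fun k => isClosed_cthickening) hx hthin (δ := fun k => 2⁻¹ ^ k) ?_ (k₀ := m + 1)
      fun k hk => ⟨a k (S k).1 (S k).2, (HS k).1.trans_le (HS k).2.1, ?_, (HS k).2.2.2.2 x hxY⟩)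
  · rw [ENNReal.tsum_geometric, ENNReal.one_sub_inv_two, inv_inv]; simp
  · obtain ⟨n, rfl⟩ : ∃ n, k = n + 1 := ⟨k - 1, by omega⟩
    have hxO : x ∉ (S (n + 1)).2 := by
      rw [hS2]
      rintro (h | h)
      · exact hx n (thickening_subset_cthickening _ _ h)
      · exact hm (hGanti (by omega) h)
    refine disjoint_left.2 fun y hy hyb => hxO ((HS (n + 1)).2.2.2.1 ?_)
    set b := a (n + 1) (S (n + 1)).1 (S (n + 1)).2 with hb
    have hb0 : 0 ≤ b := ((HS (n + 1)).1.trans_le (HS (n + 1)).2.1).le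
    rw [mem_thickening_iff_infEDist_lt]
    rw [mem_cthickening_iff] at hy
    rw [mem_ball, dist_comm] at hyb
    calc infEDist x (C (n + 1)) ≤ infEDist y (C (n + 1)) + edist x y :=
          infEDist_le_infEDist_add_edist
      _ < ENNReal.ofReal b + ENNReal.ofReal b := by
          refine ENNReal.add_lt_add_of_le_of_lt (ne_top_of_le_ne_top ofReal_ne_top hy)
            (hy.trans (ENNReal.ofReal_le_ofReal (HS (n + 1)).2.1)) ?_
          rw [edist_dist]
          exact (ENNReal.ofReal_lt_ofReal_iff_of_nonneg dist_nonneg).2 hyb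
      _ = ENNReal.ofReal (2 * b) := by rw [two_mul, ENNReal.ofReal_add hb0 hb0]

end Enlargement

section Truncation

variable {μ : Measure X} {p : ℝ} {φ : X → ℝ} {g : X → ℝ≥0∞}

lemma exists_nat_setLIntegral_lt_le (hφ : Measurable φ) {G : X → ℝ≥0∞} (hG : Measurable G)
    (hfin : ∫⁻ x, G x ∂μ < ⊤) {δ : ℝ≥0∞} (hδ : δ ≠ 0) :
    ∃ n : ℕ, 0 < n ∧ ∫⁻ x in {x | (n : ℝ) < φ x}, G x ∂μ ≤ δ := by
  have hms : ∀ n : ℕ, MeasurableSet {x | (n : ℝ) < φ x} := fun n =>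
    measurableSet_lt measurable_const hφ
  have h : Tendsto (fun n : ℕ => ∫⁻ x in {x | (n : ℝ) < φ x}, G x ∂μ) atTop (nhds 0) := by
    have h0 : (0 : ℝ≥0∞) = ∫⁻ x, 0 ∂μ := by simp
    simp_rw [← lintegral_indicator (hms _)]
    rw [h0]
    refine tendsto_lintegral_filter_of_dominated_convergence G
      (Eventually.of_forall fun n => hG.indicator (hms n))
      (Eventually.of_forall fun n => Eventually.of_forall fun x => indicator_le_self _ _ x) hfin.ne
      (Eventually.of_forall fun x => ?_)
    refine tendsto_const_nhds.congr' ?_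
    obtain ⟨m, hm⟩ := exists_nat_ge (φ x)
    filter_upwards [eventually_ge_atTop m] with n hn
    refine (indicator_of_notMem (fun h => ?_) _).symm
    have h1 : (n : ℝ) < φ x := h
    have h2 : (m : ℝ) ≤ n := by exact_mod_cast hn
    linarith
  obtain ⟨n, hn, hn0⟩ := ((h.eventually (gt_mem_nhds hδ.bot_lt)).and (eventually_gt_atTop 0)).exists
  exact ⟨n, hn0, hn.le⟩

lemma WUG.sub_const_max (hp : 0 < p) (hφ : Measurable φ) (h : WUG μ p φ g univ)
    (hg : Measurable g) (hgfin : ∫⁻ x, g x ^ p ∂μ < ⊤) (c : ℝ) :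
    WUG μ p (fun x => Max.max (φ x - c) 0) ({x | c < φ x}.indicator g) univ := by
  have h1 : WUG μ p (fun x => Max.max (φ x - c) 0) g univ := h.of_abs_le fun x y => by
    simpa using abs_max_sub_max_le_max (φ x - c) 0 (φ y - c) 0
  have h2 := h1.indicator_pos hp ((hφ.sub_const c).max measurable_const) hg
    (PLoc.of_lintegral_univ hp hg MeasurableSet.univ hgfin) fun x => le_max_right _ _
  refine h2.mono fun x => indicator_le_indicator_of_subset (fun y hy => ?_) (fun _ => zero_le) x
  have hy' : 0 < Max.max (φ y - c) 0 := hy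
  rcases lt_max_iff.1 hy' with h | h
  · exact sub_pos.1 h
  · exact absurd h (lt_irrefl _)

lemma exists_truncation_approx [ProperSpace X] [IsLocallyFiniteMeasure μ] (hp : 1 < p)
    (hφ : Measurable φ) (hφ0 : ∀ x, 0 ≤ φ x) (h : WUG μ p φ g univ) (hg : Measurable g)
    (hgfin : ∫⁻ x, g x ^ p ∂μ < ⊤) {Z : Set X} (hZ : IsClosed Z) (hZφ : ∀ x ∈ Z, φ x = 0)
    (hZb : μ Zᶜ < ⊤) {ε : ℝ≥0∞} (hε : ε ≠ 0) :
    ∃ (q : X → ℝ) (τ c : ℝ), UpperSemicontinuous q ∧ (∀ x, φ x = 0 → q x ≤ 0) ∧ 0 < τ ∧ 0 ≤ c ∧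
      (∀ x, c * max (q x - τ) 0 ≤ φ x) ∧ ∃ e : X → ℝ≥0∞, Measurable e ∧
        WUG μ p (fun x => φ x - c * max (q x - τ) 0) e univ ∧ ∫⁻ x, e x ^ p ∂μ ≤ ε := by
  have hp0 : 0 < p := by linarith
  obtain ⟨δ, hδ0, hδ1, -⟩ := exists_two_rpow_mul_add_le (p := p) hε
  obtain ⟨n, hn, hnδ⟩ := exists_nat_setLIntegral_lt_le hφ (hg.pow_const p) hgfin hδ0
  have hn0 : (0 : ℝ) < n := by exact_mod_cast hn
  have hms : MeasurableSet {x | (n : ℝ) < φ x} := measurableSet_lt measurable_const hφ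
  have hd0 : (ENNReal.ofReal n) ^ p ≠ 0 := (ENNReal.rpow_pos (by simpa using hn)
    ofReal_ne_top).ne'
  have hdt : (ENNReal.ofReal n) ^ p ≠ ⊤ := by finiteness
  have hw₁ : WUG μ p (fun x => (n : ℝ)⁻¹ * min (φ x) n)
      (fun x => ENNReal.ofReal |(n : ℝ)⁻¹| * g x) univ :=
    WUG.const_mul (h.of_abs_le fun x y => abs_min_const_sub_le _ _ _) _
  obtain ⟨q, hq, hqf, -, τ, hτ, e, he, hwe, hie, -⟩ := exists_truncation
    (ε := δ / ENNReal.ofReal n ^ p) hp ((hφ.min measurable_const).const_mul _)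
    (fun x => mul_nonneg (inv_nonneg.2 hn0.le) (le_min (hφ0 x) hn0.le))
    (fun x => by
      rw [inv_mul_le_iff₀ hn0, mul_one]
      exact min_le_right _ _) hw₁ (hg.const_mul _)
    (by
      rw [lintegral_const_mul_rpow μ hp0 hg]
      exact ENNReal.mul_lt_top (by finiteness) hgfin) hZ
    (fun x hx => by simp [hZφ x hx, hn0.le]) hZb (ENNReal.div_pos hδ0 hdt).ne'
  have hle : ∀ x, n * max (q x - τ) 0 ≤ min (φ x) n := fun x => by
    have h1 := hqf x
    rw [le_inv_mul_iff₀ hn0] at h1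
    rcases le_total (q x - τ) 0 with h2 | h2
    · rw [max_eq_right h2, mul_zero]
      exact le_min (hφ0 x) hn0.le
    · rw [max_eq_left h2]
      nlinarith
  refine ⟨q, τ, n, hq, fun x hx => ?_, hτ, hn0.le, fun x => (hle x).trans (min_le_left _ _),
    fun x => {x | (n : ℝ) < φ x}.indicator g x + ENNReal.ofReal |(n : ℝ)| * e x,
    (hg.indicator hms).add (he.const_mul _),
    (WUG.sub_const_max hp0 hφ h hg hgfin n).add hp0 (hwe.const_mul n) (hg.indicator hms)
      fun x y => ?_, ?_⟩
  · simpa [hx, hn0.le] using hqf x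
  · have e1 : ∀ x, φ x - n * max (q x - τ) 0 =
        max (φ x - n) 0 + n * ((n : ℝ)⁻¹ * min (φ x) n - max (q x - τ) 0) := fun x => by
      rw [mul_sub, mul_inv_cancel_left₀ hn0.ne']
      rcases le_total (φ x) n with h3 | h3
      · rw [min_eq_left h3, max_eq_right (by linarith : φ x - n ≤ 0)]; ring
      · rw [min_eq_right h3, max_eq_left (by linarith : 0 ≤ φ x - n)]; ring
    rw [e1, e1, add_sub_add_comm]
    exact abs_add_le _ _
  · refine (lintegral_add_rpow_le hp.le (hg.indicator hms)).trans ((mul_le_mul_right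
      (add_le_add ?_ ?_) _).trans hδ1)
    · refine le_trans (le_of_eq ?_) hnδ
      rw [← lintegral_indicator hms]
      refine lintegral_congr fun x => ?_
      by_cases hx : x ∈ {x | (n : ℝ) < φ x}
      · rw [indicator_of_mem hx, indicator_of_mem hx]
      · rw [indicator_of_notMem hx, indicator_of_notMem hx, ENNReal.zero_rpow_of_pos hp0]
    · rw [lintegral_const_mul_rpow μ hp0 he, abs_of_pos hn0]
      exact (mul_le_mul_right hie _).trans_eq (ENNReal.mul_div_cancel hd0 hdt)

lemma WUG.congr_of_curveNull {f f₁ : X → ℝ} {U P : Set X} (hp : 0 < p) (h : WUG μ p f g U)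
    (hP : CurveNull μ p P) (hf : ∀ x ∉ P, f₁ x = f x) : WUG μ p f₁ g U := by
  refine (PAECurve.and hp h hP).mono fun γ hγ hU s t h1 h2 h3 => ?_
  beta_reduce
  rw [hf _ (hγ.2 s ⟨h1, h2.trans h3⟩), hf _ (hγ.2 t ⟨h1.trans h2, h3⟩)]
  exact hγ.1 hU s t h1 h2 h3

end Truncation

section InnerApprox

variable {μ : Measure X} {p : ℝ} {V : Set X}

lemma Curve.not_forall_ae_notMem {γ : Curve X} {B O : Set X} (hO : IsOpen O) (hOB : O ⊆ B) {t : ℝ}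
    (ht : t ∈ Icc 0 γ.len) (htO : γ.path t ∈ O) :
    ¬ ∀ᵐ s, s ∈ Icc 0 γ.len → γ.path s ∉ B := by
  intro h
  have hO' : IsOpen (γ.path ⁻¹' O) := hO.preimage γ.continuous_path
  have hne : (γ.path ⁻¹' O ∩ Ioo 0 γ.len).Nonempty := by
    refine mem_closure_iff.1 ?_ _ hO' htO
    rwa [closure_Ioo γ.len_pos.ne]
  refine ((hO'.inter isOpen_Ioo).measure_pos volume hne).ne' (measure_mono_null ?_ h)
  exact fun s hs hs' => hs' (Ioo_subset_Icc_self hs.2) (hOB hs.1)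

lemma Thin.of_forall_goodRad [ProperSpace X] [IsLocallyFiniteMeasure μ] (hp : 1 < p)
    {A A' : Set X} {x : X} (h : Thin μ p A x)
    (hle : ∀ r, 0 < r → GoodRad μ p A x r →
      ballCap μ p A' x r (2 * r) ≤ ballCap μ p A x r (2 * r)) : Thin μ p A' x := by
  refine lt_of_le_of_lt (lintegral_mono_ae ?_) h
  have h1 : ∀ᵐ r : ℝ, r ∉ {r : ℝ | 0 < r ∧ ¬ GoodRad μ p A x r} :=
    measure_eq_zero_iff_ae_notMem.1 ((countable_not_goodRad hp A x).measure_zero volume)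
  filter_upwards [ae_restrict_mem measurableSet_Ioo, ae_restrict_of_ae h1] with r hr hr'
  have hg : GoodRad μ p A x r := by
    by_contra hng
    exact hr' ⟨hr.1, hng⟩
  have hp1 : 0 ≤ 1 / (p - 1) := one_div_nonneg.2 (by linarith)
  rw [thinIntegrand_eq, thinIntegrand_eq]
  split_ifs
  · exact le_rfl
  · gcongr
    exact hle r hr.1 hg

lemma hasInnerApprox_of_finelyOpen [ProperSpace X] [IsLocallyFiniteMeasure μ] (hp : 1 < p) {r₀ : ℝ}
    (hr₀ : 0 < r₀) (hr₁ : r₀ < 1)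
    (h0 : ∀ (y : X) (r : ℝ), 0 < r → r < r₀ → ballCap μ p univ y r (2 * r) ≠ 0)
    (hV : FinelyOpen μ p V) {z : X} {R : ℝ} (hVR : V ⊆ ball z R) {φ : X → ℝ}
    (hφ : MemNp0 μ p φ V) (hφ0 : ∀ x, 0 ≤ φ x) : HasInnerApprox μ p V φ := by
  classical
  intro ε hε
  have hp0 : 0 < p := by linarith
  obtain ⟨g, hg, hw, hgfin⟩ := hφ.1.exists_wug hp0
  rw [Measure.restrict_univ] at hgfin
  have hZ : IsClosed (ball z R)ᶜ := isOpen_ball.isClosed_compl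
  have hZb : μ (ball z R)ᶜᶜ < ⊤ := by rw [compl_compl]; exact measure_ball_lt_top
  have hZV : (ball z R)ᶜ ⊆ Vᶜ := compl_subset_compl.2 hVR
  obtain ⟨q, τ, c, hq, hq0, hτ, hc, hcφ, e, he, hwe, hei⟩ := exists_truncation_approx hp hφ.1.1
    hφ0 hw hg hgfin hZ (fun x hx => hφ.2 x (hZV hx)) hZb
    (lt_min hε one_pos : (0 : ℝ≥0∞) < min ε 1).ne'
  have hsep : Separating μ p Vᶜ (fun x => min (φ x) 1) g :=
    ⟨hφ.1.1.min measurable_const, fun x => le_min (hφ0 x) zero_le_one, fun x => min_le_right _ _,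
      fun x hx => by simp [hφ.2 x hx], hg, hw.of_abs_le fun x y => abs_min_const_sub_le _ _ _,
      hgfin⟩
  obtain ⟨h, gh, hh, hhφ, hcap⟩ := exists_separating_ballCap_le hp _ hsep
  have hφz : ∀ x, h x = 0 → φ x = 0 := fun x hx => by
    have h1 : min (φ x) 1 = 0 := hhφ x hx
    rcases min_choice (φ x) 1 with h2 | h2 <;> rw [h2] at h1
    · exact h1
    · exact absurd h1 one_ne_zero
  obtain ⟨G, hG, hGanti, hGc, hGcur⟩ := hh.exists_isOpen_antitone hp hZ hZV hZb
  set A : Set X := {x | h x = 0} with hA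
  set P : Set X := ⋂ k, G k with hP
  have hPm : MeasurableSet P := MeasurableSet.iInter fun k => (hG k).measurableSet
  have hPn : CurveNull μ p P := hGcur.mono fun γ ⟨k, hk⟩ t ht htP => hk t ht (mem_iInter.1 htP k)
  have hQ : IsOpen {x | q x < τ} := hq.isOpen_preimage τ
  obtain ⟨M, hM, hCM, hMQ, hthin⟩ := exists_enlargement (μ := μ) (A := A) hp hr₀ hr₁ h0
    (C := fun k => closedBall z R ∩ (A \ G k)) (G := G) (Q := {x | q x < τ})
    (Y := closedBall z R) (fun k => (isCompact_closedBall z R).inter_right (hGc k))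
    (fun k x hx => hx.2.1) hG hGanti
    (fun k x hx => by
      by_cases hxG : x ∈ G k
      · exact Or.inr hxG
      · exact Or.inl ⟨hx.1, hx.2.1, hxG⟩)
    (isCompact_closedBall z R) hQ fun k x hx => (hq0 x (hφz x hx.2.1)).trans_lt hτ
  have hWV : (A ∪ (⋃ k, M k) ∪ P)ᶜ ⊆ V := fun x hx => by
    by_contra hxV
    exact hx (Or.inl (Or.inl (hh.eq_zero x hxV)))
  have hcm : Measurable fun x => c * max (q x - τ) 0 :=
    ((hq.measurable.sub_const τ).max measurable_const).const_mul c
  have hle : ∀ x, 0 ≤ P.piecewise (fun _ => 0) (fun x => c * max (q x - τ) 0) x ∧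
      P.piecewise (fun _ => 0) (fun x => c * max (q x - τ) 0) x ≤ φ x := fun x => by
    by_cases hx : x ∈ P
    · rw [piecewise_eq_of_mem P _ _ hx]
      exact ⟨le_rfl, hφ0 x⟩
    · rw [piecewise_eq_of_notMem P _ _ hx]
      exact ⟨mul_nonneg hc (le_max_right _ _), hcφ x⟩
  have hwd : WUG μ p (fun x => φ x - P.piecewise (fun _ => 0) (fun x => c * max (q x - τ) 0) x)
      e univ := hwe.congr_of_curveNull hp0 hPn fun x hx => by
    rw [piecewise_eq_of_notMem P _ _ hx]
  refine ⟨_, hWV, fun x hx => ?_, P.piecewise (fun _ => 0) fun x => c * max (q x - τ) 0,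
    ⟨?_, fun x hx => ?_⟩, fun x => (hle x).1, ⟨e, he, hwd, hei.trans (min_le_left _ _)⟩,
    (⋃ k, M k) ∪ (closedBall z R)ᶜ, ?_, ?_, ?_⟩
  · rw [compl_compl]
    refine thin_union_of_curveNull hp hPn hPm ?_
    simp only [mem_compl_iff, mem_union, not_or, mem_iUnion, not_exists, hP, mem_iInter,
      not_forall] at hx
    have hxV : x ∈ V := by
      by_contra hxV
      exact hx.1.1 (hh.eq_zero x hxV)
    exact hthin x (ball_subset_closedBall (hVR hxV))
      ((hV x hxV).of_forall_goodRad hp fun r hr hgood => hcap x r hr hgood) hx.1.2 hx.2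
  · refine MemNp.of_wug hp0 (measurable_const.piecewise hPm hcm) ?_ (hg.add he)
      (hw.add hp0 hwd hg fun x y => ?_) ?_
    · refine lt_of_le_of_lt (lintegral_mono fun x => ?_)
        (lt_of_le_of_lt le_self_add hφ.1.2)
      gcongr 1
      exact ENNReal.ofReal_le_ofReal (abs_le_abs_of_nonneg (hle x).1 (hle x).2)
    · refine le_trans (le_of_eq ?_) (abs_sub _ _)
      congr 1
      ring
    · rw [Measure.restrict_univ]
      exact (lintegral_add_rpow_le hp.le hg).trans_lt (ENNReal.mul_lt_top (by finiteness)
        (ENNReal.add_lt_top.2 ⟨hgfin, (hei.trans (min_le_right _ _)).trans_lt one_lt_top⟩))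
  · by_cases hxP : x ∈ P
    · rw [piecewise_eq_of_mem P _ _ hxP]
    · rw [piecewise_eq_of_notMem P _ _ hxP]
      have hqx : q x - τ ≤ 0 := by
        simp only [mem_compl_iff, not_not] at hx
        rcases hx with (hx | hx) | hx
        · linarith [hq0 x (hφz x hx)]
        · obtain ⟨k, hk⟩ := mem_iUnion.1 hx
          have : q x < τ := hMQ k hk
          linarith
        · exact absurd hx hxP
      rw [max_eq_right hqx, mul_zero]
  · exact (MeasurableSet.iUnion fun k => (hM k).measurableSet).union
      isClosed_closedBall.measurableSet.compl
  · refine disjoint_left.2 fun x hx hxB => ?_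
    rcases hxB with hxB | hxB
    · exact hx (Or.inl (Or.inr hxB))
    · exact hxB (ball_subset_closedBall (hVR (hWV hx)))
  · refine hGcur.mono fun γ ⟨k, hk⟩ hae t ht => ?_
    by_contra hV'
    rw [← γ.path_eq ht] at hV'
    by_cases hb : γ.path t ∈ closedBall z R
    · exact Curve.not_forall_ae_notMem isOpen_interior (interior_subset.trans
        ((subset_iUnion M k).trans subset_union_left)) ht
        (hCM k ⟨hb, hh.eq_zero _ hV', hk t ht⟩) hae
    · exact Curve.not_forall_ae_notMem isClosed_closedBall.isOpen_compl subset_union_right ht hb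
        hae

end InnerApprox

/-- the minimum of two fine superminimizers in a quasiopen set
`U` is a fine superminimizer in `U` (given that it lies in
`N^{1,p}_{fine-loc}(U)`). -/
theorem min_fineSuperminimizer {X : Type*} [MetricSpace X]
    [CompleteSpace X] [MeasurableSpace X] [BorelSpace X]
    (μ : Measure X) (p : ℝ) (hp : 1 < p)
    (hd : DoublingMeasure μ) (hPI : PoincareInequality μ p)
    (U : Set X) (hU : Quasiopen μ p U) (u v : X → ℝ)
    (hu : FineSuperminimizer μ p u U) (hv : FineSuperminimizer μ p v U)
    (hloc : MemNpFineLoc μ p (fun x => min (u x) (v x)) U) :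
    FineSuperminimizer μ p (fun x => min (u x) (v x)) U := by
  refine ⟨hloc, fun V hV φ hφ hφ0 => ?_⟩
  have hprop : ProperSpace X := hd.properSpace
  have hlf : IsLocallyFiniteMeasure μ := hd.isLocallyFiniteMeasure
  rcases subsingleton_or_nontrivial X with hX | hX
  · have h0 : WUG μ p (fun x => min (u x) (v x)) (fun _ => 0) U :=
      ⟨fun _ => 0, measurable_const, by simp [show 0 < p by linarith], 
        fun γ _ _ s t _ _ _ => by simp [Subsingleton.elim (γ.path s) (γ.path t)]⟩
    refine (fineEnergy_le (by linarith) measurable_const h0 V).trans ?_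
    simp [ENNReal.zero_rpow_of_pos (show 0 < p by linarith)]
  · obtain ⟨r₀, hr₀, hr₁, hcap⟩ :=
      exists_forall_ballCap_univ_ne_zero hp (fun x r hr => (hd.1 x r hr).1) hPI
    obtain ⟨z⟩ := hX.to_nonempty
    obtain ⟨R, hR⟩ := hV.2.2.1.isBounded.subset_ball z
    exact fineSuperminimizer_min_of_hasInnerApprox hp (hu.1 V hV).1 (hv.1 V hV).1 hu hv hV
      (hasInnerApprox_of_finelyOpen hp hr₀ hr₁ hcap hV.1 (subset_closure.trans hR) hφ hφ0)
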